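/- There exists a positive integer n' such that every tree on n ≥ n' vertices is neighborhood-prime. -/

import Mathlib

namespace SimpleGraph

open scoped Classical in
/-- A graph of order `n` is *neighborhood-prime* if there is a bijective labeling of the
vertices by `{1, …, n}` such that for every vertex of degree at least 2, the gcd of the
labels appearing in its neighborhood is 1. -/
noncomputable def IsNeighborhoodPrime {V : Type*} [Fintype V] (G : SimpleGraph V) : Prop :=
  ∃ f : V ≃ Fin (Fintype.card V),
    ∀ v : V, 2 ≤ G.degree v →
      (G.neighborFinset v).gcd (fun u => (f u : ℕ) + 1) = 1

end SimpleGraph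

namespace NbhdPrime

open Finset

lemma exists_parent {V : Type} {G : SimpleGraph V} (hG : G.IsTree) (ρ v : V) (hv : v ≠ ρ) :
    ∃ p, G.Adj v p ∧ G.dist p ρ + 1 = G.dist v ρ ∧
      ∀ w, G.Adj v w → G.dist w ρ + 1 = G.dist v ρ → w = p := by
  obtain ⟨q, hq, hql⟩ := hG.connected.exists_path_of_dist v ρ
  have key : ∀ w, G.Adj v w → G.dist w ρ + 1 = G.dist v ρ → w = q.snd := by
    intro w hw hd
    obtain ⟨r, hr, hrl⟩ := hG.connected.exists_path_of_dist w ρ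
    have h1 : (SimpleGraph.Walk.cons hw r).length = G.dist v ρ := by simp [hrl, hd]
    have h2 := SimpleGraph.Walk.isPath_of_length_eq_dist _ h1
    have := (hG.existsUnique_path v ρ).unique h2 hq
    rw [← this]; simp
  cases q with
  | nil => exact absurd rfl hv
  | @cons _ w _ h r =>
    have hle := SimpleGraph.dist_le r
    have hd : G.dist w ρ + 1 = G.dist v ρ := by
      have h3 := hG.dist_eq_dist_add_one_of_adj ρ h
      rw [SimpleGraph.dist_comm (u := ρ), SimpleGraph.dist_comm (u := ρ) (v := w)] at h3
      simp at hql
      omega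
    exact ⟨w, h, hd, fun x hx hxd => by rw [key x hx hxd]; simp⟩

/-- Neighborhood-primality of a tree reduces to a coprime labelling of a rooted forest, in which
`par u` is the grandparent of `u` when `u` is the child selected by its parent. -/
theorem exists_forest_of_isTree {V : Type} [Fintype V] {G : SimpleGraph V} (hG : G.IsTree)
    (hn : 2 ≤ Fintype.card V) :
    ∃ (par : V → Option V) (d : V → ℕ), (∀ u v, par u = some v → d v + 1 = d u) ∧
      ∀ f : V ≃ Fin (Fintype.card V),
        (∀ u v, par u = some v → Nat.Coprime ((f u : ℕ) + 1) ((f v : ℕ) + 1)) →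
        G.IsNeighborhoodPrime := by
  classical
  have : Nontrivial V := Fintype.one_lt_card_iff_nontrivial.1 hn
  obtain ⟨ρ, hρ⟩ := hG.exists_vert_degree_one_of_nontrivial
  choose! p hp using fun v hv => exists_parent hG ρ v hv
  have hc : ∀ v, ∃ w, v ≠ ρ → (∃ x, G.Adj v x ∧ x ≠ p v) → G.Adj v w ∧ w ≠ p v := by
    intro v
    by_cases h : ∃ x, G.Adj v x ∧ x ≠ p v
    · obtain ⟨x, hx⟩ := h
      exact ⟨x, fun _ _ => hx⟩
    · exact ⟨v, fun _ h' => absurd h' h⟩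
  choose c hc using hc
  refine ⟨fun u => if u ≠ ρ ∧ p u ≠ ρ ∧ u = c (p u) then some (p (p u)) else none,
    fun u => G.dist u ρ / 2, ?_, ?_⟩
  · intro u v h
    simp only at h
    split_ifs at h with h1
    obtain ⟨h1, h2, -⟩ := h1
    cases h
    have := (hp u h1).2.1
    have := (hp _ h2).2.1
    change G.dist (p (p u)) ρ / 2 + 1 = G.dist u ρ / 2
    omega
  · intro f hf
    refine ⟨f, fun v hv => ?_⟩
    have hvρ : v ≠ ρ := by
      rintro rfl
      have : G.degree v = 1 := by convert hρ
      omega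
    have hex : ∃ x, G.Adj v x ∧ x ≠ p v := by
      by_contra! h
      have : G.neighborFinset v ⊆ {p v} := by
        intro x hx
        simpa using h x (by simpa using hx)
      have := Finset.card_le_card this
      simp at this
      omega
    obtain ⟨h1, h2⟩ := hc v hvρ hex
    have hd := hG.dist_eq_dist_add_one_of_adj ρ h1
    rw [SimpleGraph.dist_comm (u := ρ), SimpleGraph.dist_comm (u := ρ) (v := c v)] at hd
    have hd2 : G.dist (c v) ρ = G.dist v ρ + 1 := by
      rcases hd with hd | hd
      · exact absurd ((hp v hvρ).2.2 _ h1 hd.symm) h2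
      · exact hd
    have hcρ : c v ≠ ρ := by
      intro h
      rw [h, SimpleGraph.dist_self] at hd2
      omega
    have hpc : p (c v) = v := ((hp _ hcρ).2.2 v h1.symm hd2.symm).symm
    have := hf (c v) (p v) (by simp [hpc, hcρ, hvρ])
    have e1 := Finset.gcd_dvd (f := fun u => (f u : ℕ) + 1)
      ((SimpleGraph.mem_neighborFinset G v (c v)).2 h1)
    have e2 := Finset.gcd_dvd (f := fun u => (f u : ℕ) + 1)
      ((SimpleGraph.mem_neighborFinset G v (p v)).2 (hp v hvρ).1)
    have e3 := Nat.dvd_gcd e1 e2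
    rw [this.gcd_eq_one] at e3
    convert Nat.dvd_one.1 e3

section Forest

variable {V : Type}

open Classical in
/-- Size of the part hanging at `v` after cutting off every hanging part of size at least `T`. -/
noncomputable def hangSize [Fintype V] (par : V → Option V) (d : V → ℕ) (T D : ℕ)
    (hd : ∀ u v, par u = some v → d v + 1 = d u) (hD : ∀ v, d v ≤ D) (v : V) : ℕ :=
  1 + ∑ c : {c // par c = some v},
    if T ≤ hangSize par d T D hd hD c.1 then 0 else hangSize par d T D hd hD c.1
termination_by D - d v
decreasing_by
  all_goals
    have := hd _ _ c.2
    have := hD c.1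
    omega

/-- Root of the component of `v` once the vertices of `S` are deleted. -/
noncomputable def compRoot (par : V → Option V) (d : V → ℕ)
    (hd : ∀ u v, par u = some v → d v + 1 = d u) (S : Set V) (v : V) : V :=
  open Classical in
  if h : ∃ w, par v = some w ∧ v ∉ S ∧ w ∉ S then compRoot par d hd S h.choose else v
termination_by d v
decreasing_by
  have := hd _ _ h.choose_spec.1
  omega

lemma compRoot_of_edge (par : V → Option V) (d : V → ℕ)
    (hd : ∀ u v, par u = some v → d v + 1 = d u) (S : Set V) {u v : V} (h : par u = some v)
    (hu : u ∉ S) (hv : v ∉ S) : compRoot par d hd S u = compRoot par d hd S v := by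
  have hex : ∃ w, par u = some w ∧ u ∉ S ∧ w ∉ S := ⟨v, h, hu, hv⟩
  have hc : hex.choose = v := by
    have := hex.choose_spec.1
    exact (Option.some.inj (h.symm.trans this)).symm
  rw [compRoot, dif_pos hex, hc]

lemma eq_compRoot_or (par : V → Option V) (d : V → ℕ)
    (hd : ∀ u v, par u = some v → d v + 1 = d u) (S : Set V) (u : V) :
    compRoot par d hd S u = u ∨ ∃ w, par u = some w ∧ u ∉ S ∧ w ∉ S := by
  by_cases hex : ∃ w, par u = some w ∧ u ∉ S ∧ w ∉ S
  · exact Or.inr hex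
  · left
    rw [compRoot, dif_neg hex]

open Classical in
lemma sum_children [Fintype V] (par : V → Option V) (F : Finset V) (t : V → ℕ) :
    ∑ v ∈ F, ∑ c : {c // par c = some v}, t c.1 = ∑ c with ∃ w ∈ F, par c = some w, t c := by
  have h1 : ∀ v, ∑ c : {c // par c = some v}, t c.1 = ∑ c with par c = some v, t c := by
    intro v
    exact (Finset.sum_subtype _ (by simp) _).symm
  simp_rw [h1]
  rw [← Finset.sum_biUnion]
  · apply Finset.sum_congr _ (fun _ _ => rfl)
    ext c
    simp
  · intro a _ b _ hab
    rw [Function.onFun, Finset.disjoint_filter]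
    intro x _ h1 h2
    exact hab (Option.some.inj (h1.symm.trans h2))

open Classical in
/-- A rooted forest has a set of at most `n / T` vertices whose deletion leaves components with
at most `T` vertices. -/
theorem exists_separator [Fintype V] (par : V → Option V) (d : V → ℕ)
    (hd : ∀ u v, par u = some v → d v + 1 = d u) (T : ℕ) :
    ∃ (S : Finset V) (κ : V → V), #S * T ≤ Fintype.card V ∧
      (∀ u v, par u = some v → u ∉ S → v ∉ S → κ u = κ v) ∧
      ∀ x, #{v | v ∉ S ∧ κ v = x} ≤ T := by
  obtain ⟨D, hD⟩ : ∃ D, ∀ v, d v ≤ D :=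
    ⟨∑ v, d v, fun v => Finset.single_le_sum (f := d) (fun _ _ => Nat.zero_le _) (mem_univ v)⟩
  set t := hangSize par d T D hd hD with ht
  have ht' : ∀ v, t v = 1 + ∑ c : {c // par c = some v}, if T ≤ t c.1 then 0 else t c.1 := by
    intro v
    rw [ht, hangSize]
  set S : Finset V := {v | T ≤ t v} with hS
  have hmS : ∀ v, v ∈ S ↔ T ≤ t v := fun v => by simp [hS]
  have hsum : ∀ F : Finset V, ∑ v ∈ F, t v = #F +
      ∑ c with ∃ w ∈ F, par c = some w, if T ≤ t c then 0 else t c := by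
    intro F
    have := sum_children par F (fun c => if T ≤ t c then 0 else t c)
    rw [Finset.sum_congr rfl fun v _ => ht' v, Finset.sum_add_distrib, this]
    simp
  refine ⟨S, compRoot par d hd S, ?_, ?_, ?_⟩
  · have h1 := hsum univ
    have h2 : ∀ (q : V → Prop) [DecidablePred q], ∑ c with q c, (if T ≤ t c then 0 else t c) ≤
        ∑ c, if T ≤ t c then 0 else t c :=
      fun q _ => Finset.sum_le_sum_of_subset (Finset.filter_subset _ _)
    have h3 : ∑ c, t c = ∑ c ∈ S, t c + ∑ c, if T ≤ t c then 0 else t c := by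
      rw [hS, Finset.sum_filter, ← Finset.sum_add_distrib]
      exact Finset.sum_congr rfl fun v _ => by split_ifs <;> simp
    have h4 : #S * T ≤ ∑ c ∈ S, t c := by
      rw [← smul_eq_mul]
      exact Finset.card_nsmul_le_sum _ _ _ fun v hv => (hmS v).1 hv
    rw [Finset.card_univ] at h1
    have h5 := h1.le.trans (Nat.add_le_add_left (h2 _) _)
    omega
  · intro u v h hu hv
    exact compRoot_of_edge par d hd S h (by simpa using hu) (by simpa using hv)
  · intro x
    set F : Finset V := {v | v ∉ S ∧ compRoot par d hd S v = x} with hF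
    have h1 := hsum F
    have h2 : ∑ c ∈ F.erase x, t c ≤
        ∑ c with ∃ w ∈ F, par c = some w, (if T ≤ t c then 0 else t c) := by
      have : ∑ c ∈ F.erase x, t c = ∑ c ∈ F.erase x, if T ≤ t c then 0 else t c := by
        refine Finset.sum_congr rfl fun c hc => ?_
        simp only [hF, mem_erase, mem_filter, mem_univ, true_and, hmS] at hc
        rw [if_neg hc.2.1]
      rw [this]
      refine Finset.sum_le_sum_of_subset fun c hc => ?_
      simp only [hF, mem_erase, mem_filter, mem_univ, true_and] at hc ⊢
      rcases eq_compRoot_or par d hd S c with h | ⟨w, hw, hc1, hw1⟩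
      · exact absurd (h.symm.trans hc.2.2) hc.1
      · exact ⟨w, ⟨by simpa using hw1,
          (compRoot_of_edge par d hd S hw hc1 hw1).symm.trans hc.2.2⟩, hw⟩
    by_cases hxF : x ∈ F
    · have h3 := Finset.add_sum_erase _ t hxF
      have h4 : t x < T := by
        have := (hmS x).not.1 (by simp only [hF, mem_filter] at hxF; exact hxF.2.1)
        omega
      omega
    · rw [Finset.erase_eq_of_notMem hxF] at h2
      omega

end Forest

section Balance

variable {V : Type}

open Classical in
lemma exists_even_split (I : Finset V) {M : ℕ} (hM : 0 < M) :
    ∃ g : V → Fin M, ∀ j, |((#{x ∈ I | g x = j} * M : ℕ) : ℤ) - #I| ≤ M := by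
  refine ⟨fun x => if h : x ∈ I then ⟨(I.equivFin ⟨x, h⟩ : ℕ) % M, Nat.mod_lt _ hM⟩ else ⟨0, hM⟩,
    fun j => ?_⟩
  have h1 : #{x ∈ I | (if h : x ∈ I then (⟨(I.equivFin ⟨x, h⟩ : ℕ) % M, Nat.mod_lt _ hM⟩ : Fin M)
      else ⟨0, hM⟩) = j} = (#I).count (· ≡ j [MOD M]) := by
    rw [Nat.count_eq_card_filter_range]
    refine Finset.card_bij (fun x hx => (I.equivFin ⟨x, (mem_filter.1 hx).1⟩ : ℕ)) ?_ ?_ ?_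
    · intro x hx
      obtain ⟨hx1, hx2⟩ := mem_filter.1 hx
      rw [dif_pos hx1] at hx2
      rw [mem_filter, mem_range]
      refine ⟨Fin.is_lt _, ?_⟩
      rw [Nat.ModEq, Nat.mod_eq_of_lt j.2]
      exact congrArg Fin.val hx2
    · intro x hx y hy h
      have := I.equivFin.injective (Fin.ext h)
      exact congrArg Subtype.val this
    · intro k hk
      obtain ⟨hk1, hk2⟩ := mem_filter.1 hk
      rw [mem_range] at hk1
      refine ⟨(I.equivFin.symm ⟨k, hk1⟩).1, ?_, by simp⟩
      rw [mem_filter]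
      refine ⟨(I.equivFin.symm ⟨k, hk1⟩).2, ?_⟩
      rw [dif_pos (I.equivFin.symm ⟨k, hk1⟩).2]
      apply Fin.ext
      simp only [Subtype.coe_eta, Equiv.apply_symm_apply]
      rw [Nat.ModEq, Nat.mod_eq_of_lt j.2] at hk2
      exact hk2
  rw [h1, Nat.count_modEq_card _ hM]
  have h2 := Nat.div_add_mod (#I) M
  have h3 := Nat.mod_lt (#I) hM
  generalize #I / M = q at h2 ⊢
  have h4 : (M : ℤ) * q + ((#I % M : ℕ) : ℤ) = #I := by exact_mod_cast h2
  rw [abs_le]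
  split_ifs <;> push_cast <;> constructor <;> nlinarith [h4, h3]

open Classical in
lemma exists_even_split_two [Fintype V] (a b : V → ℕ) {T M : ℕ} (hM : 0 < M) (ha : ∀ x, a x ≤ T)
    (hb : ∀ x, b x ≤ T) :
    ∃ g : V → Fin M, ∀ j,
      |((∑ x with g x = j, a x : ℕ) : ℤ) * M - ((∑ x, a x : ℕ) : ℤ)| ≤ M * (T + 1) ^ 3 ∧
      |((∑ x with g x = j, b x : ℕ) : ℤ) * M - ((∑ x, b x : ℕ) : ℤ)| ≤ M * (T + 1) ^ 3 := by
  choose g hg using fun t : ℕ × ℕ =>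
    exists_even_split (Finset.univ.filter fun x => (a x, b x) = t) hM
  have key : ∀ (j : Fin M) (c : ℕ × ℕ → ℕ), (∀ t ∈ range (T + 1) ×ˢ range (T + 1), c t ≤ T) →
      |((∑ x with g (a x, b x) x = j, c (a x, b x) : ℕ) : ℤ) * M -
        ((∑ x, c (a x, b x) : ℕ) : ℤ)| ≤ M * (T + 1) ^ 3 := by
    intro j c hc
    have hmaps : ∀ x : V, (a x, b x) ∈ range (T + 1) ×ˢ range (T + 1) := by
      intro x
      have := ha x
      have := hb x
      simp only [mem_product, mem_range]
      omega
    have h1 : ∑ x with g (a x, b x) x = j, c (a x, b x) = ∑ t ∈ range (T + 1) ×ˢ range (T + 1),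
        #{x ∈ Finset.univ.filter (fun x => (a x, b x) = t) | g t x = j} * c t := by
      rw [← Finset.sum_fiberwise_of_maps_to (fun x _ => hmaps x)]
      refine Finset.sum_congr rfl fun t _ => ?_
      rw [← smul_eq_mul, ← Finset.sum_const]
      refine Finset.sum_congr ?_ ?_
      · ext x
        simp only [mem_filter, mem_univ, true_and]
        constructor
        · rintro ⟨h1, h2⟩; subst h2; exact ⟨rfl, h1⟩
        · rintro ⟨h1, h2⟩; subst h1; exact ⟨h2, rfl⟩
      · intro x hx
        simp only [mem_filter, mem_univ, true_and] at hx
        rw [hx.1]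
    have h2 : ∑ x, c (a x, b x) = ∑ t ∈ range (T + 1) ×ˢ range (T + 1),
        #(Finset.univ.filter (fun x => (a x, b x) = t)) * c t := by
      rw [← Finset.sum_fiberwise_of_maps_to (fun x _ => hmaps x)]
      refine Finset.sum_congr rfl fun t _ => ?_
      rw [← smul_eq_mul, ← Finset.sum_const]
      refine Finset.sum_congr rfl ?_
      intro x hx
      simp only [mem_filter, mem_univ, true_and] at hx
      rw [hx]
    rw [h1, h2]
    push_cast
    rw [Finset.sum_mul, ← Finset.sum_sub_distrib]
    refine (Finset.abs_sum_le_sum_abs _ _).trans ?_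
    have h3 : ∀ t ∈ range (T + 1) ×ˢ range (T + 1),
        |((#{x ∈ Finset.univ.filter (fun x => (a x, b x) = t) | g t x = j} : ℕ) : ℤ) * c t * M -
          (#(Finset.univ.filter (fun x => (a x, b x) = t)) : ℤ) * c t| ≤ M * (T + 1) := by
      intro t ht
      have e1 := hg t j
      push_cast at e1
      have e2 : (c t : ℤ) ≤ T + 1 := by have := hc t ht; omega
      rw [show ∀ p q r s : ℤ, p * q * r - s * q = (p * r - s) * q by intros; ring, abs_mul,
        Nat.abs_cast]
      exact mul_le_mul e1 e2 (by positivity) (by positivity)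
    refine (Finset.sum_le_sum h3).trans ?_
    rw [Finset.sum_const, card_product, card_range, nsmul_eq_mul]
    push_cast
    apply le_of_eq
    ring
  refine ⟨fun x => g (a x, b x) x, fun j => ⟨key j (fun t => t.1) ?_, key j (fun t => t.2) ?_⟩⟩
  · intro t ht; simp only [mem_product, mem_range] at ht; omega
  · intro t ht; simp only [mem_product, mem_range] at ht; omega

open Classical in
/-- Groups of at most `T` elements can be distributed over `M` slots so that two given sets are
both evenly spread. -/
theorem exists_balanced [Fintype V] (κ : V → V) (A B : Finset V) {T M : ℕ} (hM : 0 < M)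
    (hA : ∀ x, #{v ∈ A | κ v = x} ≤ T) (hB : ∀ x, #{v ∈ B | κ v = x} ≤ T) :
    ∃ g : V → Fin M, ∀ j,
      |((#{v ∈ A | g (κ v) = j} : ℕ) : ℤ) * M - (#A : ℤ)| ≤ M * (T + 1) ^ 3 ∧
      |((#{v ∈ B | g (κ v) = j} : ℕ) : ℤ) * M - (#B : ℤ)| ≤ M * (T + 1) ^ 3 := by
  obtain ⟨g, hg⟩ := exists_even_split_two _ _ hM hA hB
  have h1 : ∀ A : Finset V, ∑ x, #{v ∈ A | κ v = x} = #A := fun A =>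
    (Finset.card_eq_sum_card_fiberwise (fun x _ => mem_univ _)).symm
  have h2 : ∀ (A : Finset V) j, ∑ x with g x = j, #{v ∈ A | κ v = x} = #{v ∈ A | g (κ v) = j} := by
    intro A j
    rw [Finset.card_eq_sum_card_fiberwise (f := κ) (t := Finset.univ.filter fun x => g x = j)
      (fun x hx => by simp at hx ⊢; exact hx.2)]
    refine Finset.sum_congr rfl fun x hx => ?_
    congr 1
    ext v
    simp only [mem_filter, mem_univ, true_and] at hx ⊢
    constructor
    · rintro ⟨h1, rfl⟩; exact ⟨⟨h1, hx⟩, rfl⟩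
    · rintro ⟨⟨h1, -⟩, rfl⟩; exact ⟨h1, rfl⟩
  refine ⟨g, fun j => ?_⟩
  have := hg j
  rw [h1, h1, h2, h2] at this
  exact this

end Balance

lemma exists_card_le_eq (L : Finset ℕ) (k : ℕ) (hk : 1 ≤ k) (hkL : k ≤ #L) :
    ∃ l ∈ L, #{m ∈ L | m ≤ l} = k := by
  induction L using Finset.induction_on_max with
  | empty => simp at hkL; omega
  | insert a s ha ih =>
    have has : a ∉ s := fun h => (ha a h).false
    rw [card_insert_of_notMem has] at hkL
    rcases Nat.lt_or_ge (#s) k with h | h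
    · refine ⟨a, mem_insert_self _ _, ?_⟩
      rw [filter_true_of_mem, card_insert_of_notMem has]
      · omega
      · intro x hx
        rcases mem_insert.1 hx with rfl | hx
        · exact le_rfl
        · exact (ha x hx).le
    · obtain ⟨l, hl, h1⟩ := ih h
      refine ⟨l, mem_insert_of_mem hl, ?_⟩
      rw [filter_insert, if_neg (by have := ha l hl; omega), h1]

/-- Labels from `L` can be assigned to `X` in order of decreasing weight. -/
lemma exists_sorted_assignment {V : Type} [DecidableEq V] (X : Finset V) (w : V → ℕ)
    (L : Finset ℕ) (hcard : #X ≤ #L) :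
    ∃ f : V → ℕ, Set.InjOn f X ∧ (∀ v ∈ X, f v ∈ L) ∧
      ∀ v ∈ X, #{l ∈ L | l ≤ f v} ≤ #{v' ∈ X | w v ≤ w v'} := by
  induction X using Finset.induction_on_min_value w with
  | empty => exact ⟨fun _ => 0, by simp, by simp, by simp⟩
  | insert a s has hmin ih =>
    rw [card_insert_of_notMem has] at hcard
    obtain ⟨f, hf1, hf2, hf3⟩ := ih (by omega)
    obtain ⟨l, hl, hlc⟩ := exists_card_le_eq L (#s + 1) (by omega) hcard
    have hne : ∀ v ∈ s, f v ≠ l := by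
      intro v hv h
      have h1 := hf3 v hv
      rw [h, hlc] at h1
      have := card_filter_le s (fun v' => w v ≤ w v')
      omega
    have hva : ∀ v ∈ s, v ≠ a := fun v hv h => has (h ▸ hv)
    refine ⟨Function.update f a l, ?_, ?_, ?_⟩
    · rw [coe_insert, Set.injOn_insert (by simpa using has)]
      constructor
      · refine hf1.congr fun v hv => ?_
        rw [Function.update_of_ne (hva v hv)]
      · rintro ⟨v, hv, h⟩
        rw [Function.update_of_ne (hva v hv), Function.update_self] at h
        exact hne v hv h
    · intro v hv
      rcases mem_insert.1 hv with rfl | hv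
      · simpa using hl
      · rw [Function.update_of_ne (hva v hv)]
        exact hf2 v hv
    · intro v hv
      rcases mem_insert.1 hv with rfl | hv
      · rw [Function.update_self, hlc, filter_true_of_mem, card_insert_of_notMem has]
        intro x hx
        rcases mem_insert.1 hx with rfl | hx
        · exact le_rfl
        · exact hmin x hx
      · rw [Function.update_of_ne (hva v hv)]
        refine (hf3 v hv).trans (card_le_card ?_)
        exact filter_subset_filter _ (subset_insert _ _)

/-- Layer-cake bound: for a sorted assignment the vertices whose label is divisible by `p` carry
about the expected share of the total weight. -/
theorem exists_sorted_labelling {V : Type} [DecidableEq V] (X : Finset V) (w : V → ℕ)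
    (L : Finset ℕ) (K T : ℕ) (hcard : #X ≤ #L) (hT : ∀ v ∈ X, w v ≤ T)
    (hreg : ∀ l ∈ L, l ≤ K * #{m ∈ L | m ≤ l}) :
    ∃ f : V → ℕ, Set.InjOn f X ∧ (∀ v ∈ X, f v ∈ L) ∧
      ∀ p, (∀ m, p * #{l ∈ L | l ≤ K * m ∧ p ∣ l} ≤ 2 * m + p) →
        p * ∑ v ∈ X with p ∣ f v, w v ≤ 2 * ∑ v ∈ X, w v + p * T := by
  obtain ⟨f, hf1, hf2, hf3⟩ := exists_sorted_assignment X w L hcard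
  refine ⟨f, hf1, hf2, fun p hp => ?_⟩
  have hlayer : ∀ Z ⊆ X, ∑ v ∈ Z, w v = ∑ s ∈ range T, #{v ∈ Z | s < w v} := by
    intro Z hZ
    simp_rw [card_filter]
    rw [sum_comm]
    refine sum_congr rfl fun v hv => ?_
    have h1 := hT v (hZ hv)
    rw [← card_filter]
    have : filter (fun s => s < w v) (range T) = range (w v) := by
      ext s; simp only [mem_filter, mem_range]; omega
    rw [this, card_range]
  rw [hlayer _ (filter_subset _ _), hlayer X (Subset.refl _), mul_sum, mul_sum]
  have h2 : ∀ s ∈ range T, p * #{v ∈ X.filter (fun v => p ∣ f v) | s < w v} ≤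
      2 * #{v ∈ X | s < w v} + p := by
    intro s _
    refine le_trans (Nat.mul_le_mul_left p ?_) (hp #{v ∈ X | s < w v})
    refine card_le_card_of_injOn f ?_ (hf1.mono ?_)
    · intro v hv
      simp only [coe_filter, mem_filter, Set.mem_ofPred_eq] at hv ⊢
      refine ⟨hf2 v hv.1.1, ?_, hv.1.2⟩
      refine (hreg _ (hf2 v hv.1.1)).trans (Nat.mul_le_mul_left K ((hf3 v hv.1.1).trans ?_))
      refine card_le_card fun x hx => ?_
      simp only [mem_filter] at hx ⊢
      exact ⟨hx.1, by omega⟩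
    · intro v hv
      simp only [coe_filter, mem_filter, Set.mem_ofPred_eq] at hv
      exact hv.1.1
  refine (sum_le_sum h2).trans ?_
  rw [sum_add_distrib, sum_const, card_range, smul_eq_mul, mul_comm T p]

section Matching

variable {α β : Type}

lemma exists_injOn_of_hall [DecidableEq α] [DecidableEq β] [Nonempty β] (X : Finset α)
    (N : α → Finset β) (h : ∀ A ⊆ X, #A ≤ #(A.biUnion N)) :
    ∃ g : α → β, Set.InjOn g X ∧ ∀ v ∈ X, g v ∈ N v := by
  have := (Finset.all_card_le_biUnion_card_iff_exists_injective (fun v : X => N v.1)).1 (by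
    intro s
    have h1 := h (s.map (Function.Embedding.subtype _)) (by
      intro x hx
      obtain ⟨y, -, rfl⟩ := mem_map.1 hx
      exact y.2)
    rw [card_map] at h1
    refine h1.trans (card_le_card ?_)
    intro x hx
    simp only [mem_biUnion, mem_map] at hx ⊢
    obtain ⟨_, ⟨y, hy, rfl⟩, hx⟩ := hx
    exact ⟨y, hy, hx⟩)
  obtain ⟨f, hf1, hf2⟩ := this
  refine ⟨fun v => if h : v ∈ X then f ⟨v, h⟩ else Classical.arbitrary β, ?_, ?_⟩
  · intro v hv w hw hvw
    have hv' : v ∈ X := hv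
    have hw' : w ∈ X := hw
    simp only [hv', hw', dite_true] at hvw
    exact congrArg Subtype.val (hf1 hvw)
  · intro v hv
    simp only [hv, dite_true]
    exact hf2 ⟨v, hv⟩

open Classical in
lemma exists_matching_of_half [Nonempty β] (X : Finset α) (L : Finset β) (bad : α → β → Prop)
    (hXL : #X ≤ #L) (hX : ∀ v ∈ X, 2 * #{x ∈ L | bad v x} ≤ #L)
    (hL : ∀ x ∈ L, 2 * #{v ∈ X | bad v x} ≤ #L) :
    ∃ g : α → β, Set.InjOn g X ∧ ∀ v ∈ X, g v ∈ L ∧ ¬ bad v (g v) := by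
  obtain ⟨g, hg1, hg2⟩ := exists_injOn_of_hall X (fun v => L.filter fun x => ¬ bad v x) (by
    intro A hA
    rcases A.eq_empty_or_nonempty with rfl | ⟨v, hv⟩
    · simp
    by_cases h : 2 * #A ≤ #L
    · have h1 : #(L.filter fun x => ¬ bad v x) ≤ #(A.biUnion fun v => L.filter fun x => ¬ bad v x) :=
        card_le_card fun x hx => mem_biUnion.2 ⟨v, hv, hx⟩
      have h2 := hX v (hA hv)
      have h3 := card_filter_add_card_filter_not (s := L) (fun x => bad v x)
      omega
    · have h1 : L ⊆ A.biUnion fun v => L.filter fun x => ¬ bad v x := by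
        intro x hx
        by_contra hcon
        have h2 : A ⊆ X.filter fun v => bad v x := by
          intro w hw
          rw [mem_filter]
          refine ⟨hA hw, ?_⟩
          by_contra hb
          exact hcon (mem_biUnion.2 ⟨w, hw, mem_filter.2 ⟨hx, hb⟩⟩)
        have := card_le_card h2
        have := hL x hx
        omega
      exact ((card_le_card hA).trans hXL).trans (card_le_card h1))
  exact ⟨g, hg1, fun v hv => mem_filter.1 (hg2 v hv)⟩

open Classical in
lemma exists_matching_of_few [Nonempty β] (X : Finset α) (L : Finset β) (bad : α → β → Prop)
    (K : ℕ) (hXL : #X + K ≤ #L) (hX : ∀ v ∈ X, #{x ∈ L | bad v x} ≤ K) :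
    ∃ g : α → β, Set.InjOn g X ∧ ∀ v ∈ X, g v ∈ L ∧ ¬ bad v (g v) := by
  obtain ⟨g, hg1, hg2⟩ := exists_injOn_of_hall X (fun v => L.filter fun x => ¬ bad v x) (by
    intro A hA
    rcases A.eq_empty_or_nonempty with rfl | ⟨v, hv⟩
    · simp
    have h1 : #(L.filter fun x => ¬ bad v x) ≤ #(A.biUnion fun v => L.filter fun x => ¬ bad v x) :=
      card_le_card fun x hx => mem_biUnion.2 ⟨v, hv, hx⟩
    have h2 := hX v (hA hv)
    have h3 := card_filter_add_card_filter_not (s := L) (fun x => bad v x)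
    have h4 := card_le_card hA
    omega)
  exact ⟨g, hg1, fun v hv => mem_filter.1 (hg2 v hv)⟩

open Classical in
/-- Matching vertices to labels when vertices and labels are split into classes: labels in ordinary
classes go to vertices of the same class, labels in classes satisfying `C` may go anywhere. -/
theorem exists_class_matching {ι : Type} [Fintype ι] [DecidableEq ι] [Nonempty β] (Y : Finset α) (L : Finset β)
    (hYL : #Y = #L) (cls : α → ι) (res : β → ι) (C : ι → Prop) [DecidablePred C] (U : Finset α) (hUY : U ⊆ Y)
    (Q : Finset β) (hQL : Q ⊆ L) (hQC : ∀ x ∈ Q, C (res x)) (bad : α → β → Prop) (K W : ℕ)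
    (h1 : ∀ r, ¬ C r → #{x ∈ L | res x = r} ≤ #{v ∈ Y | cls v = r ∧ v ∉ U})
    (h2 : ∀ v ∈ Y, v ∉ U → ¬ C (cls v) →
      2 * #{x ∈ L | res x = cls v ∧ bad v x} ≤ #{x ∈ L | res x = cls v})
    (h3 : ∀ x ∈ L, ¬ C (res x) →
      2 * #{v ∈ Y | cls v = res x ∧ bad v x} ≤ #{y ∈ L | res y = res x})
    (hUQ : #U + K ≤ #Q) (hU : ∀ v ∈ U, #{x ∈ Q | bad v x} ≤ K)
    (hW : W + #U + #{x ∈ L | ¬ C (res x)} ≤ #Y)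
    (hW1 : ∀ v ∈ Y, v ∉ U → 2 * #{x ∈ L | C (res x) ∧ bad v x} ≤ W)
    (hW2 : ∀ x ∈ L, C (res x) →
      2 * (#{v ∈ Y | C (cls v) ∧ bad v x} + #{v ∈ Y | ¬ C (cls v)}) ≤
        W + 2 * #{y ∈ L | ¬ C (res y)}) :
    ∃ g : α → β, Set.InjOn g Y ∧
      ∀ v ∈ Y, g v ∈ L ∧ (res (g v) = cls v ∨ C (res (g v))) ∧ ¬ bad v (g v) := by
  have hVr : ∀ r, ∃ S ⊆ {v ∈ Y | cls v = r ∧ v ∉ U}, #S = if C r then 0 else #{x ∈ L | res x = r} := by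
    intro r
    apply exists_subset_card_eq
    split_ifs with h
    · exact Nat.zero_le _
    · exact h1 r h
  choose S hS1 hS2 using hVr
  have hS : ∀ r v, v ∈ S r → v ∈ Y ∧ cls v = r ∧ v ∉ U := by
    intro r v hv
    have := hS1 r hv
    simpa using this
  have hSC : ∀ r v, v ∈ S r → ¬ C r := by
    intro r v hv h
    have := hS2 r
    rw [if_pos h, card_eq_zero] at this
    rw [this] at hv
    simp at hv
  have hg1 : ∀ r, ∃ g : α → β, Set.InjOn g (S r) ∧
      ∀ v ∈ S r, g v ∈ L.filter (fun x => res x = r) ∧ ¬ bad v (g v) := by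
    intro r
    by_cases hr : C r
    · refine ⟨fun _ => Classical.arbitrary β, fun v hv => absurd hr (hSC r v hv), fun v hv => absurd hr (hSC r v hv)⟩
    have hc := hS2 r
    rw [if_neg hr] at hc
    apply exists_matching_of_half _ _ _ hc.le
    · intro v hv
      obtain ⟨e1, e2, e3⟩ := hS r v hv
      have := h2 v e1 e3 (e2 ▸ hr)
      rw [e2] at this
      rwa [filter_filter]
    · intro x hx
      obtain ⟨e1, e2⟩ := mem_filter.1 hx
      have := h3 x e1 (e2 ▸ hr)
      rw [e2] at this
      refine le_trans (Nat.mul_le_mul_left 2 (card_le_card fun v hv => ?_)) this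
      obtain ⟨e3, e4⟩ := mem_filter.1 hv
      exact mem_filter.2 ⟨(hS r v e3).1, (hS r v e3).2.1, e4⟩
  choose g1 hg1i hg1 using hg1
  obtain ⟨g2, hg2i, hg2⟩ := exists_matching_of_few U Q bad K hUQ hU
  set V1 : Finset α := {v ∈ Y | v ∈ S (cls v)} with hV1
  have hV1c : #V1 = #{x ∈ L | ¬ C (res x)} := by
    rw [card_eq_sum_card_fiberwise (f := cls) (t := univ) (fun x _ => mem_univ _),
      card_eq_sum_card_fiberwise (f := res) (t := univ) (fun x _ => mem_univ _)]
    refine sum_congr rfl fun r _ => ?_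
    have e1 : V1.filter (fun v => cls v = r) = S r := by
      ext v
      simp only [hV1, mem_filter]
      constructor
      · rintro ⟨⟨-, h⟩, rfl⟩; exact h
      · intro h
        obtain ⟨e1, rfl, e3⟩ := hS r v h
        exact ⟨⟨e1, h⟩, rfl⟩
    rw [e1, hS2, filter_filter]
    split_ifs with hr
    · symm
      rw [card_eq_zero, filter_eq_empty_iff]
      rintro x - ⟨h, rfl⟩
      exact h hr
    · congr 1
      ext x
      simp only [mem_filter]
      constructor
      · rintro ⟨h, rfl⟩; exact ⟨h, hr, rfl⟩
      · rintro ⟨h, -, h'⟩; exact ⟨h, h'⟩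
  set W1 : Finset α := (Y \ U) \ V1 with hW1d
  set L2 : Finset β := {x ∈ L | C (res x)} \ U.image g2 with hL2
  have hV1U : V1 ⊆ Y \ U := by
    intro v hv
    have hv := (mem_filter.1 hv).2
    rw [mem_sdiff]
    exact ⟨(hS _ v hv).1, (hS _ v hv).2.2⟩
  have cW1 : #W1 + #V1 + #U = #Y := by
    have e1 := card_sdiff_add_card_eq_card hV1U
    have e2 := card_sdiff_add_card_eq_card hUY
    rw [hW1d]
    omega
  have cL2 : #L2 + #U + #{x ∈ L | ¬ C (res x)} = #L := by
    have e0 : U.image g2 ⊆ {x ∈ L | C (res x)} := by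
      intro x hx
      obtain ⟨v, hv, rfl⟩ := mem_image.1 hx
      exact mem_filter.2 ⟨hQL (hg2 v hv).1, hQC _ (hg2 v hv).1⟩
    have e1 := card_sdiff_add_card_eq_card e0
    rw [card_image_of_injOn hg2i] at e1
    have e3 := card_filter_add_card_filter_not (s := L) (fun x => C (res x))
    rw [hL2]
    omega
  obtain ⟨g3, hg3i, hg3⟩ := exists_matching_of_half W1 L2 bad (by omega) (by
    intro v hv
    simp only [hW1d, mem_sdiff] at hv
    have e1 := hW1 v hv.1.1 hv.1.2
    have e2 : #{x ∈ L2 | bad v x} ≤ #{x ∈ L | C (res x) ∧ bad v x} := by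
      refine card_le_card fun x hx => ?_
      simp only [hL2, mem_filter, mem_sdiff] at hx
      exact mem_filter.2 ⟨hx.1.1.1, hx.1.1.2, hx.2⟩
    omega) (by
    intro x hx
    simp only [hL2, mem_filter, mem_sdiff] at hx
    have e1 := hW2 x hx.1.1 hx.1.2
    have e2 : #{v ∈ W1 | bad v x} ≤
        #{v ∈ Y | C (cls v) ∧ bad v x} + #(({v ∈ Y | ¬ C (cls v)} : Finset α) \ V1) := by
      refine le_trans (card_le_card ?_) (card_union_le _ _)
      intro v hv
      simp only [hW1d, mem_filter, mem_sdiff, mem_union] at hv ⊢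
      by_cases hc : C (cls v)
      · exact Or.inl ⟨hv.1.1.1, hc, hv.2⟩
      · exact Or.inr ⟨⟨hv.1.1.1, hc⟩, hv.1.2⟩
    have e3 : V1 ⊆ ({v ∈ Y | ¬ C (cls v)} : Finset α) := by
      intro v hv
      have hv := mem_filter.1 hv
      exact mem_filter.2 ⟨hv.1, hSC _ v hv.2⟩
    have e4 := card_sdiff_add_card_eq_card e3
    omega)
  have hL2m : ∀ x ∈ L2, x ∈ L ∧ C (res x) ∧ x ∉ U.image g2 := by
    intro x hx
    simpa [hL2, and_assoc] using hx
  have h1m : ∀ v ∈ V1, g1 (cls v) v ∈ L ∧ res (g1 (cls v) v) = cls v ∧ ¬ C (cls v) ∧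
      ¬ bad v (g1 (cls v) v) := by
    intro v hv
    have hv := (mem_filter.1 hv).2
    have := hg1 _ v hv
    exact ⟨(mem_filter.1 this.1).1, (mem_filter.1 this.1).2, hSC _ v hv, this.2⟩
  have hV1n : ∀ v ∈ V1, v ∉ U := fun v hv => (mem_sdiff.1 (hV1U hv)).2
  set g : α → β := fun v => if v ∈ U then g2 v else if v ∈ V1 then g1 (cls v) v else g3 v with hg
  have hgU : ∀ v, v ∈ U → g v = g2 v := fun v hv => by simp [hg, hv]
  have hgV : ∀ v, v ∈ V1 → g v = g1 (cls v) v := fun v hv => by simp [hg, hv, hV1n v hv]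
  have hgW : ∀ v, v ∈ Y → v ∉ U → v ∉ V1 → v ∈ W1 ∧ g v = g3 v := fun v hy hu hv => by
    simp [hg, hW1d, hv, hu, hy]
  refine ⟨g, ?_, ?_⟩
  · have d12 : ∀ v ∈ U, ∀ w ∈ V1, g v ≠ g w := by
      intro v hv w hw h
      rw [hgU v hv, hgV w hw] at h
      have e1 := hQC _ (hg2 v hv).1
      have e2 := h1m w hw
      rw [h, e2.2.1] at e1
      exact e2.2.2.1 e1
    have d13 : ∀ v ∈ U, ∀ w ∈ Y, w ∉ U → w ∉ V1 → g v ≠ g w := by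
      intro v hv w hw1 hw2 hw3 h
      obtain ⟨e1, e2⟩ := hgW w hw1 hw2 hw3
      rw [hgU v hv, e2] at h
      exact (hL2m _ (hg3 w e1).1).2.2 (h ▸ mem_image_of_mem _ hv)
    have d23 : ∀ v ∈ V1, ∀ w ∈ Y, w ∉ U → w ∉ V1 → g v ≠ g w := by
      intro v hv w hw1 hw2 hw3 h
      obtain ⟨e1, e2⟩ := hgW w hw1 hw2 hw3
      rw [hgV v hv, e2] at h
      have e3 := (hL2m _ (hg3 w e1).1).2.1
      have e4 := h1m v hv
      rw [← h, e4.2.1] at e3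
      exact e4.2.2.1 e3
    intro v hv w hw h
    by_cases hvU : v ∈ U <;> by_cases hwU : w ∈ U
    · rw [hgU v hvU, hgU w hwU] at h
      exact hg2i hvU hwU h
    · by_cases hwV : w ∈ V1
      · exact absurd h (d12 v hvU w hwV)
      · exact absurd h (d13 v hvU w hw hwU hwV)
    · by_cases hvV : v ∈ V1
      · exact absurd h.symm (d12 w hwU v hvV)
      · exact absurd h.symm (d13 w hwU v hv hvU hvV)
    · by_cases hvV : v ∈ V1 <;> by_cases hwV : w ∈ V1
      · rw [hgV v hvV, hgV w hwV] at h
        have e1 := (h1m v hvV).2.1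
        have e2 := (h1m w hwV).2.1
        rw [h, e2] at e1
        rw [← e1] at h
        refine hg1i (cls w) ?_ (mem_filter.1 hwV).2 h
        rw [e1]
        exact (mem_filter.1 hvV).2
      · exact absurd h (d23 v hvV w hw hwU hwV)
      · exact absurd h.symm (d23 w hwV v hv hvU hvV)
      · obtain ⟨e1, e2⟩ := hgW v hv hvU hvV
        obtain ⟨e3, e4⟩ := hgW w hw hwU hwV
        rw [e2, e4] at h
        exact hg3i e1 e3 h
  · intro v hv
    by_cases hvU : v ∈ U
    · rw [hgU v hvU]
      exact ⟨hQL (hg2 v hvU).1, Or.inr (hQC _ (hg2 v hvU).1), (hg2 v hvU).2⟩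
    · by_cases hvV : v ∈ V1
      · rw [hgV v hvV]
        have := h1m v hvV
        exact ⟨this.1, Or.inl this.2.1, this.2.2.2⟩
      · obtain ⟨e1, e2⟩ := hgW v hv hvU hvV
        rw [e2]
        have := hL2m _ (hg3 v e1).1
        exact ⟨this.1, Or.inr this.2.1, (hg3 v e1).2⟩

end Matching

/-- The product of the odd primes up to `z`. -/
def oddPrimorial (z : ℕ) : ℕ := ∏ p ∈ range (z + 1) with p.Prime ∧ p ≠ 2, p

lemma oddPrimorial_pos (z : ℕ) : 0 < oddPrimorial z :=
  prod_pos fun _ hp => (mem_filter.1 hp).2.1.pos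

instance (z : ℕ) : NeZero (oddPrimorial z) := ⟨(oddPrimorial_pos z).ne'⟩

lemma oddPrimorial_le (z : ℕ) : oddPrimorial z ≤ 4 ^ z := by
  refine le_trans ?_ (primorial_le_four_pow z)
  refine prod_le_prod_of_subset_of_one_le' ?_ ?_
  · intro p hp
    simp only [mem_filter] at hp ⊢
    exact ⟨hp.1, hp.2.1⟩
  · intro p hp _
    exact (mem_filter.1 hp).2.pos

lemma prime_dvd_oddPrimorial {p z : ℕ} (hp : p.Prime) :
    p ∣ oddPrimorial z ↔ p ≤ z ∧ p ≠ 2 := by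
  constructor
  · intro h
    obtain ⟨q, hq, hpq⟩ := (Prime.dvd_finsetProd_iff hp.prime _).1 h
    simp only [mem_filter, mem_range] at hq
    rw [(Nat.prime_dvd_prime_iff_eq hp hq.2.1).1 hpq]
    exact ⟨by omega, hq.2.2⟩
  · rintro ⟨h1, h2⟩
    exact dvd_prod_of_mem (fun p => p) (mem_filter.2 ⟨mem_range.2 (by omega), hp, h2⟩)

lemma coprime_two_oddPrimorial (z : ℕ) : Nat.Coprime 2 (oddPrimorial z) := by
  rw [Nat.Prime.coprime_iff_not_dvd Nat.prime_two, prime_dvd_oddPrimorial Nat.prime_two]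
  tauto

lemma oddPrimorial_succ_of_not {z : ℕ} (h : ¬ ((z + 1).Prime ∧ z + 1 ≠ 2)) :
    oddPrimorial (z + 1) = oddPrimorial z := by
  rw [oddPrimorial, range_add_one, filter_insert, if_neg h, oddPrimorial]

lemma oddPrimorial_succ {z : ℕ} (h : (z + 1).Prime ∧ z + 1 ≠ 2) :
    oddPrimorial (z + 1) = (z + 1) * oddPrimorial z := by
  rw [oddPrimorial, range_add_one, filter_insert, if_pos h, prod_insert (by simp), oddPrimorial]

open Classical in
/-- Residues `r` such that `r` and `r + 1` are both units. -/
noncomputable def unitPairs (m : ℕ) [NeZero m] : Finset (ZMod m) :=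
  {r | IsUnit r ∧ IsUnit (r + 1)}

lemma card_unitPairs_mul {m k : ℕ} [NeZero m] [NeZero k] [NeZero (m * k)] (h : m.Coprime k) :
    #(unitPairs (m * k)) = #(unitPairs m) * #(unitPairs k) := by
  classical
  rw [← card_product]
  refine card_equiv (ZMod.chineseRemainder h).toEquiv fun r => ?_
  set e := ZMod.chineseRemainder h
  have h1 : ∀ x, IsUnit x ↔ IsUnit (e x).1 ∧ IsUnit (e x).2 := by
    intro x
    rw [← Prod.isUnit_iff, isUnit_map_iff]
  simp only [unitPairs, mem_filter, mem_univ, true_and, mem_product]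
  rw [h1 r, h1 (r + 1), map_add, map_one]
  simp only [Prod.fst_add, Prod.fst_one, Prod.snd_add, Prod.snd_one]
  change _ ↔ (IsUnit (e r).1 ∧ IsUnit ((e r).1 + 1)) ∧ IsUnit (e r).2 ∧ IsUnit ((e r).2 + 1)
  tauto

lemma le_card_unitPairs_prime {p : ℕ} (hp : p.Prime) [NeZero p] :
    p - 2 ≤ #(unitPairs p) := by
  classical
  have : Fact p.Prime := ⟨hp⟩
  have h1 : (univ : Finset (ZMod p)) \ {0, -1} ⊆ unitPairs p := by
    intro x hx
    simp only [mem_sdiff, mem_univ, true_and, mem_insert, mem_singleton, not_or] at hx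
    simp only [unitPairs, mem_filter, mem_univ, true_and, isUnit_iff_ne_zero]
    exact ⟨hx.1, fun h => hx.2 (eq_neg_of_add_eq_zero_left h)⟩
  refine le_trans ?_ (card_le_card h1)
  have := le_card_sdiff ({0, -1} : Finset (ZMod p)) univ
  rw [card_univ, ZMod.card] at this
  have h2 : #({0, -1} : Finset (ZMod p)) ≤ 2 := card_le_two
  omega

lemma card_unitPairs_congr {m k : ℕ} [NeZero m] [NeZero k] (h : m = k) :
    #(unitPairs m) = #(unitPairs k) := by
  subst h; rfl

/-- At least a proportion `1 / z` of the residues modulo the odd primorial are unit pairs. -/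
theorem oddPrimorial_le_mul_card_unitPairs (z : ℕ) (hz : 1 ≤ z) :
    oddPrimorial z ≤ z * #(unitPairs (oddPrimorial z)) := by
  induction z using Nat.strong_induction_on with
  | _ z ih =>
  obtain ⟨k, rfl⟩ : ∃ k, z = k + 1 := ⟨z - 1, by omega⟩
  rcases Nat.eq_zero_or_pos k with rfl | hk
  · have h1 : oddPrimorial (0 + 1) = 1 := by decide
    have h2 : 1 ≤ #(unitPairs (oddPrimorial (0 + 1))) := by
      rw [Nat.one_le_iff_ne_zero, ← Nat.pos_iff_ne_zero, card_pos]
      refine ⟨0, ?_⟩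
      have : Subsingleton (ZMod (oddPrimorial (0 + 1))) := by rw [h1]; infer_instance
      simp only [unitPairs, mem_filter, mem_univ, true_and]
      exact ⟨isUnit_of_subsingleton _, isUnit_of_subsingleton _⟩
    omega
  by_cases h : (k + 1).Prime ∧ k + 1 ≠ 2
  · obtain ⟨j, rfl⟩ : ∃ j, k = j + 1 := ⟨k - 1, by omega⟩
    have hodd : Odd (j + 1 + 1) := h.1.odd_of_ne_two h.2
    have hj : ¬ ((j + 1).Prime ∧ j + 1 ≠ 2) := by
      rintro ⟨h1, h2⟩
      have := h1.odd_of_ne_two h2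
      rw [Nat.odd_iff] at this hodd
      omega
    have hj1 : 1 ≤ j := by
      rw [Nat.odd_iff] at hodd; omega
    have e1 : oddPrimorial (j + 1 + 1) = (j + 1 + 1) * oddPrimorial j := by
      rw [oddPrimorial_succ h, oddPrimorial_succ_of_not hj]
    have hcop : (j + 1 + 1).Coprime (oddPrimorial j) := by
      rw [Nat.Prime.coprime_iff_not_dvd h.1, prime_dvd_oddPrimorial h.1]
      omega
    have : NeZero (j + 1 + 1) := ⟨by omega⟩
    have : NeZero ((j + 1 + 1) * oddPrimorial j) := ⟨by rw [← e1]; exact NeZero.ne _⟩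
    have e2 := card_unitPairs_congr e1
    rw [card_unitPairs_mul hcop] at e2
    have e3 := ih j (by omega) hj1
    have e4 := le_card_unitPairs_prime h.1
    rw [e2]
    refine e1.le.trans ?_
    calc (j + 1 + 1) * oddPrimorial j ≤ (j + 1 + 1) * (j * #(unitPairs (oddPrimorial j))) :=
          Nat.mul_le_mul_left _ e3
      _ ≤ (j + 1 + 1) * (#(unitPairs (j + 1 + 1)) * #(unitPairs (oddPrimorial j))) := by
          refine Nat.mul_le_mul_left _ (Nat.mul_le_mul_right _ ?_)
          omega
  · have e1 := oddPrimorial_succ_of_not h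
    rw [card_unitPairs_congr e1, e1]
    exact (ih k (by omega) hk).trans (Nat.mul_le_mul_right _ (by omega))

lemma eventually_mul_pow_le (C k : ℕ) : ∀ᶠ z : ℕ in Filter.atTop, C * (z + 1) ^ k ≤ 4 ^ z := by
  have h1 := tendsto_pow_const_div_const_pow_of_one_lt k (r := (4 : ℝ)) (by norm_num)
  have h2 := (Filter.tendsto_add_atTop_iff_nat 1).2 h1
  have h3 := h2.eventually (gt_mem_nhds (show (0 : ℝ) < 1 / (4 * (C + 1)) by positivity))
  filter_upwards [h3] with z hz
  rw [div_lt_div_iff₀ (by positivity) (by positivity), pow_succ (4 : ℝ) z] at hz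
  push_cast at hz
  have h4 : (C : ℝ) * (z + 1) ^ k ≤ 4 ^ z := by
    have : (0 : ℝ) ≤ (z + 1 : ℝ) ^ k := by positivity
    nlinarith
  exact_mod_cast h4

lemma centralBinom_le_mul_pow_card_primes (m : ℕ) (hm : 2 < m) :
    m.centralBinom ≤ (2 * m) ^ (2 * m).sqrt * 4 ^ (2 * m / 3) *
      (2 * m) ^ #{p ∈ Ioc m (2 * m) | p.Prime} := by
  have n_pos : 0 < m := by omega
  have n2_pos : 1 ≤ 2 * m := by omega
  let f x := x ^ m.centralBinom.factorization x
  have hf1 : ∀ p, ¬ p.Prime → f p = 1 := fun p hp => by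
    simp only [f, Nat.factorization_eq_zero_of_not_prime m.centralBinom hp, pow_zero]
  have hf2 : ∀ p, f p ≤ 2 * m := fun p => Nat.pow_factorization_choose_le (by omega)
  have hsplit : m.centralBinom =
      (∏ x ∈ range (2 * m / 3 + 1), f x) * ∏ x ∈ Ioc (2 * m / 3) (2 * m), f x := by
    rw [← m.prod_pow_factorization_centralBinom]
    have : range (2 * m + 1) = range (2 * m / 3 + 1) ∪ Ioc (2 * m / 3) (2 * m) := by
      ext x; simp only [mem_range, mem_union, mem_Ioc]; omega
    rw [this, prod_union]
    rw [disjoint_left]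
    intro x; simp only [mem_range, mem_Ioc]; omega
  rw [hsplit]
  refine mul_le_mul' ?_ ?_
  · let S := {p ∈ range (2 * m / 3 + 1) | Nat.Prime p}
    have h1 : ∏ x ∈ S, f x = ∏ x ∈ range (2 * m / 3 + 1), f x := by
      refine prod_filter_of_ne fun p _ h => ?_
      by_contra hp
      exact h (hf1 p hp)
    rw [← h1, ← prod_filter_mul_prod_filter_not S (· ≤ (2 * m).sqrt)]
    apply mul_le_mul'
    · refine (prod_le_prod' fun p _ => hf2 p).trans ?_
      have : (Icc 1 (2 * m).sqrt).card = (2 * m).sqrt := by rw [Nat.card_Icc, Nat.add_sub_cancel]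
      rw [prod_const]
      refine pow_right_mono₀ n2_pos ((card_le_card fun x hx => ?_).trans this.le)
      obtain ⟨h1, h2⟩ := mem_filter.1 hx
      exact mem_Icc.mpr ⟨(mem_filter.1 h1).2.one_lt.le, h2⟩
    · refine le_trans ?_ (primorial_le_four_pow (2 * m / 3))
      refine (prod_le_prod' fun p hp => (?_ : f p ≤ p)).trans ?_
      · obtain ⟨h1, h2⟩ := mem_filter.1 hp
        refine (pow_right_mono₀ (mem_filter.1 h1).2.one_lt.le ?_).trans (pow_one p).le
        exact Nat.factorization_choose_le_one (Nat.sqrt_lt'.mp <| not_le.1 h2)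
      refine prod_le_prod_of_subset_of_one_le' (filter_subset _ _) ?_
      exact fun p hp _ => (mem_filter.1 hp).2.one_lt.le
  · have h1 : ∏ x ∈ Ioc m (2 * m) with x.Prime, f x = ∏ x ∈ Ioc (2 * m / 3) (2 * m), f x := by
      apply prod_subset
      · intro x hx
        simp only [mem_filter, mem_Ioc] at hx ⊢
        omega
      · intro x hx hx2
        simp only [mem_filter, mem_Ioc] at hx hx2
        by_cases hp : x.Prime
        · have : x ≤ m := by by_contra h; exact hx2 ⟨⟨by omega, hx.2⟩, hp⟩
          simp only [f]
          rw [Nat.factorization_centralBinom_of_two_mul_self_lt_three_mul hm this (by omega),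
            pow_zero]
        · exact hf1 x hp
    rw [← h1, ← prod_const]
    exact prod_le_prod' fun p _ => hf2 p

lemma le_mul_card_primes {m e : ℕ} (hm : 4 ≤ m) (he : 2 * m ≤ 4 ^ e) :
    m ≤ 3 * (e * (1 + (2 * m).sqrt + #{p ∈ Ioc m (2 * m) | p.Prime})) := by
  have h1 := Nat.four_pow_lt_mul_centralBinom m hm
  have h2 := centralBinom_le_mul_pow_card_primes m (by omega)
  set k := #{p ∈ Ioc m (2 * m) | p.Prime}
  set s := (2 * m).sqrt
  have h3 : 4 ^ m < 4 ^ (e * (1 + s + k) + 2 * m / 3) := by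
    calc 4 ^ m < m * m.centralBinom := h1
      _ ≤ (2 * m) * ((2 * m) ^ s * 4 ^ (2 * m / 3) * (2 * m) ^ k) :=
        Nat.mul_le_mul (by omega) h2
      _ = (2 * m) ^ (1 + s + k) * 4 ^ (2 * m / 3) := by ring
      _ ≤ (4 ^ e) ^ (1 + s + k) * 4 ^ (2 * m / 3) :=
        Nat.mul_le_mul_right _ (Nat.pow_le_pow_left he _)
      _ = 4 ^ (e * (1 + s + k) + 2 * m / 3) := by rw [← pow_mul, ← pow_add]
  have h4 := (Nat.pow_lt_pow_iff_right (by norm_num)).1 h3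
  omega

/-- A Chebyshev-type lower bound for the number of primes in `(m, 2 m]`. -/
theorem eventually_le_mul_card_primes : ∀ᶠ z : ℕ in Filter.atTop, ∀ n m : ℕ,
    4 ^ (20 * z) ≤ n → n ≤ 4 ^ (20 * (z + 1)) → n ≤ 4 * m + 3 → 2 * m ≤ n →
    n ≤ 1000 * z * #{p ∈ Ioc m (2 * m) | p.Prime} := by
  filter_upwards [eventually_mul_pow_le 100000 1, Filter.eventually_ge_atTop 1]
    with z hz hz1 n m h1 h2 h3 h4
  have e1 : 4 ^ (20 * z) = 4 ^ (10 * z) * 4 ^ (10 * z) := by rw [← pow_add]; congr 1; ring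
  have e2 : 4 ^ z ≤ 4 ^ (10 * z) := Nat.pow_le_pow_right (by norm_num) (by omega)
  rw [pow_one] at hz
  have hn : 100000 * 100000 ≤ n := by nlinarith
  have h5 := le_mul_card_primes (m := m) (e := 20 * (z + 1)) (by omega) (h4.trans h2)
  set k := #{p ∈ Ioc m (2 * m) | p.Prime}
  have h6 : (2 * m).sqrt ≤ n.sqrt := Nat.sqrt_le_sqrt h4
  have h7 : 100000 * (z + 1) ≤ n.sqrt := by
    rw [Nat.le_sqrt]
    calc _ ≤ 4 ^ (10 * z) * 4 ^ (10 * z) := Nat.mul_le_mul (hz.trans e2) (hz.trans e2)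
      _ ≤ n := by omega
  have h8 := Nat.sqrt_le n
  have h9 : 60 * (z + 1) * (1 + (2 * m).sqrt) * 100 ≤ n := by
    calc 60 * (z + 1) * (1 + (2 * m).sqrt) * 100 ≤ 100000 * (z + 1) * n.sqrt := by
          have : 1 + (2 * m).sqrt ≤ 2 * n.sqrt := by omega
          nlinarith
      _ ≤ n := (Nat.mul_le_mul_right _ h7).trans h8
  have h10 : m ≤ 60 * (z + 1) * (1 + (2 * m).sqrt) + 60 * (z + 1) * k := by nlinarith
  have h11 : n ≤ 5 * (60 * (z + 1) * k) := by omega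
  nlinarith

/-- The prime factors of `x` exceeding `z`. -/
def bigPrimes (z x : ℕ) : Finset ℕ := {p ∈ x.primeFactors | z < p}

/-- The sum of the reciprocals of the prime factors of `x` exceeding `z`. -/
noncomputable def bigRecip (z x : ℕ) : ℝ := ∑ p ∈ bigPrimes z x, (1 / p : ℝ)

lemma bigRecip_nonneg (z x : ℕ) : 0 ≤ bigRecip z x := sum_nonneg fun _ _ => by positivity

lemma mem_bigPrimes {z x p : ℕ} (hx : x ≠ 0) : p ∈ bigPrimes z x ↔ p.Prime ∧ p ∣ x ∧ z < p := by
  simp [bigPrimes, hx, and_assoc]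

lemma pow_card_bigPrimes_le {z x y : ℕ} (hx : x ≠ 0) (hy : y ≤ z + 1) :
    y ^ #(bigPrimes z x) ≤ x := by
  refine le_trans ?_ (Nat.le_of_dvd (Nat.pos_of_ne_zero hx) (Nat.prod_primeFactors_dvd x))
  calc y ^ #(bigPrimes z x) = ∏ p ∈ bigPrimes z x, y := by rw [prod_const]
    _ ≤ ∏ p ∈ bigPrimes z x, p := prod_le_prod' fun p hp => by
        have := (mem_filter.1 hp).2; omega
    _ ≤ _ := prod_le_prod_of_subset_of_one_le' (filter_subset _ _) fun p hp _ =>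
        (Nat.prime_of_mem_primeFactors hp).pos

lemma card_bigPrimes_le {z x : ℕ} (hz : 1 ≤ z) (hx : x ≠ 0) (hx2 : x ≤ 4 ^ (20 * (z + 1))) :
    #(bigPrimes z x) ≤ 40 * (z + 1) := by
  have h := (pow_card_bigPrimes_le (z := z) (y := 2) hx (by omega)).trans hx2
  rw [show 4 = 2 ^ 2 from rfl, ← pow_mul] at h
  have := (Nat.pow_le_pow_iff_right (by norm_num)).1 h
  omega

lemma bigRecip_eventually_le {ε : ℝ} (hε : 0 < ε) : ∀ᶠ z : ℕ in Filter.atTop, ∀ x : ℕ, x ≠ 0 →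
    x ≤ 4 ^ (20 * (z + 1)) → bigRecip z x ≤ ε := by
  obtain ⟨K, hK⟩ := exists_nat_gt (40 / ε)
  have hK0 : 0 < (K : ℝ) := lt_trans (by positivity) hK
  filter_upwards [Filter.eventually_ge_atTop (4 ^ K)] with z hz x hx hx2
  have hz1 : 1 ≤ z := (Nat.one_le_pow _ _ (by norm_num)).trans hz
  have h1 := (pow_card_bigPrimes_le (z := z) (y := 4 ^ K) hx (by omega)).trans hx2
  rw [← pow_mul] at h1
  have h2 := (Nat.pow_le_pow_iff_right (by norm_num)).1 h1
  have h3 : bigRecip z x ≤ #(bigPrimes z x) * (1 / z : ℝ) := by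
    rw [bigRecip, ← nsmul_eq_mul]
    refine sum_le_card_nsmul _ _ _ fun p hp => ?_
    have := (mem_filter.1 hp).2
    have h4 : (0 : ℝ) < z := by exact_mod_cast hz1
    have h5 : (z : ℝ) ≤ p := by exact_mod_cast this.le
    exact one_div_le_one_div_of_le h4 h5
  have h4 : (K : ℝ) * #(bigPrimes z x) ≤ 40 * z := by
    have : K * #(bigPrimes z x) ≤ 40 * z := by
      clear h1 hx2 hz
      omega
    exact_mod_cast this
  have h5 : (0 : ℝ) < z := by exact_mod_cast hz1
  have h6 : 40 < ε * K := by rwa [div_lt_iff₀ hε, mul_comm] at hK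
  refine h3.trans ?_
  rw [mul_one_div, div_le_iff₀ h5]
  have h7 : (K : ℝ) * #(bigPrimes z x) ≤ K * (ε * z) := by
    calc _ ≤ 40 * (z : ℝ) := h4
      _ ≤ ε * K * z := mul_le_mul_of_nonneg_right h6.le h5.le
      _ = _ := by ring
  exact le_of_mul_le_mul_left h7 hK0

lemma primeCounting_eventually_le {δ : ℝ} (hδ : 0 < δ) : ∀ᶠ x : ℕ in Filter.atTop,
    (x.primeCounting : ℝ) ≤ δ * x := by
  have h1 := (Chebyshev.eventually_primeCounting_le (ε := 1) one_pos)
  have h2 := h1.natCast_atTop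
  have h3 := (Real.tendsto_log_atTop.eventually_ge_atTop ((Real.log 4 + 1) / δ)).natCast_atTop
  filter_upwards [h2, h3, Filter.eventually_ge_atTop 2] with x hx hx2 hx3
  rw [Nat.floor_natCast] at hx
  have hl : 0 < Real.log x := Real.log_pos (by exact_mod_cast hx3)
  refine hx.trans ?_
  rw [div_le_iff₀ hδ] at hx2
  rw [div_le_iff₀ hl]
  have : (0 : ℝ) ≤ x := by positivity
  nlinarith

lemma sum_prime_sq_eventually_le {ε : ℝ} (hε : 0 < ε) : ∀ᶠ z : ℕ in Filter.atTop, ∀ n : ℕ,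
    ∑ p ∈ Ioc z n with p.Prime, (1 / p : ℝ) ^ 2 ≤ ε / z := by
  have hδ : 0 < ε / 4 := by positivity
  set δ := ε / 4 with hδd
  obtain ⟨x0, hx0⟩ := Filter.eventually_atTop.1 (primeCounting_eventually_le hδ)
  filter_upwards [Filter.eventually_ge_atTop x0, Filter.eventually_ge_atTop 1] with z hz hz1 n
  have hz0 : (0 : ℝ) < z := by exact_mod_cast hz1
  have key : ∀ k : ℕ, ∑ p ∈ Ioc z (2 ^ k * z) with p.Prime, (1 / p : ℝ) ^ 2 ≤
      4 * δ / z * (1 - 1 / 2 ^ k) := by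
    intro k
    induction k with
    | zero => simp
    | succ k ih =>
      have hpow : 1 ≤ 2 ^ k := Nat.one_le_two_pow
      have h1 : (Ioc z (2 ^ (k + 1) * z)).filter Nat.Prime ⊆
          (Ioc z (2 ^ k * z)).filter Nat.Prime ∪
            (Ioc (2 ^ k * z) (2 ^ (k + 1) * z)).filter Nat.Prime := by
        intro p hp
        simp only [mem_union, mem_filter, mem_Ioc] at hp ⊢
        by_cases h : p ≤ 2 ^ k * z
        · exact Or.inl ⟨⟨hp.1.1, h⟩, hp.2⟩
        · exact Or.inr ⟨⟨by omega, hp.1.2⟩, hp.2⟩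
      have h2 : (#((Ioc (2 ^ k * z) (2 ^ (k + 1) * z)).filter Nat.Prime) : ℝ) ≤
          δ * (2 ^ (k + 1) * z) := by
        have h3 := hx0 (2 ^ (k + 1) * z) (by
          have : 1 ≤ 2 ^ (k + 1) := Nat.one_le_two_pow
          nlinarith)
        push_cast at h3
        refine le_trans ?_ h3
        rw [Nat.cast_le, Nat.primeCounting, Nat.primeCounting', Nat.count_eq_card_filter_range]
        refine card_le_card fun p hp => ?_
        simp only [mem_filter, mem_Ioc, mem_range] at hp ⊢
        exact ⟨by omega, hp.2⟩
      have h3 : ∑ p ∈ Ioc (2 ^ k * z) (2 ^ (k + 1) * z) with p.Prime, (1 / p : ℝ) ^ 2 ≤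
          2 * δ / z / 2 ^ k := by
        have h4 : ∀ p ∈ (Ioc (2 ^ k * z) (2 ^ (k + 1) * z)).filter Nat.Prime,
            (1 / p : ℝ) ^ 2 ≤ (1 / (2 ^ k * z)) ^ 2 := by
          intro p hp
          simp only [mem_filter, mem_Ioc] at hp
          have : (2 ^ k * z : ℝ) ≤ p := by exact_mod_cast hp.1.1.le
          gcongr
        refine (sum_le_card_nsmul _ _ _ h4).trans ?_
        rw [nsmul_eq_mul]
        calc _ ≤ δ * (2 ^ (k + 1) * z) * (1 / (2 ^ k * z : ℝ)) ^ 2 :=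
              mul_le_mul_of_nonneg_right h2 (by positivity)
          _ = _ := by field_simp; ring
      calc _ ≤ _ := sum_le_sum_of_subset_of_nonneg h1 fun _ _ _ => by positivity
        _ = _ := sum_union (by
          rw [disjoint_left]
          intro p hp hp2
          simp only [mem_filter, mem_Ioc] at hp hp2
          omega)
        _ ≤ 4 * δ / z * (1 - 1 / 2 ^ k) + 2 * δ / z / 2 ^ k := add_le_add ih h3
        _ = _ := by field_simp; ring
  obtain ⟨k, hk⟩ : ∃ k : ℕ, n ≤ 2 ^ k * z :=
    ⟨n, (Nat.lt_two_pow_self.le).trans (Nat.le_mul_of_pos_right _ hz1)⟩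
  calc _ ≤ ∑ p ∈ Ioc z (2 ^ k * z) with p.Prime, (1 / p : ℝ) ^ 2 :=
        sum_le_sum_of_subset_of_nonneg (filter_subset_filter _ (Ioc_subset_Ioc_right hk))
          fun _ _ _ => by positivity
    _ ≤ 4 * δ / z * (1 - 1 / 2 ^ k) := key k
    _ ≤ 4 * δ / z * 1 := by
        gcongr
        simp
    _ = ε / z := by rw [hδd]; field_simp

lemma card_le_of_modEq {s : Finset ℕ} {n m : ℕ} (hs : s ⊆ Icc 1 n)
    (h : ∀ x ∈ s, ∀ y ∈ s, x ≡ y [MOD m]) : #s ≤ n / m + 1 := by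
  have : #s ≤ #(range (n / m + 1)) := by
    refine card_le_card_of_injOn (fun x => x / m) (fun x hx => ?_) fun x hx y hy hxy => ?_
    · have := (mem_Icc.1 (hs hx)).2
      simp only [coe_range, Set.mem_Iio]
      exact Nat.lt_succ_of_le (Nat.div_le_div_right this)
    · have h1 : x % m = y % m := h x hx y hy
      have h2 : x / m = y / m := hxy
      rw [← Nat.div_add_mod x m, ← Nat.div_add_mod y m, h1, h2]
  simpa using this

lemma div_le_card_modEq {n m x₀ : ℕ} (h0 : 1 ≤ x₀) (h1 : x₀ ≤ m) :
    n / m ≤ #{x ∈ Icc 1 n | x ≡ x₀ [MOD m]} := by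
  have : #(range (n / m)) ≤ #{x ∈ Icc 1 n | x ≡ x₀ [MOD m]} := by
    refine card_le_card_of_injOn (fun k => x₀ + m * k) (fun k hk => ?_) fun x _ y _ hxy => ?_
    · simp only [coe_range, Set.mem_Iio] at hk
      have h2 : m * (k + 1) ≤ m * (n / m) := Nat.mul_le_mul_left _ hk
      have h3 := Nat.mul_div_le n m
      simp only [coe_filter, mem_Icc, Set.mem_ofPred_eq]
      refine ⟨⟨by omega, by rw [mul_add] at h2; omega⟩, ?_⟩
      simp [Nat.ModEq]
    · have h4 : m * x = m * y := by simpa using hxy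
      exact Nat.eq_of_mul_eq_mul_left (by omega) h4
  simpa using this

lemma exists_modEq_iff_odd {P : ℕ} [NeZero P] (hP : Nat.Coprime 2 P) (r : ZMod P) :
    ∃ x₀, 1 ≤ x₀ ∧ x₀ ≤ 2 * P ∧ ∀ x : ℕ, x ≡ x₀ [MOD 2 * P] ↔ (Odd x ∧ (x : ZMod P) = r) := by
  have hP0 : 0 < P := NeZero.pos P
  obtain ⟨c, hc, h1⟩ : ∃ c, (c ≡ 1 [MOD 2] ∧ c ≡ r.val [MOD P]) ∧ c < 2 * P :=
    ⟨_, (Nat.chineseRemainder hP 1 r.val).2,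
      Nat.chineseRemainder_lt_mul hP 1 r.val two_ne_zero hP0.ne'⟩
  have hc1 : c % 2 = 1 := hc.1
  refine ⟨c, by omega, h1.le, fun x => ?_⟩
  rw [← Nat.modEq_and_modEq_iff_modEq_mul hP, Nat.odd_iff, ← ZMod.natCast_zmod_val r,
    ZMod.natCast_eq_natCast_iff]
  constructor
  · rintro ⟨h2, h3⟩
    exact ⟨h2.trans hc.1, h3.trans hc.2⟩
  · rintro ⟨h2, h3⟩
    exact ⟨(show x ≡ 1 [MOD 2] from h2).trans hc.1.symm, h3.trans hc.2.symm⟩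

/-- The odd numbers up to `n` in a given residue class. -/
def oddClass {P : ℕ} (n : ℕ) (r : ZMod P) : Finset ℕ := {x ∈ Icc 1 n | Odd x ∧ (x : ZMod P) = r}

lemma card_oddClass_le {P : ℕ} [NeZero P] (hP : Nat.Coprime 2 P) (n : ℕ) (r : ZMod P) :
    #(oddClass n r) ≤ n / (2 * P) + 1 := by
  obtain ⟨c, -, -, hc⟩ := exists_modEq_iff_odd hP r
  refine card_le_of_modEq (filter_subset _ _) fun x hx y hy => ?_
  exact ((hc x).2 (mem_filter.1 hx).2).trans ((hc y).2 (mem_filter.1 hy).2).symm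

lemma le_card_oddClass {P : ℕ} [NeZero P] (hP : Nat.Coprime 2 P) (n : ℕ) (r : ZMod P) :
    n / (2 * P) ≤ #(oddClass n r) := by
  obtain ⟨c, h1, h2, hc⟩ := exists_modEq_iff_odd hP r
  refine (div_le_card_modEq h1 h2).trans (card_le_card fun x hx => ?_)
  rw [mem_filter] at hx
  exact mem_filter.2 ⟨hx.1, (hc x).1 hx.2⟩

lemma card_class_le {P : ℕ} (n : ℕ) (r : ZMod P) :
    #{x ∈ Icc 1 n | ((x : ℕ) : ZMod P) = r} ≤ n / P + 1 := by
  refine card_le_of_modEq (filter_subset _ _) fun x hx y hy => ?_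
  rw [← ZMod.natCast_eq_natCast_iff, (mem_filter.1 hx).2, (mem_filter.1 hy).2]

lemma le_card_class {P : ℕ} [NeZero P] (n : ℕ) (r : ZMod P) :
    n / P ≤ #{x ∈ Icc 1 n | ((x : ℕ) : ZMod P) = r} := by
  have hP0 : 0 < P := NeZero.pos P
  obtain ⟨c, h1, h2, h3⟩ : ∃ c : ℕ, 1 ≤ c ∧ c ≤ P ∧ (c : ZMod P) = r := by
    by_cases h : r.val = 0
    · exact ⟨P, hP0, le_rfl, by rw [(ZMod.val_eq_zero r).1 h]; simp⟩
    · exact ⟨r.val, by omega, (ZMod.val_lt r).le, ZMod.natCast_zmod_val r⟩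
  refine (div_le_card_modEq h1 h2).trans (card_le_card fun x hx => ?_)
  rw [mem_filter, ← ZMod.natCast_eq_natCast_iff, h3] at hx
  exact mem_filter.2 hx

lemma card_class_dvd_le {P p : ℕ} (hp : Nat.Coprime p P) (n : ℕ) (r : ZMod P) :
    #{x ∈ Icc 1 n | ((x : ℕ) : ZMod P) = r ∧ p ∣ x} ≤ n / (p * P) + 1 := by
  refine card_le_of_modEq (filter_subset _ _) fun x hx y hy => ?_
  rw [mem_filter] at hx hy
  rw [← Nat.modEq_and_modEq_iff_modEq_mul hp]
  refine ⟨((Nat.modEq_zero_iff_dvd.2 hx.2.2)).trans (Nat.modEq_zero_iff_dvd.2 hy.2.2).symm, ?_⟩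
  rw [← ZMod.natCast_eq_natCast_iff, hx.2.1, hy.2.1]

lemma mul_card_oddClass_dvd_le {P p : ℕ} [NeZero P] (hP : Nat.Coprime 2 P) (hp : Nat.Coprime p P)
    (hp2 : Nat.Coprime p 2) (n m : ℕ) (r : ZMod P) (L : Finset ℕ)
    (hL : L ⊆ oddClass n r) :
    p * #{l ∈ L | l ≤ 4 * P * m ∧ p ∣ l} ≤ 2 * m + p := by
  obtain ⟨c, -, -, hc⟩ := exists_modEq_iff_odd hP r
  have hP0 : 0 < P := NeZero.pos P
  have h1 : #{l ∈ L | l ≤ 4 * P * m ∧ p ∣ l} ≤ 4 * P * m / (p * (2 * P)) + 1 := by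
    refine card_le_of_modEq (fun x hx => ?_) fun x hx y hy => ?_
    · rw [mem_filter] at hx
      exact mem_Icc.2 ⟨(mem_Icc.1 (mem_filter.1 (hL hx.1)).1).1, hx.2.1⟩
    · rw [mem_filter] at hx hy
      have hx' := (mem_filter.1 (hL hx.1)).2
      have hy' := (mem_filter.1 (hL hy.1)).2
      rw [← Nat.modEq_and_modEq_iff_modEq_mul (hp2.mul_right hp)]
      exact ⟨((Nat.modEq_zero_iff_dvd.2 hx.2.2)).trans (Nat.modEq_zero_iff_dvd.2 hy.2.2).symm,
        ((hc x).2 hx').trans ((hc y).2 hy').symm⟩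
  have h2 : 4 * P * m / (p * (2 * P)) = 2 * m / p := by
    rw [show 4 * P * m = 2 * m * (2 * P) by ring, Nat.mul_div_mul_right _ _ (by omega)]
  rw [h2] at h1
  calc _ ≤ p * (2 * m / p + 1) := Nat.mul_le_mul_left _ h1
    _ ≤ _ := by rw [mul_add, mul_one]; have := Nat.mul_div_le (2 * m) p; omega

lemma le_mul_card_oddClass_sdiff {P : ℕ} [NeZero P] (hP : Nat.Coprime 2 P) {n h : ℕ} (r : ZMod P)
    (H : Finset ℕ) (hH : ∀ x ∈ H, n < 4 * x) (hHc : #H ≤ h) (hn : 16 * P * (h + 1) ≤ n) :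
    ∀ l ∈ oddClass n r \ H, l ≤ 4 * P * #{m ∈ oddClass n r \ H | m ≤ l} := by
  intro l hl
  have hP0 : 0 < P := NeZero.pos P
  have hl' := mem_sdiff.1 hl
  have hl1 := mem_filter.1 hl'.1
  have h1 := le_card_oddClass hP l r
  have h2 : l < 2 * P * (l / (2 * P) + 1) := Nat.lt_mul_div_succ l (by omega)
  have hsub : oddClass l r ⊆ {m ∈ oddClass n r | m ≤ l} := by
    intro x hx
    simp only [oddClass, mem_filter, mem_Icc] at hx hl1 ⊢
    exact ⟨⟨⟨hx.1.1, hx.1.2.trans hl1.1.2⟩, hx.2⟩, hx.1.2⟩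
  have h3 : 1 ≤ #{m ∈ oddClass n r \ H | m ≤ l} :=
    card_pos.2 ⟨l, mem_filter.2 ⟨hl, le_rfl⟩⟩
  by_cases h4 : 4 * l ≤ n
  · have h5 : #(oddClass l r) ≤ #{m ∈ oddClass n r \ H | m ≤ l} := by
      refine card_le_card fun x hx => ?_
      have h6 := mem_filter.1 (hsub hx)
      refine mem_filter.2 ⟨mem_sdiff.2 ⟨h6.1, fun h7 => ?_⟩, h6.2⟩
      have := hH x h7
      omega
    calc l ≤ 2 * P * (l / (2 * P) + 1) := h2.le
      _ ≤ 2 * P * (2 * #{m ∈ oddClass n r \ H | m ≤ l}) := Nat.mul_le_mul_left _ (by omega)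
      _ = _ := by ring
  · have h5 : #(oddClass l r) ≤ #{m ∈ oddClass n r \ H | m ≤ l} + h := by
      refine (card_le_card (t := {m ∈ oddClass n r \ H | m ≤ l} ∪ H) fun x hx => ?_).trans
        ((card_union_le _ _).trans (by omega))
      have h6 := mem_filter.1 (hsub hx)
      by_cases h7 : x ∈ H
      · exact mem_union_right _ h7
      · exact mem_union_left _ (mem_filter.2 ⟨mem_sdiff.2 ⟨h6.1, h7⟩, h6.2⟩)
    set k := #{m ∈ oddClass n r \ H | m ≤ l}
    have h6 : 2 * P * (l / (2 * P) + 1) ≤ 2 * P * (k + h + 1) := Nat.mul_le_mul_left _ (by omega)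
    have h7 : 2 * P * (k + h + 1) = 2 * P * k + 2 * P * (h + 1) := by ring
    have h8 : 16 * P * (h + 1) = 8 * (2 * P * (h + 1)) := by ring
    have h9 : 4 * P * k = 2 * (2 * P * k) := by ring
    omega

section

variable {V : Type}

open Classical in
lemma card_bad_labels_le {z n P B T : ℕ} (hP : ∀ p, p.Prime → z < p → Nat.Coprime p P)
    (W : Finset V) (f : V → ℕ) (hf : ∀ w ∈ W, f w ≠ 0) (hW : #W ≤ T)
    (hB : ∀ w ∈ W, #(bigPrimes z (f w)) ≤ B) (r : ZMod P) (L : Finset ℕ) (hL : L ⊆ Icc 1 n) :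
    (#{x ∈ L | ((x : ℕ) : ZMod P) = r ∧ ∃ w ∈ W, ∃ p ∈ bigPrimes z (f w), p ∣ x} : ℝ) ≤
      n / P * ∑ w ∈ W, bigRecip z (f w) + T * B := by
  have hsub : {x ∈ L | ((x : ℕ) : ZMod P) = r ∧ ∃ w ∈ W, ∃ p ∈ bigPrimes z (f w), p ∣ x} ⊆
      W.biUnion fun w => (bigPrimes z (f w)).biUnion fun p =>
        {x ∈ Icc 1 n | ((x : ℕ) : ZMod P) = r ∧ p ∣ x} := by
    intro x hx
    obtain ⟨hx1, hx2, w, hw, p, hp, hpx⟩ := mem_filter.1 hx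
    exact mem_biUnion.2 ⟨w, hw, mem_biUnion.2 ⟨p, hp, mem_filter.2 ⟨hL hx1, hx2, hpx⟩⟩⟩
  have h1 := (card_le_card hsub).trans (card_biUnion_le.trans
    (sum_le_sum fun w _ => card_biUnion_le))
  have h2 : ∀ w ∈ W, (∑ p ∈ bigPrimes z (f w),
      (#{x ∈ Icc 1 n | ((x : ℕ) : ZMod P) = r ∧ p ∣ x} : ℝ)) ≤
        n / P * bigRecip z (f w) + B := by
    intro w hw
    calc (∑ p ∈ bigPrimes z (f w), (#{x ∈ Icc 1 n | ((x : ℕ) : ZMod P) = r ∧ p ∣ x} : ℝ))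
        ≤ ∑ p ∈ bigPrimes z (f w), ((n : ℝ) / P * (1 / p) + 1) := by
          refine sum_le_sum fun p hp => ?_
          have hp' := (mem_bigPrimes (hf w hw)).1 hp
          have h3 := card_class_dvd_le (hP p hp'.1 hp'.2.2) n r
          calc (#{x ∈ Icc 1 n | ((x : ℕ) : ZMod P) = r ∧ p ∣ x} : ℝ)
              ≤ ((n / (p * P) : ℕ) : ℝ) + 1 := by exact_mod_cast h3
            _ ≤ (n : ℝ) / ((p * P : ℕ) : ℝ) + 1 := by gcongr; exact Nat.cast_div_le
            _ = _ := by push_cast; rw [div_mul_div_comm, mul_one, mul_comm (p : ℝ)]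
      _ = (n : ℝ) / P * bigRecip z (f w) + #(bigPrimes z (f w)) := by
          rw [sum_add_distrib, bigRecip, mul_sum]; simp
      _ ≤ _ := by have := hB w hw; gcongr
  calc (#{x ∈ L | ((x : ℕ) : ZMod P) = r ∧ ∃ w ∈ W, ∃ p ∈ bigPrimes z (f w), p ∣ x} : ℝ)
      ≤ ∑ w ∈ W, ∑ p ∈ bigPrimes z (f w),
          (#{x ∈ Icc 1 n | ((x : ℕ) : ZMod P) = r ∧ p ∣ x} : ℝ) := by
        exact_mod_cast h1
    _ ≤ ∑ w ∈ W, ((n : ℝ) / P * bigRecip z (f w) + B) := sum_le_sum h2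
    _ = (n : ℝ) / P * ∑ w ∈ W, bigRecip z (f w) + #W * B := by
        rw [sum_add_distrib, mul_sum]; simp
    _ ≤ _ := by gcongr

open Classical in
lemma card_bad_vertices_le {z B T c : ℕ} (adj : V → V → Prop) (Y M S : Finset V) (f : V → ℕ)
    (hM : ∀ p, p.Prime → z < p → p * ∑ w ∈ M with p ∣ f w, #{v ∈ Y | adj v w} ≤ c + p * T)
    (hS : ∀ w ∈ S, #{v ∈ Y | adj v w} ≤ 8) {x : ℕ} (hx : x ≠ 0) (hB : #(bigPrimes z x) ≤ B) :
    (#{v ∈ Y | ∃ w ∈ M ∪ S, adj v w ∧ ∃ p ∈ bigPrimes z x, p ∣ f w} : ℝ) ≤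
      c * bigRecip z x + T * B + 8 * #S := by
  have hsub : {v ∈ Y | ∃ w ∈ M ∪ S, adj v w ∧ ∃ p ∈ bigPrimes z x, p ∣ f w} ⊆
      ((bigPrimes z x).biUnion fun p => {w ∈ M | p ∣ f w}.biUnion fun w => {v ∈ Y | adj v w}) ∪
        S.biUnion fun w => {v ∈ Y | adj v w} := by
    intro v hv
    obtain ⟨hv1, w, hw, hvw, p, hp, hpw⟩ := mem_filter.1 hv
    rcases mem_union.1 hw with h | h
    · exact mem_union_left _ (mem_biUnion.2 ⟨p, hp, mem_biUnion.2
        ⟨w, mem_filter.2 ⟨h, hpw⟩, mem_filter.2 ⟨hv1, hvw⟩⟩⟩)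
    · exact mem_union_right _ (mem_biUnion.2 ⟨w, h, mem_filter.2 ⟨hv1, hvw⟩⟩)
  have h1 := (card_le_card hsub).trans (card_union_le _ _)
  have h2 : #(S.biUnion fun w => {v ∈ Y | adj v w}) ≤ 8 * #S := by
    rw [mul_comm]
    exact card_biUnion_le_card_mul _ _ _ hS
  have h3 := card_biUnion_le.trans (sum_le_sum fun p (_ : p ∈ bigPrimes z x) =>
    card_biUnion_le (s := {w ∈ M | p ∣ f w}) (t := fun w => {v ∈ Y | adj v w}))
  have h4 : ((∑ p ∈ bigPrimes z x, ∑ w ∈ M with p ∣ f w, #{v ∈ Y | adj v w} : ℕ) : ℝ) ≤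
      c * bigRecip z x + T * B := by
    calc ((∑ p ∈ bigPrimes z x, ∑ w ∈ M with p ∣ f w, #{v ∈ Y | adj v w} : ℕ) : ℝ)
        ≤ ∑ p ∈ bigPrimes z x, ((c : ℝ) * (1 / p) + T) := by
          push_cast
          refine sum_le_sum fun p hp => ?_
          have hp' := (mem_bigPrimes hx).1 hp
          have hp0 : (0 : ℝ) < p := by exact_mod_cast hp'.1.pos
          have h5 : (p : ℝ) * ∑ w ∈ M with p ∣ f w, (#{v ∈ Y | adj v w} : ℝ) ≤ c + p * T := by
            exact_mod_cast hM p hp'.1 hp'.2.2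
          rw [← mul_le_mul_iff_right₀ hp0]
          refine h5.trans (le_of_eq ?_)
          field_simp
      _ = c * bigRecip z x + #(bigPrimes z x) * T := by
          rw [sum_add_distrib, bigRecip, mul_sum]; simp
      _ ≤ _ := by rw [mul_comm (T : ℝ)]; gcongr
  have h6 : (#{v ∈ Y | ∃ w ∈ M ∪ S, adj v w ∧ ∃ p ∈ bigPrimes z x, p ∣ f w} : ℝ) ≤
      ((∑ p ∈ bigPrimes z x, ∑ w ∈ M with p ∣ f w, #{v ∈ Y | adj v w} : ℕ) : ℝ) + 8 * #S := by
    exact_mod_cast h1.trans (add_le_add h3 h2)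
  linarith

lemma sum_prime_recip_le {z n k : ℕ} (hk : 2 ≤ k) (hn : n ≤ 4 ^ k) :
    ∑ p ∈ Ioc z n with p.Prime, (1 / p : ℝ) ≤ 2 * k := by
  have h1 : ∑ p ∈ Ioc z n with p.Prime, (1 / p : ℝ) ≤ ((harmonic n : ℚ) : ℝ) := by
    rw [harmonic_eq_sum_Icc]
    push_cast
    refine (sum_le_sum_of_subset_of_nonneg (fun p hp => ?_) (fun _ _ _ => by positivity)).trans
      (le_of_eq (sum_congr rfl fun p _ => one_div _))
    have := mem_filter.1 hp
    exact mem_Icc.2 ⟨this.2.one_lt.le, (mem_Ioc.1 this.1).2⟩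
  refine h1.trans ((harmonic_le_one_add_log n).trans ?_)
  have h7 : (2 : ℝ) ≤ k := by exact_mod_cast hk
  rcases Nat.eq_zero_or_pos n with rfl | hn0
  · simp; linarith
  have h2 : Real.log n ≤ Real.log ((4 : ℝ) ^ k) :=
    Real.log_le_log (Nat.cast_pos.2 hn0) (by exact_mod_cast hn)
  have h3 : Real.log 4 = 2 * Real.log 2 := by
    rw [show (4 : ℝ) = 2 ^ 2 by norm_num, Real.log_pow]; norm_num
  rw [Real.log_pow, h3] at h2
  have h4 := Real.log_two_lt_d9
  nlinarith

open Classical in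
lemma sum_deg_mul_bigRecip_le {z n T c : ℕ} {δ η h : ℝ} (adj : V → V → Prop) (Y M S : Finset V)
    (f : V → ℕ)
    (hM : ∀ p, p.Prime → z < p → p * ∑ w ∈ M with p ∣ f w, #{v ∈ Y | adj v w} ≤ c + p * T)
    (hS : ∀ w ∈ S, #{v ∈ Y | adj v w} ≤ 8) (hfM : ∀ w ∈ M, f w ∈ Icc 1 n)
    (hfS : ∀ w ∈ S, bigRecip z (f w) ≤ η)
    (hH : ∑ p ∈ Ioc z n with p.Prime, (1 / p : ℝ) ≤ h)
    (hδ : ∑ p ∈ Ioc z n with p.Prime, (1 / p : ℝ) ^ 2 ≤ δ) :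
    ∑ w ∈ M, (#{v ∈ Y | adj v w} : ℝ) * bigRecip z (f w) +
      ∑ w ∈ S, (#{v ∈ Y | adj v w} : ℝ) * bigRecip z (f w) ≤
      c * δ + T * h + 8 * η * #S := by
  have h1 : ∑ w ∈ M, (#{v ∈ Y | adj v w} : ℝ) * bigRecip z (f w) =
      ∑ p ∈ Ioc z n with p.Prime, (1 / p : ℝ) *
        ∑ w ∈ M with p ∣ f w, (#{v ∈ Y | adj v w} : ℝ) := by
    have h2 : ∀ w ∈ M, (#{v ∈ Y | adj v w} : ℝ) * bigRecip z (f w) =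
        ∑ p ∈ Ioc z n with p.Prime, if p ∣ f w then (1 / p : ℝ) * #{v ∈ Y | adj v w} else 0 := by
      intro w hw
      have hw1 := mem_Icc.1 (hfM w hw)
      have h3 : bigPrimes z (f w) = {p ∈ {p ∈ Ioc z n | p.Prime} | p ∣ f w} := by
        ext p
        rw [mem_bigPrimes (by omega), mem_filter, mem_filter, mem_Ioc]
        constructor
        · rintro ⟨ha, hb, hc⟩
          exact ⟨⟨⟨hc, (Nat.le_of_dvd (by omega) hb).trans hw1.2⟩, ha⟩, hb⟩
        · rintro ⟨⟨⟨hc, -⟩, ha⟩, hb⟩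
          exact ⟨ha, hb, hc⟩
      rw [← sum_filter, ← h3, bigRecip, mul_sum]
      exact sum_congr rfl fun p _ => mul_comm _ _
    rw [sum_congr rfl h2, sum_comm]
    refine sum_congr rfl fun p _ => ?_
    rw [mul_sum, sum_filter]
  have h3 : ∑ w ∈ M, (#{v ∈ Y | adj v w} : ℝ) * bigRecip z (f w) ≤
      c * δ + T * h := by
    rw [h1]
    calc ∑ p ∈ Ioc z n with p.Prime, (1 / p : ℝ) *
          ∑ w ∈ M with p ∣ f w, (#{v ∈ Y | adj v w} : ℝ)
        ≤ ∑ p ∈ Ioc z n with p.Prime, ((c : ℝ) * (1 / p) ^ 2 + T * (1 / p)) := by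
          refine sum_le_sum fun p hp => ?_
          have hp' := mem_filter.1 hp
          have hp0 : (0 : ℝ) < p := by exact_mod_cast hp'.2.pos
          have h5 : (p : ℝ) * ∑ w ∈ M with p ∣ f w, (#{v ∈ Y | adj v w} : ℝ) ≤ c + p * T := by
            exact_mod_cast hM p hp'.2 (mem_Ioc.1 hp'.1).1
          rw [← mul_le_mul_iff_right₀ (mul_pos hp0 hp0)]
          refine (le_of_eq ?_).trans (h5.trans (le_of_eq ?_)) <;> field_simp
      _ = c * ∑ p ∈ Ioc z n with p.Prime, (1 / p : ℝ) ^ 2 +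
            T * ∑ p ∈ Ioc z n with p.Prime, (1 / p : ℝ) := by
          rw [sum_add_distrib, mul_sum, mul_sum]
      _ ≤ _ := by
          gcongr
  have h4 : ∑ w ∈ S, (#{v ∈ Y | adj v w} : ℝ) * bigRecip z (f w) ≤ 8 * η * #S := by
    calc ∑ w ∈ S, (#{v ∈ Y | adj v w} : ℝ) * bigRecip z (f w) ≤ ∑ w ∈ S, 8 * η := by
          refine sum_le_sum fun w hw => ?_
          have h5 : (#{v ∈ Y | adj v w} : ℝ) ≤ 8 := by exact_mod_cast hS w hw
          exact mul_le_mul h5 (hfS w hw) (bigRecip_nonneg _ _) (by norm_num)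
      _ = _ := by rw [sum_const, nsmul_eq_mul, mul_comm]
  linarith

end

section

variable {V : Type}

lemma sum_card_fiber {α ι : Type} [Fintype ι] [DecidableEq ι] (Y : Finset α) (c : α → ι)
    (C : ι → Prop) [DecidablePred C] :
    ∑ r with C r, #{v ∈ Y | c v = r} = #{v ∈ Y | C (c v)} := by
  rw [card_eq_sum_card_fiberwise (f := c) (t := univ.filter C) (s := {v ∈ Y | C (c v)})
    (fun v hv => by simpa using (mem_filter.1 hv).2)]
  refine sum_congr rfl fun r hr => congrArg card ?_
  ext v
  simp only [mem_filter]
  constructor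
  · rintro ⟨h1, rfl⟩; exact ⟨⟨h1, (mem_filter.1 hr).2⟩, rfl⟩
  · rintro ⟨⟨h1, -⟩, h2⟩; exact ⟨h1, h2⟩

/-- `v` and the label `x` conflict if some neighbour of `v` in `X` has a label sharing with `x` a
prime factor exceeding `z`. -/
def Conflict (z : ℕ) (adj : V → V → Prop) (X : Finset V) (f : V → ℕ) (v : V) (x : ℕ) : Prop :=
  ∃ w ∈ X, adj v w ∧ ∃ p, p.Prime ∧ z < p ∧ p ∣ f w ∧ p ∣ x

set_option maxHeartbeats 400000 in
open Classical in
theorem exists_completion {z n P T B c : ℕ} [NeZero P] {N₀ E : ℝ} (hz : 1 ≤ z)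
    (hP : ∀ p, p.Prime → z < p → Nat.Coprime p P) (hN : N₀ * P = n)
    (hE : 10 ^ 10 * z * E ≤ N₀) (hE1 : 1 ≤ E) (hTB : (T : ℝ) * B ≤ E)
    (hB : ∀ x ∈ Icc 1 n, #(bigPrimes z x) ≤ B) (hrec : ∀ x ∈ Icc 1 n, bigRecip z x ≤ 1 / 10 ^ 8)
    (hsq : ∑ p ∈ Ioc z n with p.Prime, (1 / p : ℝ) ^ 2 ≤ 1 / 10 ^ 8 / z)
    (hH : ∑ p ∈ Ioc z n with p.Prime, (1 / p : ℝ) ≤ B) (hc : (c : ℝ) ≤ 9 * N₀)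
    (adj : V → V → Prop) (Y M S : Finset V) (hMS : Disjoint M S) (f : V → ℕ)
    (hf : ∀ w ∈ M ∪ S, f w ∈ Icc 1 n) (cls : V → ZMod P)
    (hcls : ∀ v ∈ Y, ∀ w ∈ M ∪ S, adj v w → cls v = cls w)
    (hM : ∀ r p, p.Prime → z < p →
      p * ∑ w ∈ M with cls w = r ∧ p ∣ f w, #{v ∈ Y | adj v w} ≤ c + p * T)
    (hS : ∀ w ∈ S, #{v ∈ Y | adj v w} ≤ 8)
    (hSr : ∀ r, (#{w ∈ S | cls w = r} : ℝ) ≤ N₀ / (100 * z))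
    (hT : ∀ v ∈ Y, #{w ∈ M ∪ S | adj v w} ≤ T)
    (L : Finset ℕ) (hL : L ⊆ Icc 1 n) (hYL : #Y = #L)
    (hL1 : ∀ r : ZMod P, ¬ IsUnit r → 2 / 5 * N₀ ≤ #{x ∈ L | ((x : ℕ) : ZMod P) = r})
    (hL2 : ∀ r : ZMod P, ¬ IsUnit r →
      (#{x ∈ L | ((x : ℕ) : ZMod P) = r} : ℝ) + N₀ / (1000 * z) ≤ #{v ∈ Y | cls v = r})
    (hL3 : ∀ r : ZMod P, ¬ IsUnit r →
      (#{v ∈ Y | cls v = r} : ℝ) ≤ #{x ∈ L | ((x : ℕ) : ZMod P) = r} + N₀ / (100 * z))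
    (hY : ∀ r : ZMod P, IsUnit r → N₀ / 4 ≤ #{v ∈ Y | cls v = r})
    (hunit : P ≤ z * #{r : ZMod P | IsUnit r})
    (Q : Finset ℕ) (hQL : Q ⊆ L) (hQu : ∀ x ∈ Q, IsUnit ((x : ℕ) : ZMod P))
    (hQp : ∀ p, p.Prime → z < p → #{x ∈ Q | p ∣ x} ≤ 1) (hQc : (n : ℝ) / (2000 * z) ≤ #Q) :
    ∃ g : V → ℕ, Set.InjOn g Y ∧ ∀ v ∈ Y, g v ∈ L ∧
      ((g v : ZMod P) = cls v ∨ IsUnit (g v : ZMod P)) ∧ ¬ Conflict z adj (M ∪ S) f v (g v) := by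
  have hz0 : (1 : ℝ) ≤ z := by exact_mod_cast hz
  have hN0 : 0 < N₀ := by nlinarith
  have hEN : 10 ^ 10 * E ≤ N₀ := by nlinarith
  have hEz : 10 ^ 10 * E ≤ N₀ / z := by rw [le_div_iff₀ (by linarith)]; linarith
  have hNz : N₀ / z ≤ N₀ := div_le_self hN0.le hz0
  have e1 : N₀ / (100 * z) = (N₀ / z) / 100 := by field_simp
  have e2 : N₀ / (1000 * z) = (N₀ / z) / 1000 := by field_simp
  have e3 : (n : ℝ) / (2000 * z) = P * ((N₀ / z) / 2000) := by rw [← hN]; field_simp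
  have e4 : (n : ℝ) / P = N₀ := by
    rw [← hN]; field_simp [(Nat.cast_ne_zero (R := ℝ)).2 (NeZero.ne P)]
  rw [e1] at hSr hL3
  rw [e2] at hL2
  rw [e3] at hQc
  have hP1 : (1 : ℝ) ≤ P := by exact_mod_cast NeZero.one_le
  set ν : ℝ := N₀ / z with hν
  have hν0 : 0 < ν := by positivity
  clear_value ν
  have hne : ∀ x ∈ Icc 1 n, x ≠ 0 := fun x hx => by have := (mem_Icc.1 hx).1; omega
  set X : Finset V := M ∪ S with hX
  have hbad1 : ∀ v x, Conflict z adj X f v x ↔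
      ∃ w ∈ {w ∈ X | adj v w}, ∃ p ∈ bigPrimes z (f w), p ∣ x := by
    intro v x
    constructor
    · rintro ⟨w, hw, hvw, p, h1, h2, h3, h4⟩
      exact ⟨w, mem_filter.2 ⟨hw, hvw⟩, p, (mem_bigPrimes (hne _ (hf w hw))).2 ⟨h1, h3, h2⟩, h4⟩
    · rintro ⟨w, hw, p, hp, h4⟩
      obtain ⟨hw1, hw2⟩ := mem_filter.1 hw
      obtain ⟨h1, h3, h2⟩ := (mem_bigPrimes (hne _ (hf w hw1))).1 hp
      exact ⟨w, hw1, hw2, p, h1, h2, h3, h4⟩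
  set U : Finset V := {v ∈ Y | (1 / 16 : ℝ) < ∑ w ∈ X with adj v w, bigRecip z (f w)} with hU
  have hbv : ∀ v ∈ Y, v ∉ U → ∀ r : ZMod P,
      (#{x ∈ L | ((x : ℕ) : ZMod P) = r ∧ Conflict z adj X f v x} : ℝ) ≤ N₀ / 16 + E := by
    intro v hv hvU r
    have h1 : ∑ w ∈ X with adj v w, bigRecip z (f w) ≤ 1 / 16 := by
      by_contra h
      exact hvU (mem_filter.2 ⟨hv, not_le.1 h⟩)
    have h2 := card_bad_labels_le hP {w ∈ X | adj v w} f
      (fun w hw => hne _ (hf w (mem_filter.1 hw).1)) (hT v hv)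
      (fun w hw => hB _ (hf w (mem_filter.1 hw).1)) r L hL
    simp_rw [hbad1]
    rw [e4] at h2
    have h3 := mul_le_mul_of_nonneg_left h1 hN0.le
    linarith
  have hdeg : ∀ w ∈ X, ∀ r, cls w = r → #{v ∈ {v ∈ Y | cls v = r} | adj v w} =
      #{v ∈ Y | adj v w} := by
    intro w hw r hr
    congr 1
    ext v
    simp only [mem_filter]
    constructor
    · rintro ⟨⟨h1, -⟩, h2⟩; exact ⟨h1, h2⟩
    · rintro ⟨h1, h2⟩; exact ⟨⟨h1, (hcls v h1 w hw h2).trans hr⟩, h2⟩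
  have hMr : ∀ r p, p.Prime → z < p → p * ∑ w ∈ {w ∈ M | cls w = r} with p ∣ f w,
      #{v ∈ {v ∈ Y | cls v = r} | adj v w} ≤ c + p * T := by
    intro r p hp hzp
    refine le_trans (le_of_eq ?_) (hM r p hp hzp)
    rw [filter_filter]
    congr 1
    refine sum_congr rfl fun w hw => ?_
    have := mem_filter.1 hw
    exact hdeg w (mem_union_left _ this.1) r this.2.1
  have hSr8 : ∀ r, ∀ w ∈ {w ∈ S | cls w = r}, #{v ∈ {v ∈ Y | cls v = r} | adj v w} ≤ 8 := by
    intro r w hw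
    have := mem_filter.1 hw
    rw [hdeg w (mem_union_right _ this.1) r this.2]
    exact hS w this.1
  have hbx : ∀ x ∈ Icc 1 n, ∀ r : ZMod P,
      (#{v ∈ Y | cls v = r ∧ Conflict z adj X f v x} : ℝ) ≤ N₀ / 12 := by
    intro x hx r
    have h1 := card_bad_vertices_le adj {v ∈ Y | cls v = r} {w ∈ M | cls w = r}
      {w ∈ S | cls w = r} f (hMr r) (hSr8 r) (hne x hx) (hB x hx)
    have h2 : (c : ℝ) * bigRecip z x ≤ 9 * N₀ * (1 / 10 ^ 8) :=
      mul_le_mul hc (hrec x hx) (bigRecip_nonneg _ _) (by positivity)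
    have h3 : #{v ∈ Y | cls v = r ∧ Conflict z adj X f v x} ≤
        #{v ∈ {v ∈ Y | cls v = r} | ∃ w ∈ {w ∈ M | cls w = r} ∪ {w ∈ S | cls w = r}, adj v w ∧
          ∃ p ∈ bigPrimes z x, p ∣ f w} := by
      refine card_le_card fun v hv => ?_
      obtain ⟨hv1, hv2, w, hw, hvw, p, h4, h5, h6, h7⟩ := mem_filter.1 hv
      refine mem_filter.2 ⟨mem_filter.2 ⟨hv1, hv2⟩, w, ?_, hvw, p,
        (mem_bigPrimes (hne x hx)).2 ⟨h4, h7, h5⟩, h6⟩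
      rw [← filter_union]
      exact mem_filter.2 ⟨hw, (hcls v hv1 w hw hvw).symm.trans hv2⟩
    have h4 : (#{v ∈ Y | cls v = r ∧ Conflict z adj X f v x} : ℝ) ≤ _ := Nat.cast_le.2 h3
    have h5 := hSr r
    linarith
  have hUr : ∀ r : ZMod P, (#{v ∈ U | cls v = r} : ℝ) ≤ ν / 10 ^ 5 := by
    intro r
    have h1 := sum_deg_mul_bigRecip_le (η := 1 / 10 ^ 8) adj {v ∈ Y | cls v = r}
      {w ∈ M | cls w = r} {w ∈ S | cls w = r} f (hMr r) (hSr8 r)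
      (fun w hw => hf w (mem_union_left _ (mem_filter.1 hw).1))
      (fun w hw => hrec _ (hf w (mem_union_right _ (mem_filter.1 hw).1))) hH hsq
    rw [← sum_union (disjoint_filter_filter hMS), ← filter_union] at h1
    have h2 : ∑ v ∈ Y with cls v = r, ∑ w ∈ X with adj v w, bigRecip z (f w) =
        ∑ w ∈ X with cls w = r, (#{v ∈ {v ∈ Y | cls v = r} | adj v w} : ℝ) *
          bigRecip z (f w) := by
      simp_rw [← nsmul_eq_mul, ← sum_const]
      refine sum_comm' fun v w => ?_
      simp only [mem_filter]
      constructor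
      · rintro ⟨⟨h1, h2⟩, h3, h4⟩
        exact ⟨⟨⟨h1, h2⟩, h4⟩, h3, (hcls v h1 w h3 h4).symm.trans h2⟩
      · rintro ⟨⟨⟨h1, h2⟩, h4⟩, h3, -⟩
        exact ⟨⟨h1, h2⟩, h3, h4⟩
    rw [← h2] at h1
    have h3 : (#{v ∈ U | cls v = r} : ℝ) * (1 / 16) ≤
        ∑ v ∈ Y with cls v = r, ∑ w ∈ X with adj v w, bigRecip z (f w) := by
      rw [← nsmul_eq_mul, ← sum_const]
      refine (sum_le_sum fun v hv => ?_).trans (sum_le_sum_of_subset_of_nonneg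
        (filter_subset_filter _ (filter_subset _ _)) fun v _ _ =>
          sum_nonneg fun w _ => bigRecip_nonneg _ _)
      exact (mem_filter.1 (mem_filter.1 hv).1).2.le
    have h4 : (c : ℝ) * (1 / 10 ^ 8 / z) ≤ 9 * ν * (1 / 10 ^ 8) := by
      calc (c : ℝ) * (1 / 10 ^ 8 / z) ≤ (9 * N₀) * (1 / 10 ^ 8 / z) := by gcongr
        _ = _ := by rw [hν]; ring
    have h5 := hSr r
    linarith
  have hsumU : ∀ C : ZMod P → Prop, (#{v ∈ U | C (cls v)} : ℝ) ≤
      (#{r : ZMod P | C r} : ℝ) * (ν / 10 ^ 5) := by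
    intro C
    rw [← sum_card_fiber U cls C, ← nsmul_eq_mul, ← sum_const]
    push_cast
    exact sum_le_sum fun r _ => hUr r
  have hUc : (#U : ℝ) ≤ P * (ν / 10 ^ 5) := by
    have := hsumU fun _ => True
    simpa [ZMod.card] using this
  obtain ⟨φ, hφ⟩ : ∃ φ : ℝ, φ = ((#{r : ZMod P | IsUnit r} : ℕ) : ℝ) := ⟨_, rfl⟩
  have hφ1 : (P : ℝ) * ν ≤ φ * N₀ := by
    have h1 : (P : ℝ) ≤ z * φ := by rw [hφ]; exact_mod_cast hunit
    calc (P : ℝ) * ν ≤ z * φ * ν := by gcongr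
      _ = _ := by rw [hν]; field_simp
  have hφ0 : 0 ≤ φ := by rw [hφ]; positivity
  obtain ⟨nL, hnL⟩ : ∃ k, k = #{x ∈ L | ¬ IsUnit ((x : ℕ) : ZMod P)} := ⟨_, rfl⟩
  have hnL' : nL = ∑ r : ZMod P with ¬ IsUnit r, #{x ∈ L | ((x : ℕ) : ZMod P) = r} :=
    hnL.trans (sum_card_fiber L (fun x : ℕ => (x : ZMod P)) fun r => ¬ IsUnit r).symm
  have hnU : (#{r : ZMod P | ¬ IsUnit r} : ℝ) ≤ P := by
    have : #{r : ZMod P | ¬ IsUnit r} ≤ Fintype.card (ZMod P) := card_le_univ _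
    rw [ZMod.card] at this
    exact_mod_cast this
  have hnY : (#{v ∈ Y | ¬ IsUnit (cls v)} : ℝ) ≤ nL + P * (ν / 100) := by
    rw [← sum_card_fiber Y cls fun r => ¬ IsUnit r, hnL']
    push_cast
    calc _ ≤ ∑ r : ZMod P with ¬ IsUnit r,
          ((#{x ∈ L | ((x : ℕ) : ZMod P) = r} : ℝ) + ν / 100) :=
        sum_le_sum fun r hr => hL3 r (mem_filter.1 hr).2
      _ = ∑ r : ZMod P with ¬ IsUnit r, (#{x ∈ L | ((x : ℕ) : ZMod P) = r} : ℝ) +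
          #{r : ZMod P | ¬ IsUnit r} * (ν / 100) := by
        rw [sum_add_distrib, sum_const, nsmul_eq_mul]
      _ ≤ _ := by gcongr
  have hWreal : φ * (N₀ / 5) + #U + nL ≤ #Y := by
    have h1 : (#Y : ℝ) = #{v ∈ Y | IsUnit (cls v)} + #{v ∈ Y | ¬ IsUnit (cls v)} := by
      exact_mod_cast (card_filter_add_card_filter_not _).symm
    have h2 : (#U : ℝ) = #{v ∈ U | IsUnit (cls v)} + #{v ∈ U | ¬ IsUnit (cls v)} := by
      exact_mod_cast (card_filter_add_card_filter_not _).symm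
    have h3 : (#{v ∈ U | ¬ IsUnit (cls v)} : ℝ) + nL ≤ #{v ∈ Y | ¬ IsUnit (cls v)} := by
      rw [← sum_card_fiber U cls fun r => ¬ IsUnit r, hnL',
        ← sum_card_fiber Y cls fun r => ¬ IsUnit r]
      push_cast
      rw [← sum_add_distrib]
      refine sum_le_sum fun r hr => ?_
      have := hUr r
      have := hL2 r (mem_filter.1 hr).2
      linarith
    have h4 : φ * (N₀ / 4) ≤ #{v ∈ Y | IsUnit (cls v)} := by
      rw [← sum_card_fiber Y cls IsUnit, hφ, ← nsmul_eq_mul, ← sum_const]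
      push_cast
      exact sum_le_sum fun r hr => hY r (mem_filter.1 hr).2
    have h5 := hsumU IsUnit
    have h6 : φ * (ν / 10 ^ 5) ≤ φ * (N₀ / 20) := by gcongr; linarith
    linarith
  have hWnat : #U + nL ≤ #Y := by
    have : (#U : ℝ) + nL ≤ #Y := by
      have : 0 ≤ φ * (N₀ / 5) := by positivity
      linarith
    exact_mod_cast this
  obtain ⟨W, hW⟩ := Nat.exists_eq_add_of_le hWnat
  have hWr : φ * (N₀ / 5) ≤ W := by
    have : (#Y : ℝ) = #U + nL + W := by exact_mod_cast hW
    linarith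
  refine exists_class_matching Y L hYL cls (fun x => (x : ZMod P)) IsUnit U (filter_subset _ _)
    Q hQL hQu (Conflict z adj X f) (T * B) W ?_ ?_ ?_ ?_ ?_ ?_ ?_ ?_
  · intro r hr
    have h1 := hL2 r hr
    have h2 := hUr r
    have h3 : #{v ∈ Y | cls v = r} ≤ #{v ∈ Y | cls v = r ∧ v ∉ U} + #{v ∈ U | cls v = r} := by
      refine (card_le_card fun v hv => ?_).trans (card_union_le _ _)
      rw [mem_filter] at hv
      by_cases h : v ∈ U
      · exact mem_union_right _ (mem_filter.2 ⟨h, hv.2⟩)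
      · exact mem_union_left _ (mem_filter.2 ⟨hv.1, hv.2, h⟩)
    have h4 : (#{v ∈ Y | cls v = r} : ℝ) ≤ #{v ∈ Y | cls v = r ∧ v ∉ U} + #{v ∈ U | cls v = r} := by
      exact_mod_cast h3
    have h5 : (#{x ∈ L | ((x : ℕ) : ZMod P) = r} : ℝ) ≤ #{v ∈ Y | cls v = r ∧ v ∉ U} := by linarith
    exact_mod_cast h5
  · intro v hv hvU hr
    have h1 := hbv v hv hvU (cls v)
    have h2 := hL1 (cls v) hr
    have h3 : 2 * (#{x ∈ L | ((x : ℕ) : ZMod P) = cls v ∧ Conflict z adj X f v x} : ℝ) ≤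
      #{x ∈ L | ((x : ℕ) : ZMod P) = cls v} := by linarith
    exact_mod_cast h3
  · intro x hx hr
    have h1 := hbx x (hL hx) x
    have h2 := hL1 x hr
    have h3 : 2 * (#{v ∈ Y | cls v = x ∧ Conflict z adj X f v x} : ℝ) ≤
      #{y ∈ L | ((y : ℕ) : ZMod P) = x} := by linarith
    exact_mod_cast h3
  · have h1 : E ≤ P * E := le_mul_of_one_le_left (by linarith) hP1
    have h2 : (P : ℝ) * E ≤ P * (ν / 10 ^ 5) := by gcongr; linarith
    have h4 : 0 < (P : ℝ) * ν := by positivity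
    have h3 : (#U : ℝ) + T * B ≤ #Q := by linarith
    exact_mod_cast h3
  · intro v hv
    have hvY := (mem_filter.1 hv).1
    calc #{x ∈ Q | Conflict z adj X f v x}
        ≤ #({w ∈ X | adj v w}.biUnion fun w => (bigPrimes z (f w)).biUnion fun p =>
            {x ∈ Q | p ∣ x}) := by
          refine card_le_card fun x hx => ?_
          obtain ⟨hx1, hx2⟩ := mem_filter.1 hx
          obtain ⟨w, hw, p, hp, hpx⟩ := (hbad1 v x).1 hx2
          exact mem_biUnion.2 ⟨w, hw, mem_biUnion.2 ⟨p, hp, mem_filter.2 ⟨hx1, hpx⟩⟩⟩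
      _ ≤ #{w ∈ X | adj v w} * B := card_biUnion_le_card_mul _ _ _ fun w hw => by
          have hw1 := hf w (mem_filter.1 hw).1
          refine (card_biUnion_le_card_mul _ _ 1 fun p hp => ?_).trans
            ((mul_one _).le.trans (hB _ hw1))
          have := (mem_bigPrimes (hne _ hw1)).1 hp
          exact hQp p this.1 this.2.2
      _ ≤ T * B := Nat.mul_le_mul_right _ (hT v hvY)
  · omega
  · intro v hv hvU
    have h1 : (#{x ∈ L | IsUnit ((x : ℕ) : ZMod P) ∧ Conflict z adj X f v x} : ℝ) ≤
        φ * (N₀ / 16 + E) := by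
      have h2 := sum_card_fiber {x ∈ L | Conflict z adj X f v x} (fun x : ℕ => (x : ZMod P)) IsUnit
      rw [filter_filter] at h2
      simp_rw [and_comm (a := IsUnit _), ← h2, hφ]
      rw [← nsmul_eq_mul, ← sum_const]
      push_cast
      refine sum_le_sum fun r _ => ?_
      rw [filter_filter]
      simp_rw [and_comm (a := Conflict _ _ _ _ _ _)]
      exact hbv v hv hvU r
    have h2 : φ * (N₀ / 16 + E) ≤ φ * (N₀ / 10) := by gcongr; linarith
    have h3 : 2 * (#{x ∈ L | IsUnit ((x : ℕ) : ZMod P) ∧ Conflict z adj X f v x} : ℝ) ≤ W := by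
      linarith
    exact_mod_cast h3
  · intro x hx _
    have h1 : (#{v ∈ Y | IsUnit (cls v) ∧ Conflict z adj X f v x} : ℝ) ≤ φ * (N₀ / 12) := by
      have h2 := sum_card_fiber {v ∈ Y | Conflict z adj X f v x} cls IsUnit
      rw [filter_filter] at h2
      simp_rw [and_comm (a := IsUnit _), ← h2, hφ]
      rw [← nsmul_eq_mul, ← sum_const]
      push_cast
      refine sum_le_sum fun r _ => ?_
      rw [filter_filter]
      simp_rw [and_comm (a := Conflict _ _ _ _ _ _)]
      exact hbx x (hL hx) r
    have h3 : 2 * ((#{v ∈ Y | IsUnit (cls v) ∧ Conflict z adj X f v x} : ℝ) +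
      #{v ∈ Y | ¬ IsUnit (cls v)}) ≤ W + 2 * nL := by linarith
    rw [hnL] at h3
    exact_mod_cast h3

end

section

variable {V : Type}

lemma card_slots {P : ℕ} [NeZero P] (F : Finset (ZMod P)) (r : ZMod P) :
    #{s : ZMod P × Fin 8 | ¬ (s.1 ∈ F ∧ s.2 = 7) ∧ s.1 = r} = if r ∈ F then 7 else 8 := by
  have h : ({s : ZMod P × Fin 8 | ¬ (s.1 ∈ F ∧ s.2 = 7) ∧ s.1 = r} : Finset _) =
      ({j : Fin 8 | ¬ (r ∈ F ∧ j = 7)} : Finset _).map ⟨fun j => (r, j), fun i j hij => by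
        simpa using hij⟩ := by
    ext ⟨s, j⟩
    simp only [mem_filter, mem_univ, true_and, mem_map]
    constructor
    · rintro ⟨h1, rfl⟩; exact ⟨j, h1, rfl⟩
    · rintro ⟨i, h1, h2⟩; cases h2; exact ⟨h1, rfl⟩
  rw [h, card_map]
  by_cases hr : r ∈ F
  · simp only [hr, true_and, if_true]; decide
  · simp [hr]

lemma exists_slots {P : ℕ} [NeZero P] (F : Finset (ZMod P)) :
    ∃ (M : ℕ) (π : Fin M → ZMod P), M + #F = 8 * P ∧
      ∀ r, #{i | π i = r} = if r ∈ F then 7 else 8 := by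
  set slots : Finset (ZMod P × Fin 8) := {s | ¬ (s.1 ∈ F ∧ s.2 = 7)} with hs
  refine ⟨#slots, fun i => (slots.equivFin.symm i).1.1, ?_, fun r => ?_⟩
  · have h1 : #slots = ∑ r, if r ∈ F then 7 else 8 := by
      rw [card_eq_sum_card_fiberwise (f := Prod.fst) (t := univ) (fun _ _ => mem_univ _)]
      refine sum_congr rfl fun r _ => ?_
      rw [hs, filter_filter, card_slots]
    have h2 : ∑ r : ZMod P, (if r ∈ F then 7 else 8) + ∑ r : ZMod P, (if r ∈ F then 1 else 0)
        = 8 * P := by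
      rw [← sum_add_distrib, sum_congr rfl (g := fun _ => 8)]
      · simp [ZMod.card, mul_comm]
      · intro r _; split_ifs <;> rfl
    rw [h1, ← h2]
    simp
  · rw [← card_slots F r, ← filter_filter, ← hs]
    refine card_bij (fun i _ => (slots.equivFin.symm i).1) (fun i hi => ?_) (fun i _ j _ h => ?_)
      fun s h => ?_
    · exact mem_filter.2 ⟨(slots.equivFin.symm i).2, (mem_filter.1 hi).2⟩
    · simpa using Subtype.ext h
    · have h' := mem_filter.1 h
      exact ⟨slots.equivFin ⟨s, h'.1⟩, by simpa using h'.2, by simp⟩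

/-- Adjacency in the forest given by a parent function. -/
def Linked (par : V → Option V) (u v : V) : Prop := par u = some v ∨ par v = some u

lemma Linked.symm {par : V → Option V} {u v : V} (h : Linked par u v) : Linked par v u := Or.symm h

open Classical in
theorem exists_classes [Fintype V] (par : V → Option V) (d : V → ℕ)
    (hd : ∀ u v, par u = some v → d v + 1 = d u) (T : ℕ) {P : ℕ} [NeZero P] (F : Finset (ZMod P))
    (A B : Finset V) :
    ∃ (M : ℕ) (S : Finset V) (cls : V → ZMod P), M + #F = 8 * P ∧ #S * T ≤ Fintype.card V ∧
      (∀ u v, Linked par u v → u ∉ S → v ∉ S → cls u = cls v) ∧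
      (∀ v, v ∉ S → #{w | w ∉ S ∧ Linked par v w} ≤ T) ∧
      ∀ r, |(#{v ∈ A \ S | cls v = r} : ℝ) * M - (if r ∈ F then 7 else 8) * #(A \ S)| ≤
          M * (8 * (T + 1) ^ 3) ∧
        |(#{v ∈ B \ S | cls v = r} : ℝ) * M - (if r ∈ F then 7 else 8) * #(B \ S)| ≤
          M * (8 * (T + 1) ^ 3) := by
  obtain ⟨S, κ, hS, hκ, hκT⟩ := exists_separator par d hd T
  obtain ⟨M, π, hM, hπ⟩ := exists_slots F
  have hP := NeZero.pos P
  have hF : #F ≤ P := by simpa [ZMod.card] using card_le_univ F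
  have hle : ∀ (A : Finset V) x, #{v ∈ A \ S | κ v = x} ≤ T := fun A x =>
    (card_le_card fun v hv => by
      simp only [mem_filter, mem_sdiff, mem_univ, true_and] at hv ⊢
      exact ⟨hv.1.2, hv.2⟩).trans (hκT x)
  obtain ⟨g, hg⟩ := exists_balanced κ (A \ S) (B \ S) (T := T) (M := M) (by omega)
    (hle A) (hle B)
  have hκ' : ∀ u v, Linked par u v → u ∉ S → v ∉ S → κ u = κ v := by
    rintro u v (h | h) hu hv
    · exact hκ u v h hu hv
    · exact (hκ v u h hv hu).symm
  have key : ∀ A : Finset V, (∀ j, |((#{v ∈ A | g (κ v) = j} : ℕ) : ℤ) * M - (#A : ℤ)| ≤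
      M * (T + 1) ^ 3) → ∀ r, |(#{v ∈ A | π (g (κ v)) = r} : ℝ) * M -
        (if r ∈ F then 7 else 8) * #A| ≤ M * (8 * (T + 1) ^ 3) := by
    intro A hA r
    have h1 : (#{v ∈ A | π (g (κ v)) = r} : ℝ) = ∑ j with π j = r, (#{v ∈ A | g (κ v) = j} : ℝ) := by
      have := sum_card_fiber A (fun v => g (κ v)) (fun j => π j = r)
      exact_mod_cast this.symm
    have h2 : (((if r ∈ F then 7 else 8 : ℕ) : ℕ) : ℝ) = if r ∈ F then (7 : ℝ) else 8 := by
      split_ifs <;> norm_num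
    have h3 : ∀ j, |(#{v ∈ A | g (κ v) = j} : ℝ) * M - #A| ≤ M * (T + 1) ^ 3 := fun j => by
      exact_mod_cast hA j
    have h4 : ((if r ∈ F then 7 else 8 : ℕ) : ℕ) ≤ 8 := by split_ifs <;> norm_num
    rw [h1, ← h2, ← hπ r, sum_mul, ← nsmul_eq_mul, ← sum_const, ← sum_sub_distrib]
    refine (abs_sum_le_sum_abs _ _).trans ((sum_le_sum fun j _ => h3 j).trans ?_)
    rw [sum_const, nsmul_eq_mul, hπ r]
    calc ((if r ∈ F then 7 else 8 : ℕ) : ℝ) * ((M : ℝ) * (T + 1) ^ 3)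
        ≤ 8 * ((M : ℝ) * (T + 1) ^ 3) := by gcongr; exact_mod_cast h4
      _ = _ := by ring
  refine ⟨M, S, fun v => π (g (κ v)), hM, hS, fun u v h hu hv => ?_, fun v hv => ?_, fun r =>
    ⟨key _ (fun j => (hg j).1) r, key _ (fun j => (hg j).2) r⟩⟩
  · simp only [hκ' u v h hu hv]
  · refine (card_le_card fun w hw => ?_).trans (hκT (κ v))
    simp only [mem_filter, mem_univ, true_and] at hw ⊢
    exact ⟨hw.1, (hκ' v w hw.2 hv hw.1).symm⟩

end

section

variable {V : Type}

open Classical in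
lemma sum_linked_le (par : V → Option V) (X Y : Finset V) :
    ∑ w ∈ X, #{v ∈ Y | Linked par v w} ≤ #X + #Y := by
  have h1 : ∀ w ∈ X, #{v ∈ Y | Linked par v w} ≤
      #{v ∈ Y | par v = some w} + #{v ∈ Y | par w = some v} := by
    intro w _
    refine (card_le_card fun v hv => ?_).trans (card_union_le _ _)
    obtain ⟨h1, h2 | h2⟩ := mem_filter.1 hv
    · exact mem_union_left _ (mem_filter.2 ⟨h1, h2⟩)
    · exact mem_union_right _ (mem_filter.2 ⟨h1, h2⟩)
  have h2 : ∑ w ∈ X, #{v ∈ Y | par v = some w} ≤ #Y := by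
    rw [← card_biUnion]
    · exact card_le_card (biUnion_subset.2 fun w _ => filter_subset _ _)
    · intro a _ b _ hab
      rw [Function.onFun, disjoint_filter]
      intro x _ h1 h2
      exact hab (Option.some.inj (h1.symm.trans h2))
  have h3 : ∑ w ∈ X, #{v ∈ Y | par w = some v} ≤ #X := by
    rw [card_eq_sum_ones X]
    refine sum_le_sum fun w _ => card_le_one.2 fun a ha b hb => ?_
    exact Option.some.inj ((mem_filter.1 ha).2.symm.trans (mem_filter.1 hb).2)
  have := sum_le_sum h1
  rw [sum_add_distrib] at this
  omega

lemma coprime_of_lt_two_mul {n p x : ℕ} (hp : p.Prime) (hn : n < 2 * p) (hx : x ∈ Icc 1 n)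
    (hxp : x ≠ p) : Nat.Coprime p x := by
  rw [hp.coprime_iff_not_dvd]
  rintro ⟨k, rfl⟩
  have hx' := mem_Icc.1 hx
  rcases k with _ | _ | k
  · simp at hx'
  · simp at hxp
  · nlinarith

lemma card_odd_Icc (n : ℕ) : n ≤ 2 * #{x ∈ Icc 1 n | Odd x} := by
  have h : #(range ((n + 1) / 2)) ≤ #{x ∈ Icc 1 n | Odd x} := by
    refine card_le_card_of_injOn (fun k => 2 * k + 1) (fun k hk => ?_) fun x _ y _ h => ?_
    · simp only [coe_range, Set.mem_Iio] at hk
      simp only [coe_filter, mem_Icc, Set.mem_ofPred_eq]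
      exact ⟨⟨by omega, by omega⟩, odd_two_mul_add_one k⟩
    · simpa using h
  rw [card_range] at h
  omega

/-- A labelling of a small separator `S`, together with a few extra vertices `R`, whose labels
cannot conflict with the remaining ones. -/
structure SpecialLabelling (par : V → Option V) (n : ℕ) (A S R : Finset V) (f : V → ℕ) :
    Prop where
  injOn : Set.InjOn f {v | v ∈ S ∨ v ∈ R}
  mem_Icc : ∀ v, v ∈ S ∨ v ∈ R → f v ∈ Icc 1 n
  lt_four_mul : ∀ v, v ∈ S ∨ v ∈ R → n < 4 * f v
  coprime : ∀ u ∈ S, ∀ v, v ∈ S ∨ v ∈ R → Linked par u v → Nat.Coprime (f u) (f v)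
  coprime_of_mem : ∀ s ∈ S, s ∈ A → ∀ x ∈ Icc 1 n, (∀ v, v ∈ S ∨ v ∈ R → f v ≠ x) →
    Nat.Coprime (f s) x
  coprime_of_notMem : ∀ s ∈ S, s ∉ A → ∀ x ∈ Icc 1 n, (∀ v, v ∈ S ∨ v ∈ R → f v ≠ x) →
    Odd x → Nat.Coprime (f s) x
  eq_three : ∀ w ∈ R, ∀ x ∈ Icc 1 n, (∀ v, v ∈ S ∨ v ∈ R → f v ≠ x) →
    ∀ p, p.Prime → p ∣ f w → p ∣ x → p = 3

open Classical in
lemma exists_specialLabelling_of_few [Fintype V] (par : V → Option V) {n : ℕ} (A S : Finset V)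
    (hbip : ∀ u v, Linked par u v → (u ∈ A ↔ v ∉ A))
    (Pr : Finset ℕ) (hPr : ∀ p ∈ Pr, p.Prime ∧ n < 2 * p ∧ p ≤ n) (hn : 4 ≤ n) (hSPr : #S ≤ #Pr)
    (hA : 2 * #A + 2 * #(S \ A) ≤ n) :
    ∃ f : V → ℕ, SpecialLabelling par n A S ∅ f ∧
      #(A \ S) ≤ #{x ∈ Icc 1 n | Odd x ∧ ∀ v, v ∈ S ∨ v ∈ (∅ : Finset V) → f v ≠ x} := by
  obtain ⟨f, hfi, hf⟩ := exists_matching_of_few S Pr (fun _ _ => False) 0 (by omega) (by simp)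
  have hf' : ∀ v ∈ S, (f v).Prime ∧ n < 2 * f v ∧ f v ≤ n := fun v hv => hPr _ (hf v hv).1
  have hIcc : ∀ v ∈ S, f v ∈ Icc 1 n := fun v hv =>
    mem_Icc.2 ⟨(hf' v hv).1.one_lt.le, (hf' v hv).2.2⟩
  refine ⟨f, ⟨?_, ?_, ?_, ?_, ?_, ?_, ?_⟩, ?_⟩
  · simpa using hfi
  · simpa using hIcc
  · intro v hv
    have := (hf' v (by simpa using hv)).2.1
    omega
  · intro u hu v hv huv
    have hv' : v ∈ S := by simpa using hv
    rw [Nat.coprime_primes (hf' u hu).1 (hf' v hv').1]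
    intro h
    have := hfi hu hv' h
    subst this
    have := hbip u u huv
    tauto
  · intro s hs _ x hx hxn
    exact coprime_of_lt_two_mul (hf' s hs).1 (hf' s hs).2.1 hx (hxn s (Or.inl hs)).symm
  · intro s hs _ x hx hxn _
    exact coprime_of_lt_two_mul (hf' s hs).1 (hf' s hs).2.1 hx (hxn s (Or.inl hs)).symm
  · simp
  · have h1 : #{x ∈ Icc 1 n | Odd x} ≤ #{x ∈ Icc 1 n | Odd x ∧ ∀ v,
        v ∈ S ∨ v ∈ (∅ : Finset V) → f v ≠ x} + #(S.image f) := by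
      refine (card_le_card fun x hx => ?_).trans (card_union_le _ _)
      rw [mem_filter] at hx
      by_cases h : x ∈ S.image f
      · exact mem_union_right _ h
      · refine mem_union_left _ (mem_filter.2 ⟨hx.1, hx.2, fun v hv hvx => h ?_⟩)
        exact mem_image.2 ⟨v, by simpa using hv, hvx⟩
    have h2 := card_odd_Icc n
    have h3 := card_image_le (s := S) (f := f)
    have h4 := card_sdiff_add_card_inter A S
    have h5 := card_sdiff_add_card_inter S A
    rw [inter_comm] at h5
    omega

open Classical in
lemma exists_specialLabelling_of_many [Fintype V] (par : V → Option V) {n : ℕ} (A S pool : Finset V)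
    (hbip : ∀ u v, Linked par u v → (u ∈ A ↔ v ∉ A))
    (Pr Pr' : Finset ℕ) (hPr : ∀ p ∈ Pr, p.Prime ∧ n < 2 * p ∧ p ≤ n)
    (hPr' : ∀ p ∈ Pr', p.Prime ∧ n < 4 * p ∧ 2 * p ≤ n)
    (hn : 16 ≤ n) (hSPr : #S ≤ #Pr) (hSPr' : #S ≤ #Pr') (hA : 2 * #A ≤ n) (hSA : (S \ A).Nonempty)
    (hpA : pool ⊆ A \ S) (hpool : 4 * #S + 2 ≤ #pool) :
    ∃ (R : Finset V) (f : V → ℕ), R ⊆ pool ∧ #R ≤ 2 * #S ∧ SpecialLabelling par n A S R f ∧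
      #(A \ (S ∪ R)) ≤ #{x ∈ Icc 1 n | Odd x ∧ ∀ v, v ∈ S ∨ v ∈ R → f v ≠ x} := by
  obtain ⟨s₀, hs₀, hmax⟩ := exists_max_image (S \ A) (fun s => #{v ∈ pool | Linked par v s}) hSA
  obtain ⟨P, hPi, hP⟩ := exists_matching_of_few S Pr (fun _ _ => False) 0 (by omega) (by simp)
  obtain ⟨q, hqi, hq⟩ := exists_matching_of_few S Pr' (fun _ _ => False) 0 (by omega) (by simp)
  have hP' : ∀ v ∈ S, (P v).Prime ∧ n < 2 * P v ∧ P v ≤ n := fun v hv => hPr _ (hP v hv).1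
  have hq' : ∀ v ∈ S, (q v).Prime ∧ n < 4 * q v ∧ 2 * q v ≤ n := fun v hv => hPr' _ (hq v hv).1
  clear hPr hPr' hSPr hSPr' hP hq
  set k := Nat.log 2 n with hk
  have hk1 : 2 ^ k ≤ n := Nat.pow_log_le_self 2 (by omega)
  have hk2 : n < 2 * 2 ^ k := by
    have := Nat.lt_pow_succ_log_self (b := 2) (by norm_num) n
    rwa [pow_succ, mul_comm] at this
  have hk0 : k ≠ 0 := by rintro h; rw [h] at hk2; omega
  clear_value k
  have hkeven : Even (2 ^ k) := (Nat.even_pow.2 ⟨even_two, hk0⟩)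
  have hPodd : ∀ v ∈ S, Odd (P v) := fun v hv =>
    (hP' v hv).1.odd_of_ne_two (by have := (hP' v hv).2.1; omega)
  have hqodd : ∀ v ∈ S, Odd (q v) := fun v hv =>
    (hq' v hv).1.odd_of_ne_two (by have := (hq' v hv).2.1; omega)
  set S' : Finset V := (S \ A).erase s₀ with hS'
  have hS'S : ∀ s ∈ S', s ∈ S := fun s hs => (mem_sdiff.1 (mem_of_mem_erase hs)).1
  have hdeg : ∀ s ∈ S', 2 * #{v ∈ pool | Linked par v s} ≤ #pool + 2 := by
    intro s hs
    have h1 := hmax s (mem_of_mem_erase hs)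
    have h2 := sum_linked_le par {s, s₀} pool
    rw [sum_pair (ne_of_mem_erase hs), card_pair (ne_of_mem_erase hs)] at h2
    omega
  have hmul : ∀ s ∈ S, ∀ x ∈ Icc 1 n, q s ∣ x → x = q s ∨ x = 2 * q s ∨ x = 3 * q s := by
    rintro s hs x hx ⟨m, rfl⟩
    have h1 := mem_Icc.1 hx
    have h2 := (hq' s hs).2.1
    have h3 : m < 4 := by
      by_contra h
      have : q s * 4 ≤ q s * m := Nat.mul_le_mul_left _ (not_lt.1 h)
      omega
    interval_cases m
    · omega
    · left; ring
    · right; left; ring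
    · right; right; ring
  set O : Finset ℕ := {x ∈ Icc 1 n | Odd x ∧ ∃ s ∈ S', q s ∣ x} with hO
  have hOc : #O ≤ 2 * #S := by
    have h1 : O ⊆ S.biUnion fun s => {q s, 3 * q s} := by
      intro x hx
      obtain ⟨hx1, hx2, s, hs, hsx⟩ := mem_filter.1 hx
      refine mem_biUnion.2 ⟨s, hS'S s hs, ?_⟩
      rcases hmul s (hS'S s hs) x hx1 hsx with h | h | h
      · simp [h]
      · rw [h] at hx2; exact absurd hx2 (by simp)
      · simp [h]
    have h2 := (card_le_card h1).trans (card_biUnion_le_card_mul _ _ 2 fun s _ => card_le_two)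
    omega
  have : Nonempty V := ⟨s₀⟩
  obtain ⟨Bad, hBad⟩ : ∃ Bad : ℕ → V → Prop, ∀ x v, Bad x v ↔
      ∃ s ∈ S', q s ∣ x ∧ Linked par v s := ⟨_, fun _ _ => Iff.rfl⟩
  obtain ⟨h, hhi, hh⟩ := exists_matching_of_few O pool Bad (#pool / 2 + 1) (by omega) (by
      intro x hx
      obtain ⟨hx1, hx2, s, hs, hsx⟩ := mem_filter.1 hx
      refine (card_le_card (t := {v ∈ pool | Linked par v s}) fun v hv => ?_).trans
        (by have := hdeg s hs; omega)
      obtain ⟨hv1, hvb⟩ := mem_filter.1 hv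
      obtain ⟨t, ht, htx, hvt⟩ := (hBad x v).1 hvb
      have hst : s = t := by
        by_contra hst
        have h1 : Nat.Coprime (q s) (q t) :=
          (Nat.coprime_primes (hq' s (hS'S s hs)).1 (hq' t (hS'S t ht)).1).2 fun h =>
            hst (hqi (hS'S s hs) (hS'S t ht) h)
        have h2 := Nat.le_of_dvd (mem_Icc.1 hx1).1 (h1.mul_dvd_of_dvd_of_dvd hsx htx)
        have h3 := (hq' s (hS'S s hs)).2.1
        have h4 := (hq' t (hS'S t ht)).2.1
        have h5 := (mem_Icc.1 hx1).2
        have h6 : n * n < 16 * n := calc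
          n * n < (4 * q s) * (4 * q t) := Nat.mul_lt_mul'' h3 h4
          _ = 16 * (q s * q t) := by ring
          _ ≤ 16 * n := by omega
        have := lt_of_mul_lt_mul_right h6 (Nat.zero_le n)
        omega
      exact mem_filter.2 ⟨hv1, hst ▸ hvt⟩)
  set R := O.image h with hR
  have hRp : R ⊆ pool := by
    intro v hv
    obtain ⟨x, hx, rfl⟩ := mem_image.1 hv
    exact (hh x hx).1
  have hRA : ∀ v ∈ R, v ∈ A ∧ v ∉ S := fun v hv => mem_sdiff.1 (hpA (hRp hv))
  obtain ⟨f, hf⟩ : ∃ f : V → ℕ, f = fun v => if v ∈ S then (if v ∈ A then P v else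
    if v = s₀ then 2 ^ k else 2 * q v) else Function.invFunOn h O v := ⟨_, rfl⟩
  have hfP : ∀ v ∈ S, v ∈ A → f v = P v := fun v h1 h2 => by simp [hf, h1, h2]
  have hs₀' := mem_sdiff.1 hs₀
  have hf0 : f s₀ = 2 ^ k := by simp [hf, hs₀'.1, hs₀'.2]
  have hfq : ∀ v ∈ S', f v = 2 * q v := fun v hv => by
    have := mem_sdiff.1 (mem_of_mem_erase hv)
    simp [hf, this.1, this.2, ne_of_mem_erase hv]
  have hfR : ∀ x ∈ O, f (h x) = x := fun x hx => by
    have h1 := (hRA (h x) (mem_image_of_mem _ hx)).2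
    have h2 : f (h x) = Function.invFunOn h O (h x) := by simp [hf, h1]
    rw [h2]
    exact hhi.leftInvOn_invFunOn hx
  clear hf
  have hcases : ∀ v, v ∈ S ∨ v ∈ R → (v ∈ S ∧ v ∈ A) ∨ v = s₀ ∨ v ∈ S' ∨ ∃ x ∈ O, h x = v := by
    intro v hv
    by_cases h1 : v ∈ S
    · by_cases h2 : v ∈ A
      · exact Or.inl ⟨h1, h2⟩
      · by_cases h3 : v = s₀
        · exact Or.inr (Or.inl h3)
        · exact Or.inr (Or.inr (Or.inl (mem_erase.2 ⟨h3, mem_sdiff.2 ⟨h1, h2⟩⟩)))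
    · exact Or.inr (Or.inr (Or.inr (mem_image.1 (hv.resolve_left h1))))
  have hS'A : ∀ s ∈ S', s ∉ A := fun s hs => (mem_sdiff.1 (mem_of_mem_erase hs)).2
  have hIcc : ∀ v, v ∈ S ∨ v ∈ R → f v ∈ Icc 1 n := by
    intro v hv
    rw [mem_Icc]
    rcases hcases v hv with ⟨h1, h2⟩ | rfl | h1 | ⟨x, hx, rfl⟩
    · rw [hfP v h1 h2]
      exact ⟨(hP' v h1).1.one_lt.le, (hP' v h1).2.2⟩
    · rw [hf0]
      exact ⟨Nat.one_le_two_pow, hk1⟩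
    · rw [hfq v h1]
      have := (hq' v (hS'S v h1)).1.one_lt
      exact ⟨by omega, (hq' v (hS'S v h1)).2.2⟩
    · rw [hfR x hx]
      exact mem_Icc.1 (mem_filter.1 hx).1
  have hqO : ∀ s ∈ S', ∀ x ∈ Icc 1 n, (∀ v, v ∈ S ∨ v ∈ R → f v ≠ x) → ¬ q s ∣ x := by
    intro s hs x hx hxn hd
    rcases hmul s (hS'S s hs) x hx hd with h1 | h1 | h1
    · have hxO : x ∈ O := mem_filter.2 ⟨hx, h1 ▸ hqodd s (hS'S s hs), s, hs, hd⟩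
      exact hxn (h x) (Or.inr (mem_image_of_mem _ hxO)) (hfR x hxO)
    · exact hxn s (Or.inl (hS'S s hs)) ((hfq s hs).trans h1.symm)
    · have hxO : x ∈ O := mem_filter.2 ⟨hx, h1 ▸ (by decide : Odd 3).mul (hqodd s (hS'S s hs)),
        s, hs, hd⟩
      exact hxn (h x) (Or.inr (mem_image_of_mem _ hxO)) (hfR x hxO)
  have hPc : ∀ s ∈ S, s ∈ A → ∀ x ∈ Icc 1 n, x ≠ f s → Nat.Coprime (f s) x := by
    intro s hs hsA x hx hxs
    rw [hfP s hs hsA] at hxs ⊢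
    exact coprime_of_lt_two_mul (hP' s hs).1 (hP' s hs).2.1 hx hxs
  have hqc : ∀ s ∈ S', ∀ x, Odd x → ¬ q s ∣ x → Nat.Coprime (f s) x := by
    intro s hs x hx hd
    rw [hfq s hs]
    exact Nat.Coprime.mul_left hx.coprime_two_left (((hq' s (hS'S s hs)).1.coprime_iff_not_dvd).2 hd)
  have h0c : ∀ x, Odd x → Nat.Coprime (f s₀) x := fun x hx => by
    rw [hf0]
    exact Nat.Coprime.pow_left _ hx.coprime_two_left
  have hodd : ∀ v ∈ A, v ∈ S ∨ v ∈ R → Odd (f v) := by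
    intro v hvA hv
    rcases hcases v hv with ⟨h1, h2⟩ | rfl | h1 | ⟨x, hx, rfl⟩
    · rw [hfP v h1 h2]; exact hPodd v h1
    · exact absurd hvA hs₀'.2
    · exact absurd hvA (hS'A v h1)
    · rw [hfR x hx]; exact (mem_filter.1 hx).2.1
  have heven : ∀ v, v ∈ S ∨ v ∈ R → v ∉ A → Even (f v) := by
    intro v hv hvA
    rcases hcases v hv with ⟨h1, h2⟩ | rfl | h1 | ⟨x, hx, rfl⟩
    · exact absurd h2 hvA
    · rw [hf0]; exact hkeven
    · rw [hfq v h1]; exact even_two_mul _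
    · exact absurd (hRA _ (mem_image_of_mem _ hx)).1 hvA
  have hPO : ∀ s ∈ S, P s ∉ O := by
    intro s hs hsO
    obtain ⟨-, -, t, ht, hd⟩ := mem_filter.1 hsO
    have h1 := (Nat.prime_dvd_prime_iff_eq (hq' t (hS'S t ht)).1 (hP' s hs).1).1 hd
    have h2 := (hq' t (hS'S t ht)).2.2
    have h3 := (hP' s hs).2.1
    omega
  have hPR : ∀ s ∈ S, s ∈ A → ∀ v, v ∈ S ∨ v ∈ R → f v = P s → v = s := by
    intro s hs hsA v hv hvs
    rcases hcases v hv with ⟨h1, h2⟩ | rfl | h1 | ⟨x, hx, rfl⟩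
    · rw [hfP v h1 h2] at hvs; exact hPi h1 hs hvs
    · exact absurd (hvs ▸ heven v hv hs₀'.2) (Nat.not_even_iff_odd.2 (hPodd s hs))
    · exact absurd (hvs ▸ heven v hv (hS'A v h1)) (Nat.not_even_iff_odd.2 (hPodd s hs))
    · rw [hfR x hx] at hvs
      exact absurd (hvs ▸ hx) (hPO s hs)
  have h0q : ∀ s ∈ S', 2 ^ k ≠ 2 * q s := by
    intro s hs he
    have h1 := (hq' s (hS'S s hs)).1
    have h2 : q s ∣ 2 ^ k := he ▸ dvd_mul_left _ _
    have h3 := (Nat.prime_dvd_prime_iff_eq h1 Nat.prime_two).1 (h1.dvd_of_dvd_pow h2)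
    have := hqodd s (hS'S s hs)
    rw [h3] at this
    exact absurd this (by decide)
  have hinj : Set.InjOn f {v | v ∈ S ∨ v ∈ R} := by
    intro u hu v hv huv
    rcases hcases u hu with ⟨h1, h2⟩ | h1 | h1 | ⟨x, hx, h1⟩
    · exact (hPR u h1 h2 v hv (huv.symm.trans (hfP u h1 h2))).symm
    all_goals rcases hcases v hv with ⟨h3, h4⟩ | h3 | h3 | ⟨y, hy, h3⟩
    · exact hPR v h3 h4 u hu (huv.trans (hfP v h3 h4))
    · rw [h1, h3]
    · rw [h1, hf0, hfq v h3] at huv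
      exact absurd huv (h0q v h3)
    · have h4 := hodd v (h3 ▸ (hRA _ (mem_image_of_mem _ hy)).1) hv
      rw [← huv, h1] at h4
      exact absurd (heven s₀ (Or.inl hs₀'.1) hs₀'.2) (Nat.not_even_iff_odd.2 h4)
    · exact hPR v h3 h4 u hu (huv.trans (hfP v h3 h4))
    · rw [h3, hf0, hfq u h1] at huv
      exact absurd huv.symm (h0q u h1)
    · rw [hfq u h1, hfq v h3] at huv
      exact hqi (hS'S u h1) (hS'S v h3) (by omega)
    · have h4 := hodd v (h3 ▸ (hRA _ (mem_image_of_mem _ hy)).1) hv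
      rw [← huv] at h4
      exact absurd (heven u hu (hS'A u h1)) (Nat.not_even_iff_odd.2 h4)
    · exact hPR v h3 h4 u hu (huv.trans (hfP v h3 h4))
    · have h4 := hodd u (h1 ▸ (hRA _ (mem_image_of_mem _ hx)).1) hu
      rw [huv, h3] at h4
      exact absurd (heven s₀ (Or.inl hs₀'.1) hs₀'.2) (Nat.not_even_iff_odd.2 h4)
    · have h4 := hodd u (h1 ▸ (hRA _ (mem_image_of_mem _ hx)).1) hu
      rw [huv] at h4
      exact absurd (heven v hv (hS'A v h3)) (Nat.not_even_iff_odd.2 h4)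
    · rw [← h1, ← h3, hfR x hx, hfR y hy] at huv
      rw [← h1, ← h3, huv]
  refine ⟨R, f, hRp, card_image_le.trans hOc, ⟨hinj, hIcc, ?_, ?_, ?_, ?_, ?_⟩, ?_⟩
  · intro v hv
    rcases hcases v hv with ⟨h1, h2⟩ | rfl | h1 | ⟨x, hx, rfl⟩
    · rw [hfP v h1 h2]; have := (hP' v h1).2.1; omega
    · rw [hf0]; omega
    · rw [hfq v h1]; have := (hq' v (hS'S v h1)).2.1; omega
    · rw [hfR x hx]
      obtain ⟨hx1, -, s, hs, hd⟩ := mem_filter.1 hx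
      have h1 := Nat.le_of_dvd (mem_Icc.1 hx1).1 hd
      have := (hq' s (hS'S s hs)).2.1
      omega
  · intro u hu v hv huv
    have hne : u ≠ v := by rintro rfl; have := hbip u u huv; tauto
    by_cases huA : u ∈ A
    · exact hPc u hu huA _ (hIcc v hv) fun he => hne (hinj hv (Or.inl hu) he).symm
    have hvA : v ∈ A := by have := hbip u v huv; tauto
    rcases hcases u (Or.inl hu) with ⟨h1, h2⟩ | rfl | h1 | ⟨x, hx, rfl⟩
    · exact absurd h2 huA
    · exact h0c _ (hodd v hvA hv)
    · refine hqc u h1 _ (hodd v hvA hv) fun hd => ?_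
      rcases hcases v hv with ⟨h3, h4⟩ | rfl | h3 | ⟨x, hx, rfl⟩
      · rw [hfP v h3 h4] at hd
        exact hPO v h3 (mem_filter.2 ⟨hfP v h3 h4 ▸ hIcc v hv, hPodd v h3, u, h1, hd⟩)
      · exact hs₀'.2 hvA
      · exact hS'A v h3 hvA
      · rw [hfR x hx] at hd
        exact (hh x hx).2 ((hBad _ _).2 ⟨u, h1, hd, huv.symm⟩)
    · exact absurd (hRA _ (mem_image_of_mem _ hx)).1 huA
  · intro s hs hsA x hx hxn
    exact hPc s hs hsA x hx (hxn s (Or.inl hs)).symm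
  · intro s hs hsA x hx hxn hxo
    rcases hcases s (Or.inl hs) with ⟨h1, h2⟩ | rfl | h1 | ⟨y, hy, rfl⟩
    · exact absurd h2 hsA
    · exact h0c x hxo
    · exact hqc s h1 x hxo (hqO s h1 x hx hxn)
    · exact absurd (hRA _ (mem_image_of_mem _ hy)).1 hsA
  · intro w hw x hx hxn p hp hpw hpx
    obtain ⟨y, hy, rfl⟩ := mem_image.1 hw
    rw [hfR y hy] at hpw
    obtain ⟨hy1, hy2, s, hs, hd⟩ := mem_filter.1 hy
    have hps : p ≠ q s := fun he => hqO s hs x hx hxn (he ▸ hpx)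
    have hps' : ¬ p ∣ q s := fun hd' =>
      hps ((Nat.prime_dvd_prime_iff_eq hp (hq' s (hS'S s hs)).1).1 hd')
    rcases hmul s (hS'S s hs) y hy1 hd with h1 | h1 | h1
    · exact absurd (h1 ▸ hpw) hps'
    · rw [h1] at hy2; exact absurd hy2 (by simp)
    · rw [h1, hp.dvd_mul] at hpw
      exact (Nat.prime_dvd_prime_iff_eq hp Nat.prime_three).1 (hpw.resolve_right hps')
  · have h1 : #{x ∈ Icc 1 n | Odd x} ≤ #{x ∈ Icc 1 n | Odd x ∧ ∀ v, v ∈ S ∨ v ∈ R → f v ≠ x} +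
        #(((S ∩ A) ∪ R).image f) := by
      refine (card_le_card fun x hx => ?_).trans (card_union_le _ _)
      rw [mem_filter] at hx
      by_cases h' : x ∈ ((S ∩ A) ∪ R).image f
      · exact mem_union_right _ h'
      · refine mem_union_left _ (mem_filter.2 ⟨hx.1, hx.2, fun v hv hvx => h' ?_⟩)
        refine mem_image.2 ⟨v, ?_, hvx⟩
        have hvA : v ∈ A := by
          by_contra hvA
          exact absurd (hvx ▸ heven v hv hvA) (Nat.not_even_iff_odd.2 hx.2)
        rcases hv with hv | hv
        · exact mem_union_left _ (mem_inter.2 ⟨hv, hvA⟩)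
        · exact mem_union_right _ hv
    have h2 := card_odd_Icc n
    have h3 := (card_image_le (s := (S ∩ A) ∪ R) (f := f)).trans (card_union_le _ _)
    have h4 := card_sdiff_add_card_inter A (S ∪ R)
    have h5 : #(S ∩ A) + #R ≤ #(A ∩ (S ∪ R)) := by
      rw [← card_union_of_disjoint]
      · refine card_le_card fun v hv => ?_
        rcases mem_union.1 hv with h6 | h6
        · exact mem_inter.2 ⟨(mem_inter.1 h6).2, mem_union_left _ (mem_inter.1 h6).1⟩
        · exact mem_inter.2 ⟨(hRA v h6).1, mem_union_right _ h6⟩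
      · rw [disjoint_left]
        exact fun v h6 h7 => (hRA v h7).2 (mem_inter.1 h6).1
    omega

/-- A small separator can be labelled so that enough odd labels remain for the smaller side `A`. -/
theorem exists_specialLabelling [Fintype V] [DecidableEq V] (par : V → Option V) {n : ℕ}
    (A S pool : Finset V)
    (hbip : ∀ u v, Linked par u v → (u ∈ A ↔ v ∉ A))
    (Pr Pr' : Finset ℕ) (hPr : ∀ p ∈ Pr, p.Prime ∧ n < 2 * p ∧ p ≤ n)
    (hPr' : ∀ p ∈ Pr', p.Prime ∧ n < 4 * p ∧ 2 * p ≤ n)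
    (hn : 16 ≤ n) (hSPr : #S ≤ #Pr) (hSPr' : #S ≤ #Pr') (hA : 2 * #A ≤ n)
    (hpA : pool ⊆ A \ S) (hpool : n < 2 * #A + 2 * #S → 4 * #S + 2 ≤ #pool) :
    ∃ (R : Finset V) (f : V → ℕ), R ⊆ pool ∧ #R ≤ 2 * #S ∧ SpecialLabelling par n A S R f ∧
      #(A \ (S ∪ R)) ≤ #{x ∈ Icc 1 n | Odd x ∧ ∀ v, v ∈ S ∨ v ∈ R → f v ≠ x} := by
  classical
  by_cases h : 2 * #A + 2 * #(S \ A) ≤ n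
  · obtain ⟨f, hf, hc⟩ := exists_specialLabelling_of_few par A S hbip Pr hPr (by omega) hSPr
      (by convert h)
    refine ⟨∅, f, empty_subset _, by simp, hf, ?_⟩
    rw [union_empty]
    convert hc
  · have h1 : #(S \ A) ≤ #S := card_le_card sdiff_subset
    obtain ⟨R, f, h2⟩ := exists_specialLabelling_of_many par A S pool hbip Pr Pr' hPr hPr' hn hSPr
      hSPr' hA (by rw [← card_pos]; convert (by omega : 0 < #(S \ A)))
      (by convert hpA) (hpool (by omega))
    exact ⟨R, f, by convert h2⟩

end

lemma eventually_mul_le_oddPrimorial (C : ℕ) :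
    ∀ᶠ z : ℕ in Filter.atTop, C * z ≤ oddPrimorial z := by
  filter_upwards [Filter.eventually_ge_atTop (8 * C + 8)] with z hz
  obtain ⟨p, hp, hp1, hp2⟩ := Nat.exists_prime_lt_and_le_two_mul (z / 2) (by omega)
  obtain ⟨q, hq, hq1, hq2⟩ := Nat.exists_prime_lt_and_le_two_mul (z / 4) (by omega)
  have hpq : Nat.Coprime p q := (Nat.coprime_primes hp hq).2 (by omega)
  have h1 : p * q ∣ oddPrimorial z := hpq.mul_dvd_of_dvd_of_dvd
    ((prime_dvd_oddPrimorial hp).2 ⟨by omega, by omega⟩)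
    ((prime_dvd_oddPrimorial hq).2 ⟨by omega, by omega⟩)
  have h2 := Nat.le_of_dvd (oddPrimorial_pos z) h1
  have h3 : 2 * C ≤ q := by omega
  have h4 : z ≤ 2 * p := by omega
  nlinarith

/-- The size conditions relating the sieving parameter `z`, the order `n` of the tree, the degree
bound `T`, the bound `B` on sums over large primes and the error bound `E`. -/
structure LargeParams (z n T B : ℕ) (E : ℝ) : Prop where
  three_le : 3 ≤ z
  lt_order : 4 * z < n
  sixteen_le : 16 ≤ n
  modulus : 60 * z ≤ oddPrimorial z
  degree_pos : 1 ≤ T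
  error : 8 * ((T : ℝ) + 1) ^ 3 + 20 * (n / T) + 20 ≤ E
  degree_mul : (T : ℝ) * B ≤ E
  mul_error : 10 ^ 10 * z * E ≤ n / oddPrimorial z
  card_le : ∀ x ∈ Icc 1 n, #(bigPrimes z x) ≤ B
  recip_le : ∀ x ∈ Icc 1 n, bigRecip z x ≤ 1 / 10 ^ 8
  sum_sq_le : ∑ p ∈ Ioc z n with p.Prime, (1 / p : ℝ) ^ 2 ≤ 1 / 10 ^ 8 / z
  sum_recip_le : ∑ p ∈ Ioc z n with p.Prime, (1 / p : ℝ) ≤ B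
  primes : ∀ m, n ≤ 4 * m + 3 → 2 * m ≤ n → n ≤ 1000 * z * #{p ∈ Ioc m (2 * m) | p.Prime}

lemma error_bounds {z u N P n : ℝ} (hz : 1 ≤ z) (hu : 10 ^ 13 * (z + 1) ≤ u) (hP : 0 < P)
    (hPu : P ≤ u) (hN : N * P = n) (hn : u ^ 20 ≤ n) :
    8 * (u ^ 2 + 1) ^ 3 + 20 * (n / u ^ 2) + 20 ≤ N / (10 ^ 10 * z) ∧
      u ^ 2 * (40 * (z + 1)) ≤ N / (10 ^ 10 * z) := by
  have hu1 : 1 ≤ u := by linarith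
  have hu0 : 0 < u := by linarith
  have hzu : 10 ^ 13 * z ≤ u := by linarith
  have hN0 : 0 < N := by
    by_contra h
    have : N * P ≤ 0 := mul_nonpos_of_nonpos_of_nonneg (not_lt.1 h) hP.le
    have := pow_pos hu0 20
    linarith
  have hN1 : n ≤ N * u := by rw [← hN]; gcongr
  have hN2 : u ^ 19 ≤ N := by
    by_contra h
    have : N * u < u ^ 19 * u := by gcongr; exact not_le.1 h
    have e : u ^ 19 * u = u ^ 20 := by ring
    linarith
  have hp : ∀ k, 1 ≤ u ^ k := fun k => one_le_pow₀ hu1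
  have hN3 : u ^ 8 ≤ N := (pow_le_pow_right₀ hu1 (by norm_num)).trans hN2
  have h0 : 0 < 10 ^ 10 * z := by positivity
  constructor
  · rw [le_div_iff₀ h0]
    have h1 : n / u ^ 2 ≤ N / u := by
      rw [div_le_div_iff₀ (by positivity) hu0]
      nlinarith
    have h2 : u ^ 2 + 1 ≤ 2 * u ^ 2 := by linarith [hp 2]
    have h3 : (u ^ 2 + 1) ^ 3 ≤ 8 * u ^ 6 := by
      calc (u ^ 2 + 1) ^ 3 ≤ (2 * u ^ 2) ^ 3 := by gcongr
        _ = 8 * u ^ 6 := by ring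
    have h4 : (N / u) * (10 ^ 13 * z) ≤ N := by
      calc (N / u) * (10 ^ 13 * z) ≤ (N / u) * u := by gcongr
        _ = N := by field_simp
    have h5 : u ^ 6 * (10 ^ 13 * z) ≤ N := by
      calc u ^ 6 * (10 ^ 13 * z) ≤ u ^ 6 * u := by gcongr
        _ = u ^ 7 := by ring
        _ ≤ u ^ 8 := pow_le_pow_right₀ hu1 (by norm_num)
        _ ≤ N := hN3
    have h6 : 1 * (10 ^ 13 * z) ≤ u ^ 6 * (10 ^ 13 * z) := by gcongr; exact hp 6
    have h7 := mul_le_mul_of_nonneg_right h3 h0.le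
    have h8 := mul_le_mul_of_nonneg_right h1 h0.le
    nlinarith
  · rw [le_div_iff₀ h0]
    calc u ^ 2 * (40 * (z + 1)) * (10 ^ 10 * z) ≤ u ^ 2 * u * u := by
          have h1 : 40 * (z + 1) ≤ u := by linarith
          have h2 : 10 ^ 10 * z ≤ u := by linarith
          gcongr
      _ = u ^ 4 := by ring
      _ ≤ u ^ 8 := pow_le_pow_right₀ hu1 (by norm_num)
      _ ≤ N := hN3

theorem eventually_largeParams : ∀ᶠ z : ℕ in Filter.atTop, ∀ n : ℕ, 4 ^ (20 * z) ≤ n →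
    n ≤ 4 ^ (20 * (z + 1)) → ∃ T B E, LargeParams z n T B E := by
  filter_upwards [Filter.eventually_ge_atTop 3, eventually_mul_pow_le (10 ^ 13) 1,
    eventually_mul_le_oddPrimorial 60, bigRecip_eventually_le (ε := 1 / 10 ^ 8) (by norm_num),
    sum_prime_sq_eventually_le (ε := 1 / 10 ^ 8) (by norm_num), eventually_le_mul_card_primes]
    with z hz hu hP hrec hsq hpr n hn1 hn2
  have hP0 : 0 < oddPrimorial z := oddPrimorial_pos z
  have hPu := oddPrimorial_le z
  have hpr' := hpr n
  have hcard : ∀ x ∈ Icc 1 n, #(bigPrimes z x) ≤ 40 * (z + 1) := fun x hx =>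
    card_bigPrimes_le (by omega) (by have := (mem_Icc.1 hx).1; omega) ((mem_Icc.1 hx).2.trans hn2)
  have hrec' : ∀ x ∈ Icc 1 n, bigRecip z x ≤ 1 / 10 ^ 8 := fun x hx =>
    hrec x (by have := (mem_Icc.1 hx).1; omega) ((mem_Icc.1 hx).2.trans hn2)
  have hsum : ∑ p ∈ Ioc z n with p.Prime, (1 / p : ℝ) ≤ ((40 * (z + 1) : ℕ) : ℝ) := by
    refine (sum_prime_recip_le (k := 20 * (z + 1)) (by omega) hn2).trans ?_
    push_cast
    linarith
  have hprimes : ∀ m, n ≤ 4 * m + 3 → 2 * m ≤ n →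
      n ≤ 1000 * z * #{p ∈ Ioc m (2 * m) | p.Prime} := fun m h1 h2 => hpr' m hn1 hn2 h1 h2
  clear hrec hpr hpr' hn2
  have hn3 : (4 ^ z) ^ 20 ≤ n := by rw [← pow_mul, mul_comm]; exact hn1
  clear hn1
  obtain ⟨u, hu'⟩ : ∃ u, u = 4 ^ z := ⟨_, rfl⟩
  rw [← hu'] at hu hPu hn3
  have hun : u ≤ n := (Nat.le_self_pow (by norm_num) u).trans hn3
  have hzR : (1 : ℝ) ≤ z := by exact_mod_cast (by omega : 1 ≤ z)
  have hb := error_bounds (z := z) (u := u) (P := oddPrimorial z) (n := n)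
    (N := n / oddPrimorial z) hzR (by rw [pow_one] at hu; exact_mod_cast hu) (by exact_mod_cast hP0)
    (by exact_mod_cast hPu) (by field_simp) (by exact_mod_cast hn3)
  rw [pow_one] at hu
  exact ⟨u ^ 2, 40 * (z + 1), (n / oddPrimorial z) / (10 ^ 10 * z),
    { three_le := hz
      lt_order := by omega
      sixteen_le := by omega
      modulus := hP
      degree_pos := Nat.one_le_pow _ _ (by omega)
      error := by push_cast; exact hb.1
      degree_mul := by push_cast; exact hb.2
      mul_error := by
        have : (0 : ℝ) < 10 ^ 10 * z := by positivity
        rw [mul_div_cancel₀ _ this.ne']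
      card_le := hcard
      recip_le := hrec'
      sum_sq_le := hsq n
      sum_recip_le := hsum
      primes := hprimes }⟩

section

variable {V : Type}

lemma sum_tsub_le_of_balanced {ι : Type} [Fintype ι] [DecidableEq ι] (F : Finset ι) (x l : ι → ℕ)
    {ε D : ℝ} (hsum : ∑ r, x r ≤ ∑ r, l r) (hF : ∀ r ∈ F, (x r : ℝ) + D ≤ l r) (hD : 0 ≤ D)
    (hε : 0 ≤ ε) (hne : ∀ r ∉ F, ∀ r' ∉ F, (x r : ℝ) - l r ≤ (x r' : ℝ) - l r' + ε)
    (hεD : (Fintype.card ι : ℝ) * ε ≤ #F * D) :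
    ∑ r, (x r - l r) ≤ ∑ r ∈ F, (l r - x r) := by
  have hF' : ∀ r ∈ F, x r ≤ l r := fun r hr => by
    have := hF r hr
    exact_mod_cast (by linarith : (x r : ℝ) ≤ l r)
  have h0 : ∑ r, (x r - l r) = ∑ r ∈ Fᶜ, (x r - l r) := by
    rw [← sum_add_sum_compl F, sum_eq_zero (s := F), zero_add]
    exact fun r hr => Nat.sub_eq_zero_of_le (hF' r hr)
  rw [h0]
  by_cases h : ∀ r ∈ Fᶜ, l r ≤ x r
  · have h1 : ∑ r ∈ Fᶜ, (x r - l r) + ∑ r ∈ Fᶜ, l r = ∑ r ∈ Fᶜ, x r := by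
      rw [← sum_add_distrib]
      exact sum_congr rfl fun r hr => Nat.sub_add_cancel (h r hr)
    have h2 : ∑ r ∈ F, (l r - x r) + ∑ r ∈ F, x r = ∑ r ∈ F, l r := by
      rw [← sum_add_distrib]
      exact sum_congr rfl fun r hr => Nat.sub_add_cancel (hF' r hr)
    have h3 := sum_add_sum_compl F x
    have h4 := sum_add_sum_compl F l
    omega
  · push Not at h
    obtain ⟨r', hr', hlt⟩ := h
    have h1 : ∀ r ∈ Fᶜ, ((x r - l r : ℕ) : ℝ) ≤ ε := by
      intro r hr
      rcases le_total (l r) (x r) with h2 | h2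
      · rw [Nat.cast_sub h2]
        have h3 := hne r (mem_compl.1 hr) r' (mem_compl.1 hr')
        have h4 : (x r' : ℝ) ≤ l r' := by exact_mod_cast hlt.le
        linarith
      · rw [Nat.sub_eq_zero_of_le h2]
        simpa using hε
    have h2 : ∀ r ∈ F, D ≤ ((l r - x r : ℕ) : ℝ) := fun r hr => by
      rw [Nat.cast_sub (hF' r hr)]
      linarith [hF r hr]
    have h3 := sum_le_card_nsmul _ _ _ h1
    have h4 := card_nsmul_le_sum _ _ _ h2
    rw [nsmul_eq_mul] at h3 h4
    have h5 : (#Fᶜ : ℝ) * ε ≤ Fintype.card ι * ε := by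
      gcongr
      exact_mod_cast card_le_univ _
    have h6 : ((∑ r ∈ Fᶜ, (x r - l r) : ℕ) : ℝ) ≤ ((∑ r ∈ F, (l r - x r) : ℕ) : ℝ) := by
      push_cast at h3 h4 ⊢
      linarith
    exact_mod_cast h6

/-- Label a vertex set class by class; the vertices in excess in their own class have small weight
and get unused labels from the classes in `F`. -/
theorem exists_labelling_with_overflow {ι : Type} [Fintype ι] [DecidableEq ι] [DecidableEq V]
    (X : Finset V) (w : V → ℕ) (cls : V → ι) (res : ℕ → ι) (L : ι → Finset ℕ)
    (hL : ∀ r, ∀ l ∈ L r, res l = r) (F : Finset ι) {K T : ℕ} (hT : ∀ v ∈ X, w v ≤ T)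
    (hlow : ∀ r, #{v ∈ X | cls v = r ∧ 8 < w v} ≤ #(L r))
    (hreg : ∀ r, ∀ l ∈ L r, l ≤ K * #{m ∈ L r | m ≤ l})
    (htotal : ∑ r, (#{v ∈ X | cls v = r} - #(L r)) ≤
      ∑ r ∈ F, (#(L r) - #{v ∈ X | cls v = r})) :
    ∃ (main sur : Finset V) (f : V → ℕ), Disjoint main sur ∧ main ∪ sur = X ∧ Set.InjOn f X ∧
      (∀ v ∈ main, f v ∈ L (cls v)) ∧ (∀ v ∈ sur, ∃ r ∈ F, f v ∈ L r) ∧ (∀ v ∈ sur, w v ≤ 8) ∧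
      (∀ r, #{v ∈ main | cls v = r} = min #{v ∈ X | cls v = r} #(L r)) ∧
      (∀ r, #{v ∈ sur | cls v = r} = #{v ∈ X | cls v = r} - #(L r)) ∧
      ∀ r p, (∀ m, p * #{l ∈ L r | l ≤ K * m ∧ p ∣ l} ≤ 2 * m + p) →
        p * ∑ v ∈ main with cls v = r ∧ p ∣ f v, w v ≤
          2 * ∑ v ∈ X with cls v = r, w v + p * T := by
  have h1 : ∀ r, ∃ s, s ⊆ {v ∈ X | cls v = r ∧ w v ≤ 8} ∧
      #s = #{v ∈ X | cls v = r} - #(L r) := by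
    intro r
    refine exists_subset_card_eq ?_
    have h2 : #{v ∈ X | cls v = r} ≤
        #{v ∈ X | cls v = r ∧ w v ≤ 8} + #{v ∈ X | cls v = r ∧ 8 < w v} := by
      refine (card_le_card fun v hv => ?_).trans (card_union_le _ _)
      simp only [mem_union, mem_filter] at hv ⊢
      have := le_or_gt (w v) 8
      tauto
    have := hlow r
    omega
  choose s hs hsc using h1
  have hsX : ∀ r, ∀ v ∈ s r, v ∈ X ∧ cls v = r ∧ w v ≤ 8 := fun r v hv => mem_filter.1 (hs r hv)
  obtain ⟨X', hX'⟩ : ∃ X' : ι → Finset V, ∀ r v, v ∈ X' r ↔ (v ∈ X ∧ cls v = r) ∧ v ∉ s r :=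
    ⟨fun r => {v ∈ X | cls v = r} \ s r, fun r v => by rw [mem_sdiff, mem_filter]⟩
  have hX'c : ∀ r, #(X' r) = min #{v ∈ X | cls v = r} #(L r) := by
    intro r
    have h2 : X' r = {v ∈ X | cls v = r} \ s r := by
      ext v
      rw [hX', mem_sdiff, mem_filter]
    have h3 : s r ⊆ {v ∈ X | cls v = r} := fun v hv =>
      mem_filter.2 ⟨(hsX r v hv).1, (hsX r v hv).2.1⟩
    rw [h2, card_sdiff_of_subset h3, hsc]
    omega
  have h2 : ∀ r, ∃ f, Set.InjOn f (X' r) ∧ (∀ v ∈ X' r, f v ∈ L r) ∧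
      ∀ p, (∀ m, p * #{l ∈ L r | l ≤ K * m ∧ p ∣ l} ≤ 2 * m + p) →
        p * ∑ v ∈ X' r with p ∣ f v, w v ≤ 2 * ∑ v ∈ X' r, w v + p * T := fun r =>
    exists_sorted_labelling (X' r) w (L r) K T (by rw [hX'c]; exact min_le_right _ _)
      (fun v hv => hT v ((hX' r v).1 hv).1.1) (hreg r)
  choose f hfi hfL hfp using h2
  obtain ⟨sur, hsur⟩ : ∃ sur : Finset V, ∀ v, v ∈ sur ↔ v ∈ s (cls v) :=
    ⟨{v ∈ X | v ∈ s (cls v)}, fun v => by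
      rw [mem_filter]; exact ⟨fun h => h.2, fun h => ⟨(hsX _ _ h).1, h⟩⟩⟩
  have hsur' : ∀ r, ({v ∈ sur | cls v = r} : Finset V) = s r := by
    intro r
    ext v
    rw [mem_filter, hsur]
    constructor
    · rintro ⟨h3, rfl⟩
      exact h3
    · intro h3
      have := (hsX r v h3).2.1
      exact ⟨this.symm ▸ h3, this⟩
  obtain ⟨main, hmain⟩ : ∃ main : Finset V, ∀ v, v ∈ main ↔ v ∈ X' (cls v) :=
    ⟨{v ∈ X | v ∈ X' (cls v)}, fun v => by
      rw [mem_filter]; exact ⟨fun h => h.2, fun h => ⟨((hX' _ _).1 h).1.1, h⟩⟩⟩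
  have hmain' : ∀ r, ({v ∈ main | cls v = r} : Finset V) = X' r := by
    intro r
    ext v
    rw [mem_filter, hmain]
    constructor
    · rintro ⟨h3, rfl⟩
      exact h3
    · intro h3
      have := ((hX' r v).1 h3).1.2
      exact ⟨this.symm ▸ h3, this⟩
  set O : Finset ℕ := F.biUnion fun r => L r \ (X' r).image (f r) with hO
  have hOc : #sur ≤ #O := by
    rw [hO, card_biUnion]
    · have h3 : #sur = ∑ r, #{v ∈ sur | cls v = r} :=
        card_eq_sum_card_fiberwise fun _ _ => mem_coe.2 (mem_univ _)
      rw [h3]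
      simp_rw [hsur', hsc]
      refine htotal.trans (sum_le_sum fun r _ => ?_)
      have h4 := le_card_sdiff ((X' r).image (f r)) (L r)
      have h5 := card_image_le (s := X' r) (f := f r)
      have h6 := hX'c r
      have h7 := min_le_left #{v ∈ X | cls v = r} #(L r)
      omega
    · intro r _ r' _ hrr'
      rw [Function.onFun, disjoint_left]
      intro l h3 h4
      exact hrr' ((hL r l (mem_sdiff.1 h3).1).symm.trans (hL r' l (mem_sdiff.1 h4).1))
  obtain ⟨g, hgi, hg⟩ := exists_matching_of_few sur O (fun _ _ => False) 0 (by omega) (by simp)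
  have hgO : ∀ v ∈ sur, ∃ r ∈ F, g v ∈ L r ∧ g v ∉ (X' r).image (f r) := by
    intro v hv
    obtain ⟨r, hr, h3⟩ := mem_biUnion.1 (hg v hv).1
    exact ⟨r, hr, mem_sdiff.1 h3⟩
  have hms : ∀ v ∈ main, v ∉ sur := fun v h3 h4 =>
    ((hX' _ _).1 ((hmain v).1 h3)).2 ((hsur v).1 h4)
  have hun : main ∪ sur = X := by
    ext v
    rw [mem_union, hmain, hsur, hX']
    constructor
    · rintro (h3 | h3)
      · exact h3.1.1
      · exact (hsX _ _ h3).1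
    · intro h3
      by_cases h4 : v ∈ s (cls v)
      · exact Or.inr h4
      · exact Or.inl ⟨⟨h3, rfl⟩, h4⟩
  obtain ⟨φ, hφs, hφm⟩ : ∃ φ : V → ℕ, (∀ v ∈ sur, φ v = g v) ∧
      ∀ v ∈ main, φ v = f (cls v) v :=
    ⟨fun v => if v ∈ sur then g v else f (cls v) v, fun v hv => by simp [hv], fun v hv => by
      simp [hms v hv]⟩
  have hφL : ∀ v ∈ main, φ v ∈ L (cls v) := fun v hv => by
    rw [hφm v hv]
    exact hfL _ _ ((hmain v).1 hv)
  have hcross : ∀ v ∈ main, ∀ v' ∈ sur, φ v ≠ φ v' := by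
    intro v hv v' hv' he
    obtain ⟨r, -, h3, h4⟩ := hgO v' hv'
    rw [← hφs v' hv', ← he] at h3 h4
    have h5 : cls v = r := (hL _ _ (hφL v hv)).symm.trans (hL _ _ h3)
    subst h5
    exact h4 (mem_image.2 ⟨v, (hmain v).1 hv, (hφm v hv).symm⟩)
  refine ⟨main, sur, φ, disjoint_left.2 hms, hun, ?_, hφL, ?_, ?_, ?_, ?_, ?_⟩
  · intro v hv v' hv' he
    rw [mem_coe, ← hun, mem_union] at hv hv'
    rcases hv with hv | hv <;> rcases hv' with hv' | hv'
    · have h5 : cls v = cls v' := by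
        rw [← hL _ _ (hφL v hv), ← hL _ _ (hφL v' hv'), he]
      rw [hφm v hv, hφm v' hv', h5] at he
      exact hfi _ (h5 ▸ (hmain v).1 hv) ((hmain v').1 hv') he
    · exact absurd he (hcross v hv v' hv')
    · exact absurd he.symm (hcross v' hv' v hv)
    · rw [hφs v hv, hφs v' hv'] at he
      exact hgi hv hv' he
  · intro v hv
    obtain ⟨r, hr, h3, -⟩ := hgO v hv
    exact ⟨r, hr, by rwa [hφs v hv]⟩
  · exact fun v hv => (hsX _ _ ((hsur v).1 hv)).2.2
  · intro r
    rw [hmain', hX'c]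
  · intro r
    rw [hsur', hsc]
  · intro r p hp
    have h3 := hfp r p hp
    have h4 : ∑ v ∈ main with cls v = r ∧ p ∣ φ v, w v = ∑ v ∈ X' r with p ∣ f r v, w v := by
      refine sum_congr ?_ fun _ _ => rfl
      ext v
      rw [← hmain' r, mem_filter, mem_filter, mem_filter]
      constructor
      · rintro ⟨h5, rfl, h6⟩
        exact ⟨⟨h5, rfl⟩, hφm v h5 ▸ h6⟩
      · rintro ⟨⟨h5, rfl⟩, h6⟩
        exact ⟨h5, rfl, (hφm v h5).symm ▸ h6⟩
    have h5 : ∑ v ∈ X' r, w v ≤ ∑ v ∈ X with cls v = r, w v :=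
      sum_le_sum_of_subset fun v hv => mem_filter.2 ((hX' r v).1 hv).1
    rw [h4]
    omega

end

section

variable {V : Type}

lemma exists_subset_unitPairs {z : ℕ} (hz : 1 ≤ z) (hP : 60 * z ≤ oddPrimorial z) :
    ∃ F ⊆ unitPairs (oddPrimorial z), oddPrimorial z ≤ 20 * z * #F ∧
      15 * z * #F ≤ oddPrimorial z := by
  have h1 := oddPrimorial_le_mul_card_unitPairs z hz
  obtain ⟨U, hU⟩ : ∃ U, U = unitPairs (oddPrimorial z) := ⟨_, rfl⟩
  rw [← hU] at h1 ⊢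
  clear hU
  generalize oddPrimorial z = P at *
  have h2 : P / (20 * z) + 1 ≤ #U := by
    have h3 := Nat.mul_div_le P (20 * z)
    by_contra h4
    have h5 : #U ≤ P / (20 * z) := by omega
    have h6 := Nat.mul_le_mul_left (20 * z) h5
    have h7 : 20 * z * #U = 20 * (z * #U) := by ring
    omega
  obtain ⟨F, hF, hFc⟩ := exists_subset_card_eq h2
  refine ⟨F, hF, ?_, ?_⟩
  · rw [hFc]
    exact (Nat.lt_mul_div_succ P (by omega)).le
  · rw [hFc, mul_add]
    have h3 := Nat.mul_div_le P (20 * z)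
    have h4 : 20 * z * (P / (20 * z)) = 20 * (z * (P / (20 * z))) := by ring
    have h5 : 15 * z * (P / (20 * z)) = 15 * (z * (P / (20 * z))) := by ring
    omega

lemma mass_bounds {z P M φ N n : ℝ} (hz : 1 ≤ z) (hP : 0 < P) (hM : M + φ = 8 * P)
    (h1 : P ≤ 20 * z * φ) (h2 : 15 * z * φ ≤ P) (hN : N * P = n) (hN0 : 0 < N) :
    0 < M ∧ 8 / M ≤ 2 / P ∧ N + N / z / 160 ≤ 8 / M * n ∧ 8 / M * n ≤ N + N / z / 119 := by
  have hφ : 0 ≤ φ := by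
    by_contra h
    nlinarith
  have hφz : φ ≤ z * φ := by nlinarith
  have hM0 : 7 * P ≤ M := by nlinarith
  have hMp : 0 < M := by linarith
  have e : 8 / M * n = N + N * φ / M := by
    rw [← hN]
    field_simp
    linear_combination (-1 : ℝ) * hM
  refine ⟨hMp, ?_, ?_, ?_⟩
  · rw [div_le_div_iff₀ hMp hP]
    linarith
  · rw [e, div_div]
    gcongr N + ?_
    rw [div_le_div_iff₀ (by positivity) hMp]
    have : M ≤ 160 * (z * φ) := by nlinarith
    nlinarith
  · rw [e, div_div]
    gcongr N + ?_
    rw [div_le_div_iff₀ hMp (by positivity)]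
    have : 119 * (z * φ) ≤ M := by nlinarith
    nlinarith

lemma abs_sub_div_mul_le {a M c t e : ℝ} (hM : 0 < M) (h : |a * M - c * t| ≤ M * e) :
    |a - c / M * t| ≤ e := by
  have e1 : a * M - c * t = M * (a - c / M * t) := by field_simp
  rw [e1, abs_mul, abs_of_pos hM] at h
  exact le_of_mul_le_mul_left h hM

open Classical in
/-- A partial labelling `f` of the separator `S` and the exceptional set `R`, together with a
choice of residue classes for the other vertices of both sides `A` and `Aᶜ` of the tree. -/
structure Preparation [Fintype V] (par : V → Option V) (z T : ℕ) (E x y : ℝ)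
    (A S R : Finset V) (F : Finset (ZMod (oddPrimorial z))) (cls : V → ZMod (oddPrimorial z))
    (f : V → ℕ) : Prop where
  bipartite : ∀ u v, Linked par u v → (u ∈ A ↔ v ∉ A)
  cls_eq : ∀ u v, Linked par u v → u ∉ S → v ∉ S → cls u = cls v
  degree_le : ∀ v, v ∉ S → #{w | w ∉ S ∧ Linked par v w} ≤ T
  subset_unitPairs : F ⊆ unitPairs (oddPrimorial z)
  le_card_mul : oddPrimorial z ≤ 20 * z * #F
  special : SpecialLabelling par (Fintype.card V) A S R f
  subset : R ⊆ A \ S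
  cls_zero : ∀ v ∈ R, cls v = 0
  card_le : #(A \ (S ∪ R)) ≤
    #{x ∈ Icc 1 (Fintype.card V) | Odd x ∧ ∀ v, v ∈ S ∨ v ∈ R → f v ≠ x}
  card_special_le : (#(S ∪ R) : ℝ) ≤ E / 4
  le_of_notMem : ∀ r ∉ F, x - E ≤ #{v ∈ A \ (S ∪ R) | cls v = r} ∧
    y - E ≤ #{v ∈ Aᶜ \ S | cls v = r}
  le_add : ∀ r, #{v ∈ A \ (S ∪ R) | cls v = r} ≤ x + E ∧ #{v ∈ Aᶜ \ S | cls v = r} ≤ y + E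
  le_of_mem : ∀ r ∈ F, #{v ∈ A \ (S ∪ R) | cls v = r} ≤ 7 / 8 * x + E
  ge : ∀ r, 7 / 8 * y - E ≤ #{v ∈ Aᶜ \ S | cls v = r}
  x_le_y : x ≤ y
  x_nonneg : 0 ≤ x
  le_sum : (Fintype.card V : ℝ) / oddPrimorial z + Fintype.card V / oddPrimorial z / z / 160 ≤ x + y
  sum_le : x + y ≤ (Fintype.card V : ℝ) / oddPrimorial z + Fintype.card V / oddPrimorial z / z / 119

lemma exists_bipartition [Fintype V] (par : V → Option V) (d : V → ℕ)
    (hd : ∀ u v, par u = some v → d v + 1 = d u) :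
    ∃ A : Finset V, (∀ u v, Linked par u v → (u ∈ A ↔ v ∉ A)) ∧ 2 * #A ≤ Fintype.card V := by
  have h : ∀ u v, Linked par u v → (Even (d u) ↔ ¬ Even (d v)) := by
    rintro u v (h | h)
    · rw [← hd u v h, Nat.even_add_one]
    · rw [← hd v u h, Nat.even_add_one, not_not]
  have hc := card_filter_add_card_filter_not (s := (univ : Finset V)) (fun v => Even (d v))
  rw [card_univ] at hc
  by_cases h1 : 2 * #{v | Even (d v)} ≤ Fintype.card V
  · exact ⟨univ.filter fun v => Even (d v), fun u v huv => by simpa using h u v huv, h1⟩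
  · refine ⟨univ.filter fun v => ¬ Even (d v), fun u v huv => ?_, by omega⟩
    have := h u v huv
    simp only [mem_filter, mem_univ, true_and]
    tauto

set_option maxHeartbeats 800000 in
open Classical in
theorem exists_preparation [Fintype V] (par : V → Option V) (d : V → ℕ)
    (hd : ∀ u v, par u = some v → d v + 1 = d u) {z T B : ℕ} {E : ℝ}
    (hp : LargeParams z (Fintype.card V) T B E) :
    ∃ x y A S R F cls f, Preparation par z T E x y A S R F cls f := by
  obtain ⟨n, hn⟩ : ∃ n, n = Fintype.card V := ⟨_, rfl⟩
  rw [← hn] at hp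
  have hz3 := hp.three_le
  have hP0 : 0 < oddPrimorial z := oddPrimorial_pos z
  have hzR : (1 : ℝ) ≤ z := by exact_mod_cast (by omega : 1 ≤ z)
  obtain ⟨F, hF, hF1, hF2⟩ := exists_subset_unitPairs (by omega) hp.modulus
  obtain ⟨A, hbip, hA⟩ := exists_bipartition par d hd
  obtain ⟨M, S, cls, hM, hS, hcls, hdeg, hcount⟩ := exists_classes par d hd T F A Aᶜ
  rw [← hn] at hS hA
  have hPR : (0 : ℝ) < oddPrimorial z := by exact_mod_cast hP0
  have hnR : (0 : ℝ) < n := by exact_mod_cast (by have := hp.sixteen_le; omega : 0 < n)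
  obtain ⟨N, hN⟩ : ∃ N : ℝ, N = n / oddPrimorial z := ⟨_, rfl⟩
  have hNP : N * oddPrimorial z = n := by rw [hN]; field_simp
  have hN0 : 0 < N := by rw [hN]; positivity
  obtain ⟨hM0, hMP, hα1, hα2⟩ := mass_bounds (M := M) (φ := #F) hzR hPR (by exact_mod_cast hM)
    (by exact_mod_cast hF1) (by exact_mod_cast hF2) hNP hN0
  have hE := hp.error
  have hmul := hp.mul_error
  rw [← hN] at hmul
  have hT0 : (0 : ℝ) < T := by exact_mod_cast hp.degree_pos
  have hSn : (#S : ℝ) ≤ n / T := by rw [le_div_iff₀ hT0]; exact_mod_cast hS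
  have hT3 : (0 : ℝ) ≤ 8 * ((T : ℝ) + 1) ^ 3 := by positivity
  have hE20 : 8 * ((T : ℝ) + 1) ^ 3 + 20 * #S + 20 ≤ E := by linarith
  have hs0 : (0 : ℝ) ≤ #S := by positivity
  have hNE : 10 ^ 10 * E ≤ N / z := by rw [le_div_iff₀ (by linarith)]; linarith
  have hNz : N / z ≤ N := div_le_self hN0.le hzR
  have hβ : 8 / (M : ℝ) ≤ 2 := by
    refine hMP.trans ((div_le_iff₀ hPR).2 ?_)
    have : (1 : ℝ) ≤ oddPrimorial z := by exact_mod_cast hP0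
    linarith
  have hβ0 : 0 < 8 / (M : ℝ) := by positivity
  have h78 : 7 / (M : ℝ) = 7 / 8 * (8 / M) := by field_simp
  obtain ⟨β, hβe⟩ : ∃ β : ℝ, β = 8 / M := ⟨_, rfl⟩
  obtain ⟨e, he⟩ : ∃ e : ℝ, e = 8 * ((T : ℝ) + 1) ^ 3 := ⟨_, rfl⟩
  rw [← hβe] at hα1 hα2 hβ hβ0 h78
  rw [← he] at hE20 hT3
  have hmass : ∀ X : Finset V, β * #X - 2 * #S ≤ β * #(X \ S) ∧ β * #(X \ S) ≤ β * #X := by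
    intro X
    have h1 : (#X : ℝ) ≤ #(X \ S) + #S := by exact_mod_cast
      (by have := le_card_sdiff S X; omega : #X ≤ #(X \ S) + #S)
    have h2 : (#(X \ S) : ℝ) ≤ #X := by exact_mod_cast card_le_card sdiff_subset
    constructor <;> nlinarith
  have hnot : ∀ X : Finset V, ∀ r, |(#{v ∈ X \ S | cls v = r} : ℝ) * M -
      (if r ∈ F then 7 else 8) * #(X \ S)| ≤ M * (8 * (T + 1) ^ 3) →
      (r ∉ F → |(#{v ∈ X \ S | cls v = r} : ℝ) - β * #(X \ S)| ≤ e) ∧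
      (r ∈ F → |(#{v ∈ X \ S | cls v = r} : ℝ) - 7 / 8 * β * #(X \ S)| ≤ e) := by
    intro X r h
    constructor <;> intro hr
    · rw [if_neg hr] at h
      rw [hβe, he]
      exact abs_sub_div_mul_le hM0 h
    · rw [if_pos hr] at h
      rw [← h78, he]
      exact abs_sub_div_mul_le hM0 h
  obtain ⟨pool, hpool⟩ : ∃ pool : Finset V, pool = {v ∈ A \ S | cls v = 0} := ⟨_, rfl⟩
  have hP1 : Fact (1 < oddPrimorial z) := ⟨by have := hp.modulus; omega⟩
  have h0F : (0 : ZMod (oddPrimorial z)) ∉ F := fun h => by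
    have := (mem_filter.1 (hF h)).2.1
    exact not_isUnit_zero this
  have hx2 : 2 * (β * #A) ≤ β * n := by
    have : (2 * #A : ℝ) ≤ n := by exact_mod_cast hA
    nlinarith
  have hAc : (#A : ℝ) + #Aᶜ = n := by
    rw [hn]
    exact_mod_cast card_add_card_compl A
  have hxy : β * #A + β * #Aᶜ = β * n := by rw [← hAc]; ring
  have hx0 : 0 ≤ β * #A := by positivity
  obtain ⟨x, hx⟩ : ∃ x, x = β * #A := ⟨_, rfl⟩
  obtain ⟨y, hy⟩ : ∃ y, y = β * #Aᶜ := ⟨_, rfl⟩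
  rw [← hx] at hx2 hxy hx0
  rw [← hy] at hxy
  have hpool4 : n < 2 * #A + 2 * #S → 4 * #S + 2 ≤ #pool := by
    intro h
    have h1 := abs_le.1 ((hnot A 0 (hcount 0).1).1 h0F)
    have h2 := hmass A
    have h3 : (n : ℝ) < 2 * #A + 2 * #S := by exact_mod_cast h
    have h4 : β * n ≤ 2 * x + 4 * #S := by rw [hx]; nlinarith
    rw [← hpool] at h1
    rw [← hx] at h2
    have h5 : (4 * #S + 2 : ℝ) ≤ #pool := by linarith [h1.1, h2.1, h2.2]
    exact_mod_cast h5
  have hprimes : ∀ m, n ≤ 4 * m + 3 → 2 * m ≤ n → #S ≤ #{p ∈ Ioc m (2 * m) | p.Prime} := by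
    intro m h1 h2
    have h3 : (n : ℝ) ≤ 1000 * z * #{p ∈ Ioc m (2 * m) | p.Prime} := by
      exact_mod_cast hp.primes m h1 h2
    have h4 : N ≤ n := by rw [← hNP]; exact le_mul_of_one_le_right hN0.le (by exact_mod_cast hP0)
    have h5 : (z : ℝ) * (1000 * #S) ≤ z * (1000 * #{p ∈ Ioc m (2 * m) | p.Prime}) := by
      have h6 : (z : ℝ) * (1000 * #S) ≤ z * (10 ^ 10 * E) :=
        mul_le_mul_of_nonneg_left (by linarith) (by linarith)
      linarith
    have h6 := le_of_mul_le_mul_left h5 (by linarith)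
    exact_mod_cast (by linarith : (#S : ℝ) ≤ #{p ∈ Ioc m (2 * m) | p.Prime})
  obtain ⟨R, f, hR, hRc, hf, hfc⟩ := exists_specialLabelling par A S pool hbip
    {p ∈ Ioc (n / 2) (2 * (n / 2)) | p.Prime} {p ∈ Ioc (n / 4) (2 * (n / 4)) | p.Prime} (n := n)
    (fun p hp => by simp only [mem_filter, mem_Ioc] at hp; exact ⟨hp.2, by omega, by omega⟩)
    (fun p hp => by simp only [mem_filter, mem_Ioc] at hp; exact ⟨hp.2, by omega, by omega⟩)
    hp.sixteen_le (hprimes _ (by omega) (by omega)) (hprimes _ (by omega) (by omega)) hA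
    (hpool ▸ filter_subset _ _) hpool4
  have hRc' : (#R : ℝ) ≤ 2 * #S := by exact_mod_cast hRc
  have hXr : ∀ r, (#{v ∈ A \ S | cls v = r} : ℝ) - 2 * #S ≤ #{v ∈ A \ (S ∪ R) | cls v = r} ∧
      (#{v ∈ A \ (S ∪ R) | cls v = r} : ℝ) ≤ #{v ∈ A \ S | cls v = r} := by
    intro r
    constructor
    · have h1 : #{v ∈ A \ S | cls v = r} ≤ #{v ∈ A \ (S ∪ R) | cls v = r} + #R := by
        refine (card_le_card fun v hv => ?_).trans (card_union_le _ _)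
        simp only [mem_filter, mem_sdiff, mem_union] at hv ⊢
        tauto
      have h2 : (#{v ∈ A \ S | cls v = r} : ℝ) ≤ #{v ∈ A \ (S ∪ R) | cls v = r} + #R := by
        exact_mod_cast h1
      linarith
    · have h1 : #{v ∈ A \ (S ∪ R) | cls v = r} ≤ #{v ∈ A \ S | cls v = r} := by
        refine card_le_card fun v hv => ?_
        simp only [mem_filter, mem_sdiff, mem_union] at hv ⊢
        tauto
      exact_mod_cast h1
  have hRp : ∀ v ∈ R, v ∈ A \ S ∧ cls v = 0 := fun v hv => by
    have h1 := hR hv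
    rw [hpool] at h1
    exact mem_filter.1 h1
  have hA' := hmass A
  have hB' := hmass Aᶜ
  rw [← hx] at hA'
  rw [← hy] at hB'
  have hy0 : 0 ≤ y := by linarith
  have hα : 0 ≤ β * n := by positivity
  refine ⟨x, y, A, S, R, F, cls, f,
    { bipartite := hbip
      cls_eq := hcls
      degree_le := fun v hv => by convert hdeg v hv
      subset_unitPairs := hF
      le_card_mul := hF1
      special := hn ▸ hf
      subset := fun v hv => (hRp v hv).1
      cls_zero := fun v hv => (hRp v hv).2
      card_le := hn ▸ hfc
      card_special_le := ?_
      le_of_notMem := ?_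
      le_add := ?_
      le_of_mem := ?_
      ge := ?_
      x_le_y := by linarith
      x_nonneg := hx0
      le_sum := by rw [← hn, ← hN, hxy]; exact hα1
      sum_le := by rw [← hn, ← hN, hxy]; exact hα2 }⟩
  · have h1 : (#(S ∪ R) : ℝ) ≤ #S + #R := by exact_mod_cast card_union_le S R
    linarith
  · intro r hr
    have h1 := abs_le.1 ((hnot A r (hcount r).1).1 hr)
    have h2 := abs_le.1 ((hnot Aᶜ r (hcount r).2).1 hr)
    constructor
    · linarith [(hXr r).1, h1.1, hA'.1]
    · linarith [h2.1, hB'.1]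
  · intro r
    by_cases hr : r ∈ F
    · have h1 := abs_le.1 ((hnot A r (hcount r).1).2 hr)
      have h2 := abs_le.1 ((hnot Aᶜ r (hcount r).2).2 hr)
      constructor
      · linarith [(hXr r).2, h1.2, hA'.2]
      · linarith [h2.2, hB'.2]
    · have h1 := abs_le.1 ((hnot A r (hcount r).1).1 hr)
      have h2 := abs_le.1 ((hnot Aᶜ r (hcount r).2).1 hr)
      constructor
      · linarith [(hXr r).2, h1.2, hA'.2]
      · linarith [h2.2, hB'.2]
  · intro r hr
    have h1 := abs_le.1 ((hnot A r (hcount r).1).2 hr)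
    linarith [(hXr r).2, h1.2, hA'.2]
  · intro r
    by_cases hr : r ∈ F
    · have h2 := abs_le.1 ((hnot Aᶜ r (hcount r).2).2 hr)
      linarith [h2.1, hB'.1]
    · have h2 := abs_le.1 ((hnot Aᶜ r (hcount r).2).1 hr)
      linarith [h2.1, hB'.1]

end

section

variable {V : Type}

lemma LargeParams.order_pos {z n T B : ℕ} {E : ℝ} (hp : LargeParams z n T B E) :
    20 ≤ E ∧ 10 ^ 10 * E ≤ n / oddPrimorial z / z ∧
      (n : ℝ) / oddPrimorial z / z ≤ n / oddPrimorial z / 3 := by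
  have hT3 : (0 : ℝ) ≤ 8 * ((T : ℝ) + 1) ^ 3 := by positivity
  have hnT : (0 : ℝ) ≤ 20 * (n / T) := by positivity
  have h3 : (3 : ℝ) ≤ z := by exact_mod_cast hp.three_le
  refine ⟨by linarith [hp.error], ?_, ?_⟩
  · rw [le_div_iff₀ (by linarith)]
    linarith [hp.mul_error]
  · gcongr

lemma card_oddClass_sdiff_bounds {P n : ℕ} [NeZero P] (hP : Nat.Coprime 2 P) (r : ZMod P)
    (H : Finset ℕ) :
    (n : ℝ) / P / 2 - 1 - #H ≤ #(oddClass n r \ H) ∧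
      (#(oddClass n r \ H) : ℝ) ≤ (n : ℝ) / P / 2 + 1 := by
  have h1 := le_card_oddClass hP n r
  have h2 := card_oddClass_le hP n r
  have h3 := le_card_sdiff H (oddClass n r)
  have h4 : #(oddClass n r \ H) ≤ #(oddClass n r) := card_le_card sdiff_subset
  have e : (n : ℝ) / P / 2 = n / (2 * P : ℕ) := by
    push_cast
    rw [div_div, mul_comm]
  have h5 : (n : ℝ) / P / 2 < (n / (2 * P) : ℕ) + 1 := by
    have := Nat.lt_floor_add_one ((n : ℝ) / (2 * P : ℕ))
    rwa [Nat.floor_div_eq_div, ← e] at this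
  have h6 : ((n / (2 * P) : ℕ) : ℝ) ≤ (n : ℝ) / P / 2 := by
    rw [e]
    exact Nat.cast_div_le
  constructor
  · have : ((n / (2 * P) : ℕ) : ℝ) ≤ #(oddClass n r \ H) + #H := by exact_mod_cast (by omega)
    linarith
  · have : (#(oddClass n r \ H) : ℝ) ≤ (n / (2 * P) : ℕ) + 1 := by exact_mod_cast (by omega)
    linarith

lemma card_class_bounds {P n : ℕ} [NeZero P] (r : ZMod P) :
    (n : ℝ) / P - 1 ≤ #{x ∈ Icc 1 n | ((x : ℕ) : ZMod P) = r} ∧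
      (#{x ∈ Icc 1 n | ((x : ℕ) : ZMod P) = r} : ℝ) ≤ n / P + 1 := by
  have h1 := le_card_class n r
  have h2 := card_class_le n r
  have h5 : (n : ℝ) / P < (n / P : ℕ) + 1 := by
    have := Nat.lt_floor_add_one ((n : ℝ) / P)
    rwa [Nat.floor_div_eq_div] at this
  have h6 : ((n / P : ℕ) : ℝ) ≤ (n : ℝ) / P := Nat.cast_div_le
  constructor
  · have : ((n / P : ℕ) : ℝ) ≤ #{x ∈ Icc 1 n | ((x : ℕ) : ZMod P) = r} := by exact_mod_cast h1
    linarith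
  · have : (#{x ∈ Icc 1 n | ((x : ℕ) : ZMod P) = r} : ℝ) ≤ (n / P : ℕ) + 1 := by exact_mod_cast h2
    linarith

lemma coprime_oddPrimorial_of_lt {z p : ℕ} (hp : p.Prime) (hz : z < p) :
    Nat.Coprime p (oddPrimorial z) := by
  rw [hp.coprime_iff_not_dvd, prime_dvd_oddPrimorial hp]
  omega

set_option maxHeartbeats 800000 in
open Classical in
/-- The vertices of `A` outside the separator can be labelled by odd numbers. -/
theorem exists_odd_labelling [Fintype V] {par : V → Option V} {z T B n : ℕ} {E x y : ℝ}
    {A S R : Finset V} {F : Finset (ZMod (oddPrimorial z))} {cls : V → ZMod (oddPrimorial z)}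
    {f₀ : V → ℕ} (hn : Fintype.card V = n) (hp : LargeParams z n T B E)
    (h : Preparation par z T E x y A S R F cls f₀)
    (L : ZMod (oddPrimorial z) → Finset ℕ) (hLdef : ∀ r, L r = oddClass n r \ (S ∪ R).image f₀) :
    ∃ (main sur : Finset V) (f : V → ℕ), Disjoint main sur ∧ main ∪ sur = A \ (S ∪ R) ∧
      Set.InjOn f (A \ (S ∪ R) : Finset V) ∧
      (∀ v ∈ main, f v ∈ L (cls v)) ∧ (∀ v ∈ sur, ∃ r ∈ F, f v ∈ L r) ∧
      (∀ w ∈ sur, #{v ∈ Aᶜ \ S | Linked par v w} ≤ 8) ∧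
      (∀ r, #{v ∈ main | cls v = r} = min #{v ∈ A \ (S ∪ R) | cls v = r} #(L r)) ∧
      (∀ r, #{v ∈ sur | cls v = r} = #{v ∈ A \ (S ∪ R) | cls v = r} - #(L r)) ∧
      ∀ r p, p.Prime → z < p → p * ∑ w ∈ main with cls w = r ∧ p ∣ f w,
        #{v ∈ Aᶜ \ S | Linked par v w} ≤ ⌊9 * ((n : ℝ) / oddPrimorial z)⌋₊ + p * T := by
  obtain ⟨hE20, hNE, hNz⟩ := hp.order_pos
  have hP0 : 0 < oddPrimorial z := oddPrimorial_pos z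
  have h2P := coprime_two_oddPrimorial z
  have hsum := h.sum_le
  rw [hn] at hsum
  have hLc := fun r => card_oddClass_sdiff_bounds (n := n) h2P r ((S ∪ R).image f₀)
  have hH : (#((S ∪ R).image f₀) : ℝ) ≤ E / 4 :=
    le_trans (by exact_mod_cast card_image_le) h.card_special_le
  obtain ⟨N, hN⟩ : ∃ N : ℝ, N = n / oddPrimorial z := ⟨_, rfl⟩
  have hPR : (0 : ℝ) < oddPrimorial z := by exact_mod_cast hP0
  have hNP : N * oddPrimorial z = n := by rw [hN]; field_simp
  obtain ⟨ν, hν⟩ : ∃ ν : ℝ, ν = N / z := ⟨_, rfl⟩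
  have hz3 : (3 : ℝ) ≤ z := by exact_mod_cast hp.three_le
  have hνN : ν * z = N := by rw [hν]; field_simp
  rw [← hN] at hNE hNz hsum ⊢
  rw [← hν] at hNE hNz hsum
  simp_rw [← hLdef, ← hN] at hLc
  have hxy := h.x_le_y
  have hx0 := h.x_nonneg
  obtain ⟨X, hX⟩ : ∃ X, X = A \ (S ∪ R) := ⟨_, rfl⟩
  obtain ⟨Y, hY⟩ : ∃ Y, Y = Aᶜ \ S := ⟨_, rfl⟩
  have hle := h.le_add
  have hnot := h.le_of_notMem
  have hmem := h.le_of_mem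
  have hcard := h.card_le
  rw [hn] at hcard
  rw [← hX] at hcard ⊢
  simp_rw [← hX, ← hY] at hle hnot hmem ⊢
  have hXS : ∀ v ∈ X, v ∉ S := fun v hv hs => by
    rw [hX] at hv
    exact (mem_sdiff.1 hv).2 (mem_union_left _ hs)
  have hYS : ∀ v ∈ Y, v ∉ S := fun v hv => by
    rw [hY] at hv
    exact (mem_sdiff.1 hv).2
  have hclass : ∀ r, ∑ w ∈ X with cls w = r, #{v ∈ Y | Linked par v w} ≤
      #{v ∈ X | cls v = r} + #{v ∈ Y | cls v = r} := by
    intro r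
    refine le_trans (le_of_eq ?_) (sum_linked_le par _ _)
    refine sum_congr rfl fun w hw => ?_
    congr 1
    ext v
    obtain ⟨hw1, hw2⟩ := mem_filter.1 hw
    simp only [mem_filter]
    constructor
    · rintro ⟨h1, h2⟩
      exact ⟨⟨h1, (h.cls_eq v w h2 (hYS v h1) (hXS w hw1)).trans hw2⟩, h2⟩
    · rintro ⟨⟨h1, -⟩, h2⟩
      exact ⟨h1, h2⟩
  obtain ⟨main, sur, f, h1, h2, h3, h4, h5, h6, h7, h8, h9⟩ := exists_labelling_with_overflow X
    (fun w => #{v ∈ Y | Linked par v w}) cls (fun l => (l : ZMod (oddPrimorial z))) L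
    (fun r l hl => by
      rw [hLdef] at hl
      exact (mem_filter.1 (mem_sdiff.1 hl).1).2.2) F (K := 4 * oddPrimorial z) (T := T)
    (fun v hv => by
      refine (card_le_card fun w hw => ?_).trans (h.degree_le v (hXS v hv))
      obtain ⟨hw1, hw2⟩ := mem_filter.1 hw
      exact mem_filter.2 ⟨mem_univ _, hYS w hw1, hw2.symm⟩)
    (fun r => by
      have h1 : 9 * #{v ∈ X | cls v = r ∧ 8 < #{u ∈ Y | Linked par u v}} ≤
          ∑ w ∈ X with cls w = r, #{v ∈ Y | Linked par v w} := by
        rw [mul_comm, ← smul_eq_mul]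
        refine (card_nsmul_le_sum _ (fun v => #{u ∈ Y | Linked par u v}) 9 fun v hv => ?_).trans
          (sum_le_sum_of_subset fun v hv => ?_)
        · exact (mem_filter.1 hv).2.2
        · exact mem_filter.2 ⟨(mem_filter.1 hv).1, (mem_filter.1 hv).2.1⟩
      have h2 := h1.trans (hclass r)
      have h3 : (9 * #{v ∈ X | cls v = r ∧ 8 < #{u ∈ Y | Linked par u v}} : ℝ) ≤
        #{v ∈ X | cls v = r} + #{v ∈ Y | cls v = r} := by exact_mod_cast h2
      have h4 := hle r
      have h5 := (hLc r).1
      have h6 : (#{v ∈ X | cls v = r ∧ 8 < #{u ∈ Y | Linked par u v}} : ℝ) ≤ #(L r) := by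
        linarith [h4.1, h4.2]
      exact_mod_cast h6)
    (fun r => by
      rw [hLdef]
      refine le_mul_card_oddClass_sdiff h2P r _ (fun l hl => ?_) le_rfl ?_
      · obtain ⟨v, hv, rfl⟩ := mem_image.1 hl
        rw [← hn]
        exact h.special.lt_four_mul v (mem_union.1 hv)
      · have h1 : (16 * oddPrimorial z * (#((S ∪ R).image f₀) + 1) : ℝ) ≤ n := by
          rw [← hNP, mul_comm N, mul_comm (16 : ℝ), mul_assoc]
          gcongr
          linarith
        exact_mod_cast h1)
    (by
      refine sum_tsub_le_of_balanced F (fun r => #{v ∈ X | cls v = r}) (fun r => #(L r))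
        (ε := 10 * E) (D := N / 20) ?_ ?_ (by linarith) (by linarith) ?_ ?_
      · rw [← card_eq_sum_card_fiberwise (fun _ _ => mem_coe.2 (mem_univ _))]
        refine hcard.trans (le_of_eq ?_)
        refine (card_eq_sum_card_fiberwise (f := fun l : ℕ => (l : ZMod (oddPrimorial z)))
          (t := univ) fun _ _ => mem_coe.2 (mem_univ _)).trans ?_
        refine sum_congr rfl fun r _ => ?_
        congr 1
        ext l
        rw [hLdef]
        simp only [oddClass, mem_filter, mem_sdiff, mem_image, mem_union, not_exists, not_and]
        tauto
      · intro r hr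
        have h1 := hmem r hr
        have h2 := (hLc r).1
        linarith
      · intro r hr r' hr'
        linarith [(hnot r' hr').1, (hle r).1, (hLc r).1, (hLc r').2]
      · rw [ZMod.card]
        have h1 : (oddPrimorial z : ℝ) ≤ 20 * z * #F := by exact_mod_cast h.le_card_mul
        have h2 : (oddPrimorial z : ℝ) * (10 * E) ≤ 20 * z * #F * (10 * E) := by gcongr
        have h3 : (20 * z * #F * (10 * E) : ℝ) = #F * z * (200 * E) := by ring
        have h4 : (#F : ℝ) * z * (200 * E) ≤ #F * z * (ν / 20) := by
          gcongr
          linarith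
        have h5 : (#F : ℝ) * z * (ν / 20) = #F * (N / 20) := by rw [← hνN]; ring
        linarith)
  refine ⟨main, sur, f, h1, h2, h3, h4, h5, h6, h7, h8, fun r p hpp hpz => ?_⟩
  have h10 := h9 r p fun m => by
    have hp2 : Nat.Coprime p 2 := (Nat.coprime_primes hpp Nat.prime_two).2
      (by have := hp.three_le; omega)
    rw [hLdef]
    exact mul_card_oddClass_dvd_le h2P (coprime_oddPrimorial_of_lt hpp hpz) hp2 n m r _ sdiff_subset
  refine h10.trans (Nat.add_le_add_right (Nat.le_floor ?_) _)
  have h11 : ((2 * ∑ w ∈ X with cls w = r, #{v ∈ Y | Linked par v w} : ℕ) : ℝ) ≤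
      2 * (#{v ∈ X | cls v = r} + #{v ∈ Y | cls v = r}) := by
    exact_mod_cast (Nat.mul_le_mul_left 2 (hclass r) :)
  linarith [(hle r).1, (hle r).2]

end

section

variable {V : Type}

lemma not_isUnit_of_dvd {P p x : ℕ} (hp : p.Prime) (hpP : p ∣ P) (hx : p ∣ x) :
    ¬ IsUnit (x : ZMod P) := by
  rw [ZMod.isUnit_iff_coprime]
  exact fun h => hp.not_dvd_one (h ▸ Nat.dvd_gcd hx hpP)

lemma not_dvd_of_cast_eq_add_one {P p a b : ℕ} (hp : p.Prime) (hpP : p ∣ P) (ha : p ∣ a)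
    (h : (b : ZMod P) = a + 1) : ¬ p ∣ b := by
  intro hb
  have h1 : (b : ZMod P) = ((a + 1 : ℕ) : ZMod P) := by rw [h]; push_cast; rfl
  have h2 := ((ZMod.natCast_eq_natCast_iff _ _ _).1 h1).of_dvd hpP
  have h3 : p ∣ a + 1 := (h2.dvd_iff dvd_rfl).1 hb
  exact hp.not_dvd_one ((Nat.dvd_add_right ha).1 h3)

lemma exists_doubled_primes {z n T B : ℕ} {E : ℝ} (hp : LargeParams z n T B E) (H : Finset ℕ)
    (hH : (#H : ℝ) ≤ E) :
    ∃ Q : Finset ℕ, (∀ x ∈ Q, x ∈ Icc 1 n ∧ Even x ∧ x ∉ H ∧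
      IsUnit (x : ZMod (oddPrimorial z))) ∧
      (∀ p, p.Prime → z < p → #{x ∈ Q | p ∣ x} ≤ 1) ∧ (n : ℝ) / (2000 * z) ≤ #Q := by
  have hz3 := hp.three_le
  have hzn := hp.lt_order
  have hpr := hp.primes (n / 4) (by omega) (by omega)
  obtain ⟨Pr, hPr⟩ : ∃ Pr, Pr = {p ∈ Ioc (n / 4) (2 * (n / 4)) | p.Prime} := ⟨_, rfl⟩
  rw [← hPr] at hpr
  have hmem : ∀ q ∈ Pr, q.Prime ∧ n < 4 * q ∧ 2 * q ≤ n := fun q hq => by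
    rw [hPr, mem_filter, mem_Ioc] at hq
    exact ⟨hq.2, by omega, by omega⟩
  refine ⟨Pr.image (fun q => 2 * q) \ H, fun x hx => ?_, fun p hpp hpz => ?_, ?_⟩
  · obtain ⟨hx1, hx2⟩ := mem_sdiff.1 hx
    obtain ⟨q, hq, rfl⟩ := mem_image.1 hx1
    obtain ⟨h1, h2, h3⟩ := hmem q hq
    refine ⟨mem_Icc.2 ⟨by have := h1.one_lt; omega, h3⟩, even_two_mul q, hx2, ?_⟩
    rw [ZMod.isUnit_iff_coprime]
    exact Nat.Coprime.mul_left (coprime_two_oddPrimorial z)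
      (coprime_oddPrimorial_of_lt h1 (by omega))
  · refine card_le_one.2 fun a ha b hb => ?_
    have key : ∀ a ∈ ({x ∈ Pr.image (fun q => 2 * q) \ H | p ∣ x} : Finset ℕ), a = 2 * p := by
      intro a ha
      obtain ⟨ha1, ha2⟩ := mem_filter.1 ha
      obtain ⟨q, hq, rfl⟩ := mem_image.1 (mem_sdiff.1 ha1).1
      have h1 := (hmem q hq).1
      rcases (Nat.Prime.dvd_mul hpp).1 ha2 with h2 | h2
      · have := Nat.le_of_dvd (by norm_num) h2
        omega
      · rw [(Nat.prime_dvd_prime_iff_eq hpp h1).1 h2]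
    rw [key a ha, key b hb]
  · obtain ⟨hE20, hNE, hNz⟩ := hp.order_pos
    have hzR : (3 : ℝ) ≤ z := by exact_mod_cast hz3
    have hPR : (1 : ℝ) ≤ oddPrimorial z := by exact_mod_cast oddPrimorial_pos z
    have h1 : #Pr - #H ≤ #(Pr.image (fun q => 2 * q) \ H) := by
      have h2 := le_card_sdiff H (Pr.image fun q => 2 * q)
      rwa [card_image_of_injective _ fun a b h => by simpa using h] at h2
    have h2 : (#Pr : ℝ) ≤ #(Pr.image (fun q => 2 * q) \ H) + #H := by exact_mod_cast (by omega)
    have h3 : (n : ℝ) ≤ 1000 * z * #Pr := by exact_mod_cast hpr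
    have h4 : (n : ℝ) / oddPrimorial z / z ≤ n / z := by
      gcongr
      exact div_le_self (Nat.cast_nonneg n) hPR
    have h5 : (n : ℝ) / z ≤ 1000 * #Pr := by
      rw [div_le_iff₀ (by linarith)]
      linarith
    have h6 : (n : ℝ) / (2000 * z) = n / z / 2000 := by field_simp
    rw [h6]
    linarith

set_option maxHeartbeats 1600000 in
open Classical in
theorem Preparation.exists_coprime_labelling [Fintype V] {par : V → Option V} {z T B n : ℕ}
    {E x y : ℝ} {A S R : Finset V} {F : Finset (ZMod (oddPrimorial z))}
    {cls : V → ZMod (oddPrimorial z)} {f₀ : V → ℕ} (hn : Fintype.card V = n)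
    (hp : LargeParams z n T B E) (h : Preparation par z T E x y A S R F cls f₀) :
    ∃ g : V → ℕ, Function.Injective g ∧ (∀ v, g v ∈ Icc 1 n) ∧
      ∀ u v, Linked par u v → Nat.Coprime (g u) (g v) := by
  obtain ⟨L, hLdef⟩ : ∃ L : ZMod (oddPrimorial z) → Finset ℕ,
    ∀ r, L r = oddClass n r \ (S ∪ R).image f₀ := ⟨_, fun _ => rfl⟩
  obtain ⟨main, sur, f₁, hdisj, hun, hinj₁, hmain, hsur, hsur8, hmainc, hsurc, hM⟩ :=
    exists_odd_labelling hn hp h L hLdef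
  have hsp := h.special
  rw [hn] at hsp
  have h2P := coprime_two_oddPrimorial z
  have hLmem : ∀ r, ∀ l ∈ L r, l ∈ Icc 1 n ∧ Odd l ∧ (l : ZMod (oddPrimorial z)) = r ∧
      ∀ v, v ∈ S ∨ v ∈ R → f₀ v ≠ l := by
    intro r l hl
    rw [hLdef, mem_sdiff] at hl
    obtain ⟨h1, h2, h3⟩ := mem_filter.1 hl.1
    exact ⟨h1, h2, h3, fun v hv he => hl.2 (mem_image.2 ⟨v, mem_union.2 hv, he⟩)⟩
  obtain ⟨X, hX⟩ : ∃ X, X = A \ (S ∪ R) := ⟨_, rfl⟩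
  obtain ⟨Y, hY⟩ : ∃ Y, Y = Aᶜ \ S := ⟨_, rfl⟩
  rw [← hX] at hun hinj₁
  have hmX : ∀ v ∈ main, v ∈ X := fun v hv => hun ▸ mem_union_left _ hv
  have hsX : ∀ v ∈ sur, v ∈ X := fun v hv => hun ▸ mem_union_right _ hv
  have hXA : ∀ v ∈ X, v ∈ A ∧ v ∉ S ∧ v ∉ R := fun v hv => by
    rw [hX, mem_sdiff, mem_union] at hv
    tauto
  have hYA : ∀ v, v ∈ Y ↔ v ∉ A ∧ v ∉ S := fun v => by
    rw [hY, mem_sdiff, mem_compl]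
  have hRA : ∀ v ∈ R, v ∈ A ∧ v ∉ S := fun v hv => mem_sdiff.1 (h.subset hv)
  have hcases : ∀ v, v ∉ Y → (v ∈ S ∨ v ∈ R) ∨ v ∈ X := fun v hv => by
    rw [hYA] at hv
    rw [hX, mem_sdiff, mem_union]
    tauto
  have hXL : ∀ v ∈ X, ∃ r, f₁ v ∈ L r ∧ (r = cls v ∨ IsUnit r) := by
    intro v hv
    rw [← hun, mem_union] at hv
    rcases hv with hv | hv
    · exact ⟨_, hmain v hv, Or.inl rfl⟩
    · obtain ⟨r, hr, hrL⟩ := hsur v hv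
      exact ⟨r, hrL, Or.inr (mem_filter.1 (h.subset_unitPairs hr)).2.1⟩
  obtain ⟨f, hfS, hfX⟩ : ∃ f : V → ℕ, (∀ v, v ∈ S ∨ v ∈ R → f v = f₀ v) ∧
      ∀ v ∈ X, f v = f₁ v := by
    refine ⟨fun v => if v ∈ S ∨ v ∈ R then f₀ v else f₁ v, fun v hv => by simp [hv],
      fun v hv => ?_⟩
    have h1 : ¬ (v ∈ S ∨ v ∈ R) := by have := hXA v hv; tauto
    simp [h1]
  have hfXL : ∀ v ∈ X, f v ∈ Icc 1 n ∧ Odd (f v) ∧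
      ((f v : ZMod (oddPrimorial z)) = cls v ∨ IsUnit (f v : ZMod (oddPrimorial z))) ∧
      ∀ u, u ∈ S ∨ u ∈ R → f₀ u ≠ f v := by
    intro v hv
    rw [hfX v hv]
    obtain ⟨r, h1, h2⟩ := hXL v hv
    obtain ⟨h3, h4, h5, h6⟩ := hLmem r _ h1
    exact ⟨h3, h4, by rw [h5]; exact h2, h6⟩
  have hfIcc : ∀ v, v ∉ Y → f v ∈ Icc 1 n := by
    intro v hv
    rcases hcases v hv with h1 | h1
    · rw [hfS v h1]
      exact hsp.mem_Icc v h1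
    · exact (hfXL v h1).1
  have hfinj : Set.InjOn f (Yᶜ : Finset V) := by
    intro u hu v hv huv
    rw [mem_coe, mem_compl] at hu hv
    rcases hcases u hu with h1 | h1 <;> rcases hcases v hv with h2 | h2
    · rw [hfS u h1, hfS v h2] at huv
      exact hsp.injOn h1 h2 huv
    · rw [hfS u h1] at huv
      exact absurd huv ((hfXL v h2).2.2.2 u h1)
    · rw [hfS v h2] at huv
      exact absurd huv.symm ((hfXL u h1).2.2.2 v h2)
    · rw [hfX u h1, hfX v h2] at huv
      exact hinj₁ h1 h2 huv
  obtain ⟨Λ, hΛ⟩ : ∃ Λ, Λ = Icc 1 n \ Yᶜ.image f := ⟨_, rfl⟩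
  have hΛmem : ∀ l, l ∈ Λ ↔ l ∈ Icc 1 n ∧ ∀ v, v ∉ Y → f v ≠ l := fun l => by
    rw [hΛ, mem_sdiff, mem_image]
    simp only [mem_compl, not_exists, not_and]
  have hYΛ : #Y = #Λ := by
    have h1 : Yᶜ.image f ⊆ Icc 1 n := fun l hl => by
      obtain ⟨v, hv, rfl⟩ := mem_image.1 hl
      exact hfIcc v (mem_compl.1 hv)
    have h2 := card_compl Y
    have h3 := card_le_univ Y
    rw [hΛ, card_sdiff_of_subset h1, card_image_of_injOn hfinj, Nat.card_Icc, h2, hn]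
    rw [hn] at h3
    omega
  obtain ⟨hE20, hNE, hNz⟩ := hp.order_pos
  have hsum1 := h.le_sum
  have hsum2 := h.sum_le
  rw [hn] at hsum1 hsum2
  have hHc : (#((S ∪ R).image f₀) : ℝ) ≤ E / 4 :=
    le_trans (by exact_mod_cast card_image_le) h.card_special_le
  have hLc := fun r => card_oddClass_sdiff_bounds (n := n) h2P r ((S ∪ R).image f₀)
  simp_rw [← hLdef] at hLc
  have hCc := fun r => card_class_bounds (n := n) (P := oddPrimorial z) r
  have hmulE := hp.mul_error
  obtain ⟨Q, hQ1, hQ2, hQ3⟩ := exists_doubled_primes hp _ (hHc.trans (by linarith))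
  have hP0 : 0 < oddPrimorial z := oddPrimorial_pos z
  have hPR : (0 : ℝ) < oddPrimorial z := by exact_mod_cast hP0
  have hz3 : (3 : ℝ) ≤ z := by exact_mod_cast hp.three_le
  have hNP : (n : ℝ) / oddPrimorial z * oddPrimorial z = n := by field_simp
  have hfloor : ((⌊9 * ((n : ℝ) / oddPrimorial z)⌋₊ : ℕ) : ℝ) ≤ 9 * ((n : ℝ) / oddPrimorial z) :=
    Nat.floor_le (by positivity)
  obtain ⟨N, hN⟩ : ∃ N : ℝ, N = n / oddPrimorial z := ⟨_, rfl⟩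
  rw [← hN] at hNE hNz hsum1 hsum2 hmulE hNP hfloor hM
  simp_rw [← hN] at hLc hCc
  have e100 : N / (100 * z) = N / z / 100 := by field_simp
  have e1000 : N / (1000 * z) = N / z / 1000 := by field_simp
  obtain ⟨ν, hν⟩ : ∃ ν : ℝ, ν = N / z := ⟨_, rfl⟩
  rw [← hν] at hNE hNz hsum1 hsum2 e100 e1000
  have hle := h.le_add
  have hnot := h.le_of_notMem
  have hge := h.ge
  have hxy := h.x_le_y
  simp_rw [← hX, ← hY] at hle hnot hge hmainc hsurc hM hsur8
  have hfil : ∀ (Z : Finset V) (r : ZMod (oddPrimorial z)),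
      ({v ∈ Z | cls v + 1 = r} : Finset V) = {v ∈ Z | cls v = r - 1} := by
    intro Z r
    ext v
    simp only [mem_filter, eq_sub_iff_add_eq]
  have hnonunit : ∀ r : ZMod (oddPrimorial z), ¬ IsUnit r → r ∉ F ∧ r - 1 ∉ F := by
    intro r hr
    refine ⟨fun h1 => hr (mem_filter.1 (h.subset_unitPairs h1)).2.1, fun h1 => hr ?_⟩
    have := (mem_filter.1 (h.subset_unitPairs h1)).2.2
    rwa [sub_add_cancel] at this
  have hΛup : ∀ r : ZMod (oddPrimorial z),
      (#{l ∈ Λ | ((l : ℕ) : ZMod (oddPrimorial z)) = r} : ℝ) + #{v ∈ main | cls v = r} ≤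
        #{l ∈ Icc 1 n | ((l : ℕ) : ZMod (oddPrimorial z)) = r} := by
    intro r
    have h1 : #{v ∈ main | cls v = r} = #(({v ∈ main | cls v = r} : Finset V).image f) := by
      refine (card_image_of_injOn (hfinj.mono fun v hv => ?_)).symm
      have h2 := hXA v (hmX v (mem_filter.1 hv).1)
      rw [mem_coe, mem_compl, hYA]
      tauto
    rw [h1]
    norm_cast
    rw [← card_union_of_disjoint]
    · refine card_le_card fun l hl => ?_
      rcases mem_union.1 hl with hl | hl
      · obtain ⟨h2, h3⟩ := mem_filter.1 hl
        exact mem_filter.2 ⟨((hΛmem l).1 h2).1, h3⟩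
      · obtain ⟨v, hv, rfl⟩ := mem_image.1 hl
        obtain ⟨hv1, rfl⟩ := mem_filter.1 hv
        have h2 := hLmem _ _ (hmain v hv1)
        rw [← hfX v (hmX v hv1)] at h2
        exact mem_filter.2 ⟨h2.1, h2.2.2.1⟩
    · rw [disjoint_left]
      intro l hl hl'
      obtain ⟨v, hv, rfl⟩ := mem_image.1 hl'
      have h2 := hXA v (hmX v (mem_filter.1 hv).1)
      exact ((hΛmem _).1 (mem_filter.1 hl).1).2 v (by rw [hYA]; tauto) rfl
  have hΛlow : ∀ r : ZMod (oddPrimorial z), ¬ IsUnit r →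
      (#{l ∈ Icc 1 n | ((l : ℕ) : ZMod (oddPrimorial z)) = r} : ℝ) ≤
        #{l ∈ Λ | ((l : ℕ) : ZMod (oddPrimorial z)) = r} + #{v ∈ main | cls v = r} + E / 4 := by
    intro r hr
    have h1 : #{l ∈ Icc 1 n | ((l : ℕ) : ZMod (oddPrimorial z)) = r} ≤
        #{l ∈ Λ | ((l : ℕ) : ZMod (oddPrimorial z)) = r} + #{v ∈ main | cls v = r} +
          #((S ∪ R).image f₀) := by
      have h2 := card_image_le (s := ({v ∈ main | cls v = r} : Finset V)) (f := f)
      refine le_trans ?_ (Nat.add_le_add_right (Nat.add_le_add_left h2 _) _)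
      refine (card_le_card fun l hl => ?_).trans ((card_union_le _ _).trans
        (Nat.add_le_add_right (card_union_le _ _) _))
      obtain ⟨hl1, hl2⟩ := mem_filter.1 hl
      by_cases hlΛ : l ∈ Λ
      · exact mem_union_left _ (mem_union_left _ (mem_filter.2 ⟨hlΛ, hl2⟩))
      have h3 : ∃ v, v ∉ Y ∧ f v = l := by
        by_contra! hcon
        exact hlΛ ((hΛmem l).2 ⟨hl1, hcon⟩)
      obtain ⟨v, hv, rfl⟩ := h3
      rcases hcases v hv with h4 | h4
      · exact mem_union_right _ (mem_image.2 ⟨v, mem_union.2 h4, (hfS v h4).symm⟩)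
      · refine mem_union_left _ (mem_union_right _ (mem_image_of_mem _ (mem_filter.2 ?_)))
        have h5 := h4
        rw [← hun, mem_union] at h5
        rcases h5 with h5 | h5
        · have h6 := (hLmem _ _ (hmain v h5)).2.2.1
          rw [← hfX v h4] at h6
          exact ⟨h5, h6.symm.trans hl2⟩
        · obtain ⟨r', hr', h6⟩ := hsur v h5
          have h7 := (hLmem _ _ h6).2.2.1
          rw [← hfX v h4, hl2] at h7
          exact absurd (h7 ▸ (mem_filter.1 (h.subset_unitPairs hr')).2.1) hr
    have h2 : (#{l ∈ Icc 1 n | ((l : ℕ) : ZMod (oddPrimorial z)) = r} : ℝ) ≤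
        #{l ∈ Λ | ((l : ℕ) : ZMod (oddPrimorial z)) = r} + #{v ∈ main | cls v = r} +
          #((S ∪ R).image f₀) := by exact_mod_cast h1
    linarith
  have hmc : ∀ r, (#{v ∈ main | cls v = r} : ℝ) = min (#{v ∈ X | cls v = r} : ℝ) #(L r) := by
    intro r
    rw [hmainc]
    push_cast
    rfl
  have hcomp := exists_completion (V := V) (z := z) (n := n) (P := oddPrimorial z) (T := T) (B := B)
    (c := ⌊9 * N⌋₊) (N₀ := N) (E := E) (by have := hp.three_le; omega)
    (fun p hpp hpz => coprime_oddPrimorial_of_lt hpp hpz) hNP hmulE (by linarith) hp.degree_mul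
    hp.card_le hp.recip_le hp.sum_sq_le hp.sum_recip_le hfloor (Linked par) Y main sur hdisj f
    (fun w hw => (hfXL w (hun ▸ hw)).1) (fun v => cls v + 1)
    (fun v hv w hw hvw => by
      rw [hun] at hw
      rw [h.cls_eq v w hvw ((hYA v).1 hv).2 (hXA w hw).2.1])
    (fun r p hpp hpz => by
      refine le_trans (le_of_eq ?_) (hM (r - 1) p hpp hpz)
      congr 1
      refine sum_congr ?_ fun _ _ => rfl
      ext w
      simp only [mem_filter, eq_sub_iff_add_eq]
      refine and_congr_right fun hw => ?_
      rw [hfX w (hmX w hw)])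
    hsur8
    (fun r => by
      rw [hfil, hsurc, e100]
      have h1 := (hLc (r - 1)).1
      have h2 := (hle (r - 1)).1
      rcases le_total #{v ∈ X | cls v = r - 1} #(L (r - 1)) with h3 | h3
      · rw [Nat.sub_eq_zero_of_le h3]
        push_cast
        linarith
      · rw [Nat.cast_sub h3]
        linarith)
    (fun v hv => by
      rw [hun]
      refine (card_le_card fun w hw => ?_).trans (h.degree_le v ((hYA v).1 hv).2)
      obtain ⟨hw1, hw2⟩ := mem_filter.1 hw
      exact mem_filter.2 ⟨mem_univ _, (hXA w hw1).2.1, hw2⟩)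
    Λ (fun l hl => ((hΛmem l).1 hl).1) hYΛ
    (fun r hr => by
      have h1 := hΛlow r hr
      have h2 := (hCc r).1
      have h3 := hmc r
      have h4 := min_le_right (#{v ∈ X | cls v = r} : ℝ) #(L r)
      have h5 := (hLc r).2
      linarith)
    (fun r hr => by
      rw [hfil, e1000]
      have h1 := hΛup r
      have h2 := (hCc r).2
      have h3 := hmc r
      have h4 := (hnot r (hnonunit r hr).1).1
      have h5 := (hnot (r - 1) (hnonunit r hr).2).2
      have h6 := (hLc r).1
      rcases min_choice (#{v ∈ X | cls v = r} : ℝ) #(L r) with h7 | h7 <;> linarith)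
    (fun r hr => by
      rw [hfil, e100]
      have h1 := hΛlow r hr
      have h2 := (hCc r).1
      have h3 := hmc r
      have h4 := (hle (r - 1)).2
      have h5 := (hle r).1
      have h6 := min_le_left (#{v ∈ X | cls v = r} : ℝ) #(L r)
      linarith)
    (fun r hr => by
      rw [hfil]
      have := hge (r - 1)
      linarith)
    ((oddPrimorial_le_mul_card_unitPairs z (by have := hp.three_le; omega)).trans
      (Nat.mul_le_mul_left _ (card_le_card fun r hr =>
        mem_filter.2 ⟨mem_univ _, (mem_filter.1 hr).2.1⟩)))
    Q (fun l hl => by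
      obtain ⟨h1, h2, h3, -⟩ := hQ1 l hl
      refine (hΛmem l).2 ⟨h1, fun v hv he => ?_⟩
      rcases hcases v hv with h4 | h4
      · exact h3 (mem_image.2 ⟨v, mem_union.2 h4, (hfS v h4).symm.trans he⟩)
      · exact Nat.not_even_iff_odd.2 (hfXL v h4).2.1 (he ▸ h2))
    (fun l hl => (hQ1 l hl).2.2.2) hQ2 hQ3
  obtain ⟨g₁, hg₁i, hg₁⟩ := hcomp
  obtain ⟨g, hgY, hgN⟩ : ∃ g : V → ℕ, (∀ v ∈ Y, g v = g₁ v) ∧ ∀ v, v ∉ Y → g v = f v :=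
    ⟨fun v => if v ∈ Y then g₁ v else f v, fun v hv => by simp [hv], fun v hv => by simp [hv]⟩
  have hunused : ∀ v ∈ Y, ∀ u, u ∈ S ∨ u ∈ R → f₀ u ≠ g₁ v := by
    intro v hv u hu
    rw [← hfS u hu]
    refine ((hΛmem _).1 (hg₁ v hv).1).2 u ?_
    rw [hYA]
    have := hRA u
    tauto
  have hg₁Icc : ∀ v ∈ Y, g₁ v ∈ Icc 1 n := fun v hv => ((hΛmem _).1 (hg₁ v hv).1).1
  have key : ∀ u v, u ∈ A → v ∉ A → Linked par u v → Nat.Coprime (g u) (g v) := by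
    intro u v hu hv huv
    have huY : u ∉ Y := fun h1 => ((hYA u).1 h1).1 hu
    rw [hgN u huY]
    by_cases huS : u ∈ S
    · rw [hfS u (Or.inl huS)]
      by_cases hvS : v ∈ S
      · rw [hgN v fun h1 => ((hYA v).1 h1).2 hvS, hfS v (Or.inl hvS)]
        exact hsp.coprime u huS v (Or.inl hvS) huv
      · have hvY := (hYA v).2 ⟨hv, hvS⟩
        rw [hgY v hvY]
        exact hsp.coprime_of_mem u huS hu _ (hg₁Icc v hvY) (hunused v hvY)
    by_cases hvS : v ∈ S
    · rw [hgN v fun h1 => ((hYA v).1 h1).2 hvS, hfS v (Or.inl hvS), Nat.coprime_comm]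
      rcases hcases u huY with h1 | h1
      · rw [hfS u h1]
        exact hsp.coprime v hvS u h1 huv.symm
      · obtain ⟨h2, h3, -, h4⟩ := hfXL u h1
        exact hsp.coprime_of_notMem v hvS hv _ h2 h4 h3
    have hvY := (hYA v).2 ⟨hv, hvS⟩
    rw [hgY v hvY]
    obtain ⟨-, hgv, hgc⟩ := hg₁ v hvY
    have hcls := h.cls_eq u v huv huS hvS
    refine Nat.coprime_of_dvd fun p hpp hpu hpv => ?_
    rcases hcases u huY with h1 | h1
    · have huR := h1.resolve_left huS
      rw [hfS u h1] at hpu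
      have h3 := hsp.eq_three u huR _ (hg₁Icc v hvY) (hunused v hvY) p hpp hpu hpv
      have hpP : p ∣ oddPrimorial z := (prime_dvd_oddPrimorial hpp).2
        ⟨by have := hp.three_le; omega, by omega⟩
      rcases hgv with h4 | h4
      · refine not_dvd_of_cast_eq_add_one hpp hpP (dvd_zero p) ?_ hpv
        rw [h4, ← hcls, h.cls_zero u huR, Nat.cast_zero]
      · exact not_isUnit_of_dvd hpp hpP hpv h4
    · obtain ⟨h2, h3, h4, -⟩ := hfXL u h1
      by_cases hpz : p ≤ z
      · have hp2 : p ≠ 2 := by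
          rintro rfl
          exact Nat.not_even_iff_odd.2 h3 (even_iff_two_dvd.2 hpu)
        have hpP : p ∣ oddPrimorial z := (prime_dvd_oddPrimorial hpp).2 ⟨hpz, hp2⟩
        rcases hgv with h5 | h5
        · rcases h4 with h6 | h6
          · refine not_dvd_of_cast_eq_add_one hpp hpP hpu ?_ hpv
            rw [h5, h6, hcls]
          · exact not_isUnit_of_dvd hpp hpP hpu h6
        · exact not_isUnit_of_dvd hpp hpP hpv h5
      · exact hgc ⟨u, hun.symm ▸ h1, huv.symm, p, hpp, not_le.1 hpz, hpu, hpv⟩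
  refine ⟨g, ?_, ?_, ?_⟩
  · intro u v huv
    by_cases hu : u ∈ Y <;> by_cases hv : v ∈ Y
    · rw [hgY u hu, hgY v hv] at huv
      exact hg₁i hu hv huv
    · rw [hgY u hu, hgN v hv] at huv
      exact absurd huv.symm (((hΛmem _).1 (hg₁ u hu).1).2 v hv)
    · rw [hgN u hu, hgY v hv] at huv
      exact absurd huv (((hΛmem _).1 (hg₁ v hv).1).2 u hu)
    · rw [hgN u hu, hgN v hv] at huv
      exact hfinj (mem_coe.2 (mem_compl.2 hu)) (mem_coe.2 (mem_compl.2 hv)) huv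
  · intro v
    by_cases hv : v ∈ Y
    · rw [hgY v hv]
      exact hg₁Icc v hv
    · rw [hgN v hv]
      exact hfIcc v hv
  · intro u v huv
    have hb := h.bipartite u v huv
    by_cases hu : u ∈ A
    · exact key u v hu (hb.1 hu) huv
    · exact (key v u (by tauto) hu huv.symm).symm

end

lemma exists_equiv_of_injective {V : Type} [Fintype V] {g : V → ℕ} (hg : Function.Injective g)
    (hgn : ∀ v, g v ∈ Icc 1 (Fintype.card V)) :
    ∃ f : V ≃ Fin (Fintype.card V), ∀ v, (f v : ℕ) + 1 = g v := by
  have hg1 : ∀ v, 1 ≤ g v ∧ g v ≤ Fintype.card V := fun v => mem_Icc.1 (hgn v)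
  let f : V → Fin (Fintype.card V) := fun v => ⟨g v - 1, by have := hg1 v; omega⟩
  have hf : Function.Injective f := fun u v huv => hg <| by
    have h : g u - 1 = g v - 1 := congrArg Fin.val huv
    have := hg1 u
    have := hg1 v
    omega
  refine ⟨Equiv.ofBijective f ((Fintype.bijective_iff_injective_and_card f).2 ⟨hf, by simp⟩),
    fun v => ?_⟩
  exact Nat.sub_add_cancel (hg1 v).1

lemma LargeParams.isNeighborhoodPrime {V : Type} [Fintype V] {G : SimpleGraph V} {z T B : ℕ}
    {E : ℝ} (hp : LargeParams z (Fintype.card V) T B E) (hG : G.IsTree) :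
    G.IsNeighborhoodPrime := by
  obtain ⟨par, d, hd, hpar⟩ := exists_forest_of_isTree hG (le_trans (by norm_num) hp.sixteen_le)
  obtain ⟨x, y, A, S, R, F, cls, c, h⟩ := exists_preparation par d hd hp
  obtain ⟨g, hg, hgn, hgc⟩ := h.exists_coprime_labelling rfl hp
  obtain ⟨f, hf⟩ := exists_equiv_of_injective hg hgn
  refine hpar f fun u v huv => ?_
  rw [hf, hf]
  exact hgc u v (.inl huv)

lemma exists_exponent {z n : ℕ} (hn : 4 ^ (20 * z) ≤ n) :
    ∃ w ≥ z, 4 ^ (20 * w) ≤ n ∧ n ≤ 4 ^ (20 * (w + 1)) := by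
  have hn0 : n ≠ 0 := (lt_of_lt_of_le (by positivity) hn).ne'
  have hz : 20 * z ≤ Nat.log 4 n := Nat.le_log_of_pow_le (by norm_num) hn
  refine ⟨Nat.log 4 n / 20, by omega, ?_, ?_⟩
  · exact le_trans (Nat.pow_le_pow_right (by norm_num) (by omega)) (Nat.pow_log_le_self 4 hn0)
  · exact le_trans (Nat.lt_pow_succ_log_self (by norm_num) n).le
      (Nat.pow_le_pow_right (by norm_num) (by omega))

end NbhdPrime

/-- There exists a positive integer n' such that every tree on n ≥ n'
vertices is neighborhood-prime. -/
theorem exists_bound_tree_isNeighborhoodPrime :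
    ∃ n' : ℕ, 0 < n' ∧ ∀ (V : Type) [Fintype V] (G : SimpleGraph V),
      n' ≤ Fintype.card V → G.IsTree → G.IsNeighborhoodPrime := by
  obtain ⟨z, hz⟩ := Filter.eventually_atTop.1 NbhdPrime.eventually_largeParams
  refine ⟨4 ^ (20 * z), by positivity, fun V _ G hn hG => ?_⟩
  obtain ⟨w, hzw, h1, h2⟩ := NbhdPrime.exists_exponent hn
  obtain ⟨T, B, E, hp⟩ := hz w hzw _ h1 h2
  exact hp.isNeighborhoodPrime hG
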